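/- Let (R, m) be a regular local ring of dimension n containing a field, and let I be a proper ideal of R with ht_R(I) = d. Then inj.dim_R(H_I^d(R)) = dim_R(H_I^d(R)). -/

import Mathlib

open CategoryTheory Opposite

noncomputable section

/-- Krull dimension of the support of a module. -/
def moduleSuppDim (R : Type) [CommRing R] (M : Type) [AddCommGroup M] [Module R M] :
    WithBot ℕ∞ :=
  Order.krullDim (Module.support R M)

/-- `M` has injective dimension at most `n` (as `R`-module), characterized by
vanishing of `Ext^i(N, M)` for all `i > n`. -/
def injDimLE (R : Type) [CommRing R] (M : Type) [AddCommGroup M] [Module R M] (n : ℕ) : Prop :=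
  ∀ (N : ModuleCat R) (i : ℕ), n < i →
    Subsingleton (((Ext R (ModuleCat R) i).obj (op N)).obj (ModuleCat.of R M))

/-- The injective dimension of `M` as an `R`-module, valued in `ℕ∞`. -/
def injDim (R : Type) [CommRing R] (M : Type) [AddCommGroup M] [Module R M] : ℕ∞ :=
  sInf {n : ℕ∞ | ∃ m : ℕ, (m : ℕ∞) = n ∧ injDimLE R M m}

/-- The height of an ideal: the infimum of the heights of primes containing it. -/
def idealHeight (R : Type) [CommRing R] (I : Ideal R) : ℕ∞ :=
  sInf {h : ℕ∞ | ∃ p : PrimeSpectrum R, I ≤ p.asIdeal ∧ Order.height p = h}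

/-- A regular local ring: a Noetherian local ring whose maximal ideal can be generated
by `dim R` elements. -/
def IsRegularLocal (R : Type) [CommRing R] [IsLocalRing R] : Prop :=
  IsNoetherianRing R ∧
    ∃ s : Finset R, Ideal.span (s : Set R) = IsLocalRing.maximalIdeal R ∧
      (s.card : WithBot ℕ∞) = ringKrullDim R

/-- A ring contains a field if some subring of it is a field. -/
def ContainsField (R : Type) [CommRing R] : Prop :=
  ∃ k : Subring R, IsField k

/-- The underlying module of the `i`-th local cohomology of `R` with support in `I`. -/
abbrev LocalCohomologyMod (R : Type) [CommRing R] (I : Ideal R) (i : ℕ) : Type :=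
  (localCohomology I i).obj (ModuleCat.of R R)

end

section

open TensorProduct

namespace LyuB

section crys
variable {R B C : Type} [CommRing R] [CommRing B] [CommRing C] [Algebra R B] [Algebra R C]
  (ε : B →ₐ[R] C) (φ : R →+* B)

/-- A crystalline structure along `φ`. -/
def IsCrysMap {M : Type} [AddCommGroup M] [Module R M] (δ : M →ₛₗ[φ] B ⊗[R] M) : Prop :=
  ∀ m, ε.toLinearMap.rTensor M (δ m) = 1 ⊗ₜ m

lemma rT_smul {M : Type} [AddCommGroup M] [Module R M] (b : B) (z : B ⊗[R] M) :
    ε.toLinearMap.rTensor M (b • z) = ε b • ε.toLinearMap.rTensor M z := by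
  induction z using TensorProduct.induction_on with
  | zero => simp
  | tmul x y => simp [TensorProduct.smul_tmul']
  | add x y hx hy => simp only [smul_add, map_add, hx, hy]

lemma rT_baseChange {M N : Type} [AddCommGroup M] [Module R M] [AddCommGroup N] [Module R N]
    (f : M →ₗ[R] N) (z : B ⊗[R] M) :
    ε.toLinearMap.rTensor N (f.baseChange B z) = f.baseChange C (ε.toLinearMap.rTensor M z) := by
  induction z using TensorProduct.induction_on with
  | zero => simp
  | tmul x y => simp
  | add x y hx hy => simp only [map_add, hx, hy]

lemma crys_self (h : ∀ r, ε (φ r) = algebraMap R C r) :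
    ∃ δ : R →ₛₗ[φ] B ⊗[R] R, IsCrysMap ε φ δ := by
  refine ⟨{ toFun := fun r => φ r ⊗ₜ 1, map_add' := ?_, map_smul' := ?_ }, ?_⟩
  · intro x y; simp [TensorProduct.add_tmul]
  · intro r x; simp [TensorProduct.smul_tmul']
  · intro m
    show ε.toLinearMap.rTensor R (φ m ⊗ₜ 1) = _
    rw [LinearMap.rTensor_tmul, AlgHom.toLinearMap_apply, h]
    rw [Algebra.algebraMap_eq_smul_one, TensorProduct.smul_tmul]; simp

omit [Algebra R B] in
lemma lift_semi {M M' P : Type} [AddCommGroup M] [Module R M] [AddCommGroup M'] [Module R M']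
    [AddCommGroup P] [Module B P] (S : Submonoid R) (f : M →ₗ[R] M') [IsLocalizedModule S f]
    (g : M →ₛₗ[φ] P) (h : ∀ s : S, Function.Bijective (fun x : P => φ s • x)) :
    ∃ g' : M' →ₛₗ[φ] P, ∀ m, g' (f m) = g m := by
  let _ : Module R P := Module.compHom P φ
  have hs : ∀ (r : R) (x : P), r • x = φ r • x := fun r x => rfl
  let g0 : M →ₗ[R] P := { toFun := g, map_add' := map_add g, map_smul' := fun r x => by simp [hs] }
  have hu : ∀ s : S, IsUnit (algebraMap R (Module.End R P) s) := by
    intro s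
    rw [Module.End.isUnit_iff]
    exact h s
  refine ⟨{ toFun := IsLocalizedModule.lift S f g0 hu, map_add' := map_add _,
            map_smul' := fun r x => by simp [hs] }, fun m => ?_⟩
  simp [IsLocalizedModule.lift_apply, g0]

lemma bij_smul_of_nilp {P : Type} [AddCommGroup P] [Module B P] {a b : B}
    (hab : IsNilpotent (a - b)) (h : Function.Bijective (fun x : P => b • x)) :
    Function.Bijective (fun x : P => a • x) := by
  have h1 : IsUnit (algebraMap B (Module.End B P) b) := (Module.End.isUnit_iff _).2 h
  have h2 : IsNilpotent (algebraMap B (Module.End B P) (a - b)) := hab.map _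
  have h3 : IsUnit (algebraMap B (Module.End B P) b + algebraMap B (Module.End B P) (a-b)) :=
    IsNilpotent.isUnit_add_left_of_commute h2 h1 (Algebra.commutes _ _)
  rw [← map_add, add_sub_cancel] at h3
  exact (Module.End.isUnit_iff _).1 h3

lemma bij_tensor {M' D : Type} [AddCommGroup M'] [Module R M'] [CommRing D] [Algebra R D] {s : R}
    (h : Function.Bijective (fun x : M' => s • x)) :
    Function.Bijective (fun x : D ⊗[R] M' => algebraMap R D s • x) := by
  have h1 : IsUnit (algebraMap R (Module.End R M') s) := (Module.End.isUnit_iff _).2 h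
  obtain ⟨u, hu⟩ := h1
  have e : ∀ x : D ⊗[R] M', algebraMap R D s • x = (u : Module.End R M').lTensor D x := by
    intro x
    induction x using TensorProduct.induction_on with
    | zero => simp
    | tmul x y => simp [hu]
    | add x y hx hy => simp only [smul_add, map_add, hx, hy]
  simp_rw [e]
  have a1 : ∀ x : D ⊗[R] M', ((u⁻¹ : (Module.End R M')ˣ) : Module.End R M').lTensor D ((u : Module.End R M').lTensor D x) = x := by
    intro x
    rw [← LinearMap.comp_apply, ← LinearMap.lTensor_comp]
    have : ((u⁻¹ : (Module.End R M')ˣ) : Module.End R M') ∘ₗ (u : Module.End R M') = LinearMap.id := u.inv_mul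
    rw [this]; simp
  have a2 : ∀ x : D ⊗[R] M', (u : Module.End R M').lTensor D (((u⁻¹ : (Module.End R M')ˣ) : Module.End R M').lTensor D x) = x := by
    intro x
    rw [← LinearMap.comp_apply, ← LinearMap.lTensor_comp]
    have : (u : Module.End R M') ∘ₗ ((u⁻¹ : (Module.End R M')ˣ) : Module.End R M') = LinearMap.id := u.mul_inv
    rw [this]; simp
  exact ⟨Function.LeftInverse.injective a1, Function.RightInverse.surjective a2⟩

variable (hk : IsNilpotent (RingHom.ker ε)) (h : ∀ r, ε (φ r) = algebraMap R C r)
include hk h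

lemma crys_loc {M M' : Type} [AddCommGroup M] [Module R M] [AddCommGroup M'] [Module R M']
    (S : Submonoid R) (f : M →ₗ[R] M') [hf : IsLocalizedModule S f]
    (δ : M →ₛₗ[φ] B ⊗[R] M) (hδ : IsCrysMap ε φ δ) :
    ∃ δ' : M' →ₛₗ[φ] B ⊗[R] M', IsCrysMap ε φ δ' ∧ ∀ m, δ' (f m) = f.baseChange B (δ m) := by
  have hbM : ∀ s : S, Function.Bijective (fun x : M' => (s : R) • x) := fun s =>
    (Module.End.isUnit_iff _).1 (IsLocalizedModule.map_units f s)
  have hb : ∀ s : S, Function.Bijective (fun x : B ⊗[R] M' => φ s • x) := by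
    intro s
    refine bij_smul_of_nilp (P := B ⊗[R] M') (b := algebraMap R B s) ?_ (bij_tensor (D := B) (hbM s))
    obtain ⟨n, hn⟩ := hk
    refine ⟨n, ?_⟩
    have : (φ s - algebraMap R B s) ∈ RingHom.ker ε := by
      rw [RingHom.mem_ker, map_sub, h, AlgHom.commutes, sub_self]
    have := Ideal.pow_mem_pow this n
    rw [hn] at this
    simpa using this
  let g : M →ₛₗ[φ] B ⊗[R] M' := (f.baseChange B).comp δ
  obtain ⟨δ', h'⟩ := lift_semi φ S f g hb
  refine ⟨δ', ?_, fun m => h' m⟩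
  intro m'
  obtain ⟨⟨m, s⟩, hm⟩ := IsLocalizedModule.surj S f m'
  apply (bij_tensor (D := C) (hbM s)).1
  show algebraMap R C s • _ = algebraMap R C s • _
  have e1 : φ s • δ' m' = g m := by
    rw [← h', ← hm, Submonoid.smul_def, map_smulₛₗ]
  rw [← h, ← rT_smul, e1]
  show ε.toLinearMap.rTensor M' (f.baseChange B (δ m)) = _
  rw [rT_baseChange, hδ m]
  simp only [LinearMap.baseChange_tmul]
  rw [← hm, Submonoid.smul_def, h, algebraMap_smul, TensorProduct.tmul_smul]

omit hk h in
lemma crys_dsum {ι : Type} [DecidableEq ι] {N : ι → Type} [∀ i, AddCommGroup (N i)] [∀ i, Module R (N i)]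
    (δ : ∀ i, N i →ₛₗ[φ] B ⊗[R] N i) (hδ : ∀ i, IsCrysMap ε φ (δ i)) :
    ∃ δ' : (DirectSum ι N) →ₛₗ[φ] B ⊗[R] (DirectSum ι N), IsCrysMap ε φ δ' ∧
      ∀ i x, (DirectSum.component R ι N i).baseChange B (δ' x) = δ i (DirectSum.component R ι N i x) := by
  let g : (DirectSum ι N) →+ B ⊗[R] (DirectSum ι N) :=
    DirectSum.toAddMonoid fun i => (((DirectSum.lof R ι N i).baseChange B).comp (δ i)).toAddMonoidHom
  have hg : ∀ i x, g (DirectSum.lof R ι N i x) = (DirectSum.lof R ι N i).baseChange B (δ i x) := by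
    intro i x
    have := DirectSum.toAddMonoid_of (fun i => (((DirectSum.lof R ι N i).baseChange B).comp (δ i)).toAddMonoidHom) i x
    exact this
  let δ' : (DirectSum ι N) →ₛₗ[φ] B ⊗[R] (DirectSum ι N) :=
    { toFun := g, map_add' := map_add g, map_smul' := by
        intro r x
        induction x using DirectSum.induction_on with
        | zero => simp
        | of i x =>
          have : DirectSum.of N i x = DirectSum.lof R ι N i x := rfl
          rw [this, ← map_smul, hg, hg, map_smulₛₗ, map_smul]
        | add x y hx hy => rw [smul_add, map_add, hx, hy, map_add, smul_add] }
  refine ⟨δ', ?_, ?_⟩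
  · intro x
    induction x using DirectSum.induction_on with
    | zero => simp
    | of i x =>
      show ε.toLinearMap.rTensor _ (g (DirectSum.lof R ι N i x)) = _
      rw [hg, rT_baseChange, hδ]; rfl
    | add x y hx hy => rw [map_add, map_add, hx, hy, TensorProduct.tmul_add]
  · intro i x
    induction x using DirectSum.induction_on with
    | zero => simp
    | of j x =>
      show (DirectSum.component R ι N i).baseChange B (g (DirectSum.lof R ι N j x)) = δ i ((DirectSum.component R ι N i) (DirectSum.lof R ι N j x))
      rw [hg, ← LinearMap.comp_apply, ← LinearMap.baseChange_comp]
      by_cases hij : j = i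
      · subst hij
        have : DirectSum.component R ι N j ∘ₗ DirectSum.lof R ι N j = LinearMap.id := by
          ext y; simp [DirectSum.component.lof_self]
        rw [this, DirectSum.component.lof_self]; simp
      · have : DirectSum.component R ι N i ∘ₗ DirectSum.lof R ι N j = 0 := by
          ext y; simp [DirectSum.component.of, hij]
        have h2 : DirectSum.component R ι N i (DirectSum.lof R ι N j x) = 0 := by
          simp [DirectSum.component.of, hij]
        rw [this, h2]; simp
    | add x y hx hy => simp only [map_add, hx, hy]

omit hk h in
lemma crys_ker [Module.Flat R B] [Module.Flat R C] {M N : Type} [AddCommGroup M] [Module R M] [AddCommGroup N] [Module R N]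
    (f : M →ₗ[R] N) (δM : M →ₛₗ[φ] B ⊗[R] M) (δN : N →ₛₗ[φ] B ⊗[R] N)
    (hM : IsCrysMap ε φ δM) (hc : ∀ m, δN (f m) = f.baseChange B (δM m)) :
    ∃ δ : LinearMap.ker f →ₛₗ[φ] B ⊗[R] (LinearMap.ker f), IsCrysMap ε φ δ ∧
      ∀ m, (LinearMap.ker f).subtype.baseChange B (δ m) = δM m := by
  have hex : Function.Exact ((LinearMap.ker f).subtype.lTensor B) (f.lTensor B) :=
    Module.Flat.lTensor_exact B (LinearMap.exact_subtype_ker_map f)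
  have hinj : Function.Injective ((LinearMap.ker f).subtype.baseChange B) :=
    Module.Flat.lTensor_preserves_injective_linearMap (M := B) _ (Submodule.injective_subtype _)
  have hinjC : Function.Injective ((LinearMap.ker f).subtype.baseChange C) :=
    Module.Flat.lTensor_preserves_injective_linearMap (M := C) _ (Submodule.injective_subtype _)
  have : ∀ m : LinearMap.ker f, ∃ y, (LinearMap.ker f).subtype.baseChange B y = δM m := by
    intro m
    have : f.baseChange B (δM m) = 0 := by rw [← hc]; simp
    exact (hex _).1 this
  choose g hg using this
  refine ⟨{ toFun := g, map_add' := ?_, map_smul' := ?_ }, ?_, hg⟩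
  · intro x y; apply hinj; simp only [map_add, hg, Submodule.coe_add]
  · intro r x; apply hinj; simp only [map_smul, hg, Submodule.coe_smul, map_smulₛₗ]
  · intro m; apply hinjC
    rw [← rT_baseChange]
    simp only [LinearMap.coe_mk, AddHom.coe_mk, hg]
    rw [hM]; simp

omit hk h in
lemma crys_coker {M N : Type} [AddCommGroup M] [Module R M] [AddCommGroup N] [Module R N]
    (f : M →ₗ[R] N) (δM : M →ₛₗ[φ] B ⊗[R] M) (δN : N →ₛₗ[φ] B ⊗[R] N)
    (hN : IsCrysMap ε φ δN) (hc : ∀ m, δN (f m) = f.baseChange B (δM m)) :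
    ∃ δ : (N ⧸ LinearMap.range f) →ₛₗ[φ] B ⊗[R] (N ⧸ LinearMap.range f), IsCrysMap ε φ δ ∧
      ∀ m, (LinearMap.range f).mkQ.baseChange B (δN m) = δ ((LinearMap.range f).mkQ m) := by
  let g : N →ₛₗ[φ] B ⊗[R] (N ⧸ LinearMap.range f) := ((LinearMap.range f).mkQ.baseChange B).comp δN
  have hg : LinearMap.range f ≤ LinearMap.ker g := by
    rintro _ ⟨m, rfl⟩
    rw [LinearMap.mem_ker]
    show (LinearMap.range f).mkQ.baseChange B (δN (f m)) = 0
    rw [hc, ← LinearMap.comp_apply, ← LinearMap.baseChange_comp, LinearMap.range_mkQ_comp]; simp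
  refine ⟨(LinearMap.range f).liftQ g hg, ?_, fun m => ?_⟩
  · intro x
    obtain ⟨y, rfl⟩ := Submodule.mkQ_surjective _ x
    rw [Submodule.mkQ_apply, Submodule.liftQ_apply]
    show ε.toLinearMap.rTensor _ ((LinearMap.range f).mkQ.baseChange B (δN y)) = _
    rw [rT_baseChange, hN]; simp
  · rw [Submodule.mkQ_apply, Submodule.liftQ_apply]; rfl

omit hk h in
lemma crys_equiv {M N : Type} [AddCommGroup M] [Module R M] [AddCommGroup N] [Module R N]
    (e : M ≃ₗ[R] N) (δM : M →ₛₗ[φ] B ⊗[R] M) (hM : IsCrysMap ε φ δM) :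
    ∃ δ : N →ₛₗ[φ] B ⊗[R] N, IsCrysMap ε φ δ ∧
      ∀ m, δ (e m) = e.toLinearMap.baseChange B (δM m) := by
  refine ⟨(e.toLinearMap.baseChange B).comp (δM.comp e.symm.toLinearMap), ?_, ?_⟩
  · intro x
    show ε.toLinearMap.rTensor _ (e.toLinearMap.baseChange B (δM (e.symm x))) = _
    rw [rT_baseChange, hM]; simp
  · intro m
    show e.toLinearMap.baseChange B (δM (e.symm (e m))) = _
    simp

end crys

/-- `M` is crystalline: it has crystalline structures along all data. -/
def IsCrys (R : Type) [CommRing R] (M : Type) [AddCommGroup M] [Module R M] : Prop :=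
  ∀ (B C : Type) [CommRing B] [CommRing C] [Algebra R B] [Algebra R C] [Module.Flat R B]
    [Module.Flat R C] (ε : B →ₐ[R] C) (φ : R →+* B), IsNilpotent (RingHom.ker ε) →
    (∀ r, ε (φ r) = algebraMap R C r) → ∃ δ : M →ₛₗ[φ] B ⊗[R] M, IsCrysMap ε φ δ

section
variable {R : Type} [CommRing R] {M : Type} [AddCommGroup M] [Module R M]

lemma isCrys_self : IsCrys R R := by
  intro B C _ _ _ _ _ _ ε φ _ h
  exact crys_self ε φ h

lemma IsCrys.equiv {N : Type} [AddCommGroup N] [Module R N] (hM : IsCrys R M) (e : M ≃ₗ[R] N) :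
    IsCrys R N := by
  intro B C _ _ _ _ _ _ ε φ hk h
  obtain ⟨δ, hδ⟩ := hM B C ε φ hk h
  obtain ⟨δ', h1, -⟩ := crys_equiv ε φ e δ hδ
  exact ⟨δ', h1⟩

lemma IsCrys.loc {N : Type} [AddCommGroup N] [Module R N] (hM : IsCrys R M) (S : Submonoid R)
    (f : M →ₗ[R] N) [IsLocalizedModule S f] : IsCrys R N := by
  intro B C _ _ _ _ _ _ ε φ hk h
  obtain ⟨δ, hδ⟩ := hM B C ε φ hk h
  obtain ⟨δ', h1, -⟩ := crys_loc ε φ hk h S f δ hδ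
  exact ⟨δ', h1⟩

lemma crys_map_dsum {ι : Type} [DecidableEq ι] {N : ι → Type} [∀ i, AddCommGroup (N i)] [∀ i, Module R (N i)]
    (S : ι → Submonoid R) (f : M →ₗ[R] DirectSum ι N)
    (hf : ∀ i, IsLocalizedModule (S i) (DirectSum.component R ι N i ∘ₗ f))
    {B C : Type} [CommRing B] [CommRing C] [Algebra R B] [Algebra R C]
    (ε : B →ₐ[R] C) (φ : R →+* B)
    (hk : IsNilpotent (RingHom.ker ε)) (h : ∀ r, ε (φ r) = algebraMap R C r)
    (δ : M →ₛₗ[φ] B ⊗[R] M) (hδ : IsCrysMap ε φ δ) :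
    ∃ δN : DirectSum ι N →ₛₗ[φ] B ⊗[R] DirectSum ι N, IsCrysMap ε φ δN ∧
      ∀ m, δN (f m) = f.baseChange B (δ m) := by
  have := fun i => crys_loc ε φ hk h (S i) (DirectSum.component R ι N i ∘ₗ f) (hf := hf i) δ hδ
  choose δi h1 h2 using this
  obtain ⟨δN, h3, h4⟩ := crys_dsum ε φ δi h1
  refine ⟨δN, h3, fun m => ?_⟩
  apply (TensorProduct.directSumRight R R B N).injective
  refine DFinsupp.ext fun i => ?_
  have key : ∀ z : B ⊗[R] DirectSum ι N, (TensorProduct.directSumRight R R B N z) i = (DirectSum.component R ι N i).baseChange B z := by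
    intro z
    induction z using TensorProduct.induction_on with
    | zero => simp
    | tmul x y => 
      simp [DirectSum.component, TensorProduct.directSumRight_tmul]
      rfl
    | add x y hx hy => simp only [map_add, ← hx, ← hy]; rfl
  rw [key, key, h4]
  have := h2 i m
  rw [LinearMap.baseChange_comp] at this
  exact this

lemma IsCrys.ker_dsum (hM : IsCrys R M) {ι : Type} [DecidableEq ι] {N : ι → Type} [∀ i, AddCommGroup (N i)]
    [∀ i, Module R (N i)] (S : ι → Submonoid R) (f : M →ₗ[R] DirectSum ι N)
    (hf : ∀ i, IsLocalizedModule (S i) (DirectSum.component R ι N i ∘ₗ f)) :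
    IsCrys R (LinearMap.ker f) := by
  intro B C _ _ _ _ _ _ ε φ hk h
  obtain ⟨δ, hδ⟩ := hM B C ε φ hk h
  obtain ⟨δN, h1, h2⟩ := crys_map_dsum S f hf ε φ hk h δ hδ
  obtain ⟨δ', h3, -⟩ := crys_ker ε φ f δ δN hδ h2
  exact ⟨δ', h3⟩

lemma IsCrys.coker_dsum (hM : IsCrys R M) {ι : Type} [DecidableEq ι] {N : ι → Type} [∀ i, AddCommGroup (N i)]
    [∀ i, Module R (N i)] (S : ι → Submonoid R) (f : M →ₗ[R] DirectSum ι N)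
    (hf : ∀ i, IsLocalizedModule (S i) (DirectSum.component R ι N i ∘ₗ f)) :
    IsCrys R (DirectSum ι N ⧸ LinearMap.range f) := by
  intro B C _ _ _ _ _ _ ε φ hk h
  obtain ⟨δ, hδ⟩ := hM B C ε φ hk h
  obtain ⟨δN, h1, h2⟩ := crys_map_dsum S f hf ε φ hk h δ hδ
  obtain ⟨δ', h3, -⟩ := crys_coker ε φ f δ δN h1 h2
  exact ⟨δ', h3⟩

lemma IsCrys.coker_loc (hM : IsCrys R M) {N : Type} [AddCommGroup N]
    [Module R N] (S : Submonoid R) (f : M →ₗ[R] N) [IsLocalizedModule S f] :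
    IsCrys R (N ⧸ LinearMap.range f) := by
  intro B C _ _ _ _ _ _ ε φ hk h
  obtain ⟨δ, hδ⟩ := hM B C ε φ hk h
  obtain ⟨δN, h1, h2⟩ := crys_loc ε φ hk h S f δ hδ
  obtain ⟨δ', h3, -⟩ := crys_coker ε φ f δ δN h1 h2
  exact ⟨δ', h3⟩

end
end LyuB

end

section

open TensorProduct

namespace LyuB

lemma exists_assoc_colon {R : Type} [CommRing R] [IsNoetherianRing R] (J : Ideal R) (hJ : J ≠ ⊤) :
    ∃ b : R, ∃ q : Ideal R, q.IsPrime ∧ ∀ a, a ∈ q ↔ a * b ∈ J := by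
  have h1 : (1 : R ⧸ J) ≠ 0 := by
    intro h
    apply hJ
    rw [Ideal.eq_top_iff_one, ← Ideal.Quotient.eq_zero_iff_mem]
    exact h
  obtain ⟨P, hP, -⟩ := exists_le_isAssociatedPrime_of_isNoetherianRing R (1 : R ⧸ J) h1
  obtain ⟨hp, x, hx⟩ := Submodule.isAssociatedPrime_iff.1 hP
  obtain ⟨b, rfl⟩ := Ideal.Quotient.mk_surjective x
  refine ⟨b, P, hp, fun a => ?_⟩
  rw [hx, Submodule.mem_colon_singleton, Submodule.mem_bot, ← Ideal.Quotient.eq_zero_iff_mem, map_mul]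
  rfl

lemma baer_of_torsion {R : Type} [CommRing R] [IsNoetherianRing R] (p : Ideal R)
    {N : Type} [AddCommGroup N] [Module R N]
    (htors : ∀ x : N, ∃ k : ℕ, ∀ a ∈ p ^ k, a • x = 0)
    (hbij : ∀ s, s ∉ p → Function.Bijective (fun x : N => s • x))
    (hext : ∀ g : p →ₗ[R] N, ∃ n : N, ∀ a : p, g a = (a : R) • n) :
    Module.Baer R N := by
  intro I g
  -- kill a power
  have hk : ∃ k : ℕ, ∀ a ∈ p ^ k, ∀ x : I, a • g x = 0 := by
    obtain ⟨s, hs⟩ := (Module.Finite.fg_top : (⊤ : Submodule R I).FG)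
    choose kk hkk using fun x : I => htors (g x)
    refine ⟨s.sup kk, fun a ha x => ?_⟩
    have hx : x ∈ Submodule.span R (s : Set I) := by rw [hs]; trivial
    induction hx using Submodule.span_induction with
    | mem x hx => exact hkk x a (Ideal.pow_le_pow_right (Finset.le_sup hx) ha)
    | zero => simp
    | add x y _ _ hx hy => rw [map_add, smul_add, hx, hy, add_zero]
    | smul r x _ hx => rw [map_smul, smul_comm, hx, smul_zero]
  obtain ⟨k, hk⟩ := hk
  obtain ⟨c, hc⟩ := Ideal.exists_pow_inf_eq_pow_smul p (I : Submodule R R)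
  have hc2 := hc (k + c) (by omega)
  rw [Nat.add_sub_cancel] at hc2
  have hvan : ∀ x : I, (x : R) ∈ p ^ (k + c) → g x = 0 := by
    intro x hx
    have h1 : (x : R) ∈ p ^ k • (I : Submodule R R) := by
      have : (x : R) ∈ p ^ (k + c) • (⊤ : Submodule R R) ⊓ I := ⟨by simpa using hx, x.2⟩
      rw [hc2] at this
      exact Submodule.smul_mono le_rfl inf_le_right this
    have h2 : ∀ y ∈ p ^ k • (I : Submodule R R), ∀ hy : y ∈ I, g ⟨y, hy⟩ = 0 := by
      intro y hy
      induction hy using Submodule.smul_induction_on' with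
      | smul r hr n hn =>
        intro hy
        have : (⟨r • n, hy⟩ : I) = r • (⟨n, hn⟩ : I) := rfl
        rw [this, map_smul]; exact hk r hr _
      | add x hx y hy hx' hy' =>
        intro h
        have hxI := Submodule.smul_le_right hx
        have hyI := Submodule.smul_le_right hy
        have : (⟨x + y, h⟩ : I) = ⟨x, hxI⟩ + ⟨y, hyI⟩ := rfl
        rw [this, map_add, hx', hy', add_zero]
    exact h2 x h1 x.2
  let f0 : R →ₗ.[R] N := ⟨I, g⟩
  let f1 : R →ₗ.[R] N := ⟨p ^ (k + c), 0⟩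
  let f : R →ₗ.[R] N := f0.sup f1 (by
    intro x y hxy
    show g x = 0
    apply hvan
    rw [show ((x : R)) = y from hxy]; exact y.2)
  have hf0 : f0 ≤ f := LinearPMap.left_le_sup _ _ _
  have hfp : p ^ (k + c) ≤ f.domain := (LinearPMap.right_le_sup f0 f1 _).1
  obtain ⟨J, ⟨F, hF, rfl⟩, hmax⟩ := set_has_maximal_iff_noetherian.2 (inferInstance : IsNoetherian R R)
    {J | ∃ F : R →ₗ.[R] N, f ≤ F ∧ F.domain = J} ⟨_, f, le_rfl, rfl⟩
  have htop : F.domain = ⊤ := by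
    by_contra hne
    obtain ⟨b, q, hq, hqb⟩ := exists_assoc_colon F.domain hne
    have hbn : b ∉ F.domain := by
      intro hb
      exact hq.ne_top ((Ideal.eq_top_iff_one _).2 ((hqb 1).2 (by simpa using hb)))
    have hpq : p ≤ q := by
      have : p ^ (k + c) ≤ q := fun a ha => (hqb a).2 (Ideal.mul_mem_right _ _ (hF.1 (hfp ha)))
      exact hq.le_of_pow_le this
    have key : ∃ n : N, ∀ a : R, ∀ h : a * b ∈ F.domain, F ⟨a * b, h⟩ = a • n := by
      by_cases hqp : q ≤ p
      · have e : q = p := le_antisymm hqp hpq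
        subst e
        let G : q →ₗ[R] N :=
          { toFun := fun a => F ⟨a * b, (hqb a).1 a.2⟩
            map_add' := by
              intro x y
              rw [← F.map_add]; congr 1; ext; simp [add_mul]
            map_smul' := by
              intro r x
              rw [RingHom.id_apply, ← F.map_smul]; congr 1; ext; simp [mul_assoc] }
        obtain ⟨n, hn⟩ := hext G
        exact ⟨n, fun a h => hn ⟨a, (hqb a).2 h⟩⟩
      · obtain ⟨s, hs, hsp⟩ := Set.not_subset.1 hqp
        obtain ⟨n, hn⟩ := (hbij s hsp).2 (F ⟨s * b, (hqb s).1 hs⟩)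
        refine ⟨n, fun a h => (hbij s hsp).1 ?_⟩
        have hn' : s • n = _ := hn
        show s • F _ = s • a • n
        rw [smul_comm s, hn', ← F.map_smul, ← F.map_smul]
        congr 1; ext; simp; ring
    obtain ⟨n, hn⟩ := key
    let G : R →ₗ.[R] N := LinearPMap.mkSpanSingleton' b n (by
      intro a ha
      have hz : a * b = 0 := ha
      have := hn a (by rw [hz]; exact zero_mem _)
      rw [RingHom.id_apply, ← this]
      have e : (⟨a * b, by rw [hz]; exact zero_mem _⟩ : F.domain) = 0 := by ext; exact hz
      rw [e, F.map_zero])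
    have hcomp : ∀ (x : F.domain) (y : G.domain), (x : R) = y → F x = G y := by
      rintro ⟨x, hx⟩ ⟨y, hy⟩ (rfl : x = y)
      obtain ⟨a, rfl⟩ := Submodule.mem_span_singleton.1 (show x ∈ Submodule.span R {b} from hy)
      have := LinearPMap.mkSpanSingleton'_apply b n (σ := RingHom.id R) (by
        intro a ha
        have hz : a * b = 0 := ha
        have := hn a (by rw [hz]; exact zero_mem _)
        rw [RingHom.id_apply, ← this]
        have e : (⟨a * b, by rw [hz]; exact zero_mem _⟩ : F.domain) = 0 := by ext; exact hz
        rw [e, F.map_zero]) a hy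
      exact (hn a hx).trans this.symm
    apply hmax _ ⟨F.sup G hcomp, hF.trans (LinearPMap.left_le_sup _ _ _), rfl⟩
    refine lt_of_le_of_ne (LinearPMap.left_le_sup F G hcomp).1 fun he => hbn ?_
    rw [he]
    exact (LinearPMap.right_le_sup F G hcomp).1 (Submodule.mem_span_singleton_self b)
  refine ⟨F.toFun ∘ₗ (LinearMap.codRestrict F.domain LinearMap.id (by simp [htop])), ?_⟩
  intro x hx
  exact ((hf0.trans hF).2 (x := ⟨x, hx⟩) (y := ⟨x, _⟩) rfl).symm

end LyuB

end

section

open TensorProduct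

namespace LyuB

lemma IsCrys.baseChange {R : Type} [CommRing R] {M : Type} [AddCommGroup M] [Module R M]
    (hM : IsCrys R M) (S : Type) [CommRing S] [Algebra R S] [Module.Flat R S] :
    IsCrys S (S ⊗[R] M) := by
  intro B C _ _ _ _ _ _ ε φ hk h
  letI : Algebra R B := Algebra.compHom B (algebraMap R S)
  letI : Algebra R C := Algebra.compHom C (algebraMap R S)
  haveI : IsScalarTower R S B := IsScalarTower.of_algebraMap_eq fun r => rfl
  haveI : IsScalarTower R S C := IsScalarTower.of_algebraMap_eq fun r => rfl
  haveI : Module.Flat R B := Module.Flat.trans R S B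
  haveI : Module.Flat R C := Module.Flat.trans R S C
  obtain ⟨δ, hδ⟩ := hM B C (ε.restrictScalars R) (φ.comp (algebraMap R S)) hk
    (fun r => h _)
  let eB := AlgebraTensorModule.cancelBaseChange R S B B M
  let eC := AlgebraTensorModule.cancelBaseChange R S C C M
  let g : S ⊗[R] M →+ B ⊗[R] M := TensorProduct.liftAddHom
    { toFun := fun s => (DistribSMul.toAddMonoidHom _ (φ s)).comp δ.toAddMonoidHom
      map_zero' := by ext; simp
      map_add' := by intro x y; ext; simp [add_smul] } (by
    intro r s m
    simp [smul_smul, Algebra.smul_def, mul_comm])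
  have hg : ∀ s m, g (s ⊗ₜ m) = φ s • δ m := fun s m => rfl
  refine ⟨{ toFun := fun x => eB.symm (g x), map_add' := by intro x y; simp, map_smul' := ?_ }, ?_⟩
  · intro r x
    have : g (r • x) = φ r • g x := by
      induction x using TensorProduct.induction_on with
      | zero => simp
      | tmul s m => rw [TensorProduct.smul_tmul', hg, hg, smul_eq_mul, map_mul, mul_smul]
      | add x y hx hy => rw [smul_add, map_add, hx, hy, map_add, smul_add]
    rw [this, map_smul]
  · intro x
    have key : ∀ z : B ⊗[S] (S ⊗[R] M), eC (ε.toLinearMap.rTensor (S ⊗[R] M) z) =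
        (ε.restrictScalars R).toLinearMap.rTensor M (eB z) := by
      intro z
      induction z using TensorProduct.induction_on with
      | zero => simp
      | tmul b y =>
        induction y using TensorProduct.induction_on with
        | zero => simp
        | tmul s m => simp [eB, eC]
        | add x y hx hy => simp only [TensorProduct.tmul_add, map_add, hx, hy]
      | add x y hx hy => simp only [map_add, hx, hy]
    apply eC.injective
    show eC (ε.toLinearMap.rTensor (S ⊗[R] M) (eB.symm (g x))) = _
    rw [key, LinearEquiv.apply_symm_apply]
    induction x using TensorProduct.induction_on with
    | zero => simp
    | tmul s m => 
      rw [hg, rT_smul, hδ m]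
      simp [eC, h, TensorProduct.smul_tmul', Algebra.smul_def]
    | add x y hx hy => simp only [TensorProduct.tmul_add, map_add, hx, hy]

/-- Descent of solvability along a flat map. -/
lemma flat_descent {R : Type} [CommRing R] {M : Type} [AddCommGroup M] [Module R M]
    (p : Ideal R) (S : Type) [CommRing S] [Algebra R S] [Module.Flat R S]
    (hp : ∀ K : Ideal R, K.map (algebraMap R S) = ⊤ → ¬ K ≤ p)
    (hbij : ∀ s, s ∉ p → Function.Bijective (fun x : M => s • x))
    {ι : Type} [Finite ι] (a : ι → R) (g : ι → M)
    (hS : ∃ n : S ⊗[R] M, ∀ i, a i • n = 1 ⊗ₜ g i) :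
    ∃ n : M, ∀ i, a i • n = g i := by
  have := Fintype.ofFinite ι
  classical
  let F : M →ₗ[R] (ι → M) := LinearMap.pi fun i => a i • LinearMap.id
  let w : (ι → M) ⧸ LinearMap.range F := Submodule.Quotient.mk g
  let K : Ideal R := LinearMap.ker (LinearMap.toSpanSingleton R _ w)
  have hw : (1 : S) ⊗ₜ[R] w = 0 := by
    obtain ⟨n, hn⟩ := hS
    have e1 : (1 : S) ⊗ₜ[R] g = F.lTensor S n := by
      apply (TensorProduct.piRight R R S (fun _ : ι => M)).injective
      ext i
      have : ∀ n : S ⊗[R] M, (TensorProduct.piRight R R S (fun _ : ι => M)) (F.lTensor S n) i = a i • n := by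
        intro n
        induction n using TensorProduct.induction_on with
        | zero => simp
        | tmul s m => simp [F]
        | add x y hx hy => simp only [map_add, smul_add, ← hx, ← hy, Pi.add_apply]
      rw [this, hn]; simp
    have e2 : (1 : S) ⊗ₜ[R] w = (LinearMap.range F).mkQ.lTensor S ((1 : S) ⊗ₜ g) := by simp [w]
    rw [e2, e1, ← LinearMap.comp_apply, ← LinearMap.lTensor_comp, LinearMap.range_mkQ_comp]
    simp
  have hK : K.map (algebraMap R S) = ⊤ := by
    have hex : Function.Exact ((Submodule.subtype K).lTensor S) ((LinearMap.toSpanSingleton R _ w).lTensor S) :=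
      Module.Flat.lTensor_exact S (LinearMap.exact_subtype_ker_map _)
    obtain ⟨y, hy⟩ := (hex ((1 : S) ⊗ₜ 1)).1 (by simpa using hw)
    have : ∀ y : S ⊗[R] K, TensorProduct.rid R S ((Submodule.subtype K).lTensor S y) ∈ K.map (algebraMap R S) := by
      intro y
      induction y using TensorProduct.induction_on with
      | zero => simp
      | tmul s m =>
        simp only [LinearMap.lTensor_tmul, TensorProduct.rid_tmul, Algebra.smul_def]
        exact Ideal.mul_mem_right _ _ (Ideal.mem_map_of_mem _ m.2)
      | add x y hx hy => simp only [map_add]; exact add_mem hx hy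
    rw [Ideal.eq_top_iff_one]
    have := this y
    rw [hy] at this
    simpa using this
  obtain ⟨s, hs, hsp⟩ := Set.not_subset.1 (hp K hK)
  have h1 : s • g ∈ LinearMap.range F := by
    rw [← Submodule.Quotient.mk_eq_zero, Submodule.Quotient.mk_smul]
    exact hs
  obtain ⟨n, hn⟩ := h1
  obtain ⟨n', hn'⟩ := (hbij s hsp).2 n
  refine ⟨n', fun i => (hbij s hsp).1 ?_⟩
  have := congrFun hn i
  simp only [F, LinearMap.pi_apply, LinearMap.smul_apply, LinearMap.id_apply, Pi.smul_apply] at this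
  show s • a i • n' = s • g i
  rw [← this, smul_comm]
  congr 1

end LyuB

end

section

open TensorProduct Polynomial

namespace LyuB

/-- truncated polynomials -/
abbrev Tr (S : Type) [CommRing S] (L : ℕ) : Type := AdjoinRoot (X ^ (L + 1) : S[X])

noncomputable def tr (S : Type) [CommRing S] (L : ℕ) : Tr S L := AdjoinRoot.root _

lemma tr_pow (S : Type) [CommRing S] (L : ℕ) : tr S L ^ (L + 1) = 0 := by
  rw [tr, AdjoinRoot.root, ← map_pow, AdjoinRoot.mk_self]

noncomputable def trε (S : Type) [CommRing S] (L : ℕ) : Tr S L →ₐ[S] S :=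
  AdjoinRoot.liftAlgHom _ (Algebra.ofId S S) 0 (by simp)

@[simp] lemma trε_t (S : Type) [CommRing S] (L : ℕ) : trε S L (tr S L) = 0 := by
  simp [trε, tr]

lemma tr_decomp (S : Type) [CommRing S] (L : ℕ) (b : Tr S L) :
    ∃ c, b = algebraMap S _ (trε S L b) + tr S L * c := by
  obtain ⟨f, rfl⟩ := AdjoinRoot.mk_surjective b
  refine ⟨AdjoinRoot.mk _ f.divX, ?_⟩
  have h1 := Polynomial.X_mul_divX_add f
  have : trε S L (AdjoinRoot.mk _ f) = f.coeff 0 := by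
    simp [trε, Polynomial.coeff_zero_eq_aeval_zero]
  rw [this]
  conv_lhs => rw [← h1, map_add, map_mul, AdjoinRoot.mk_C, add_comm]
  rfl

lemma tr_ker (S : Type) [CommRing S] (L : ℕ) : IsNilpotent (RingHom.ker (trε S L)) := by
  refine ⟨L + 1, ?_⟩
  have : RingHom.ker (trε S L) ≤ Ideal.span {tr S L} := by
    intro b hb
    obtain ⟨c, hc⟩ := tr_decomp S L b
    rw [RingHom.mem_ker] at hb
    rw [hb, map_zero, zero_add] at hc
    rw [hc]
    exact Ideal.mul_mem_right _ _ (Ideal.mem_span_singleton_self _)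
  have := Ideal.pow_right_mono this (L + 1)
  rw [Ideal.span_singleton_pow, tr_pow] at this
  simpa using this

instance (S : Type) [CommRing S] (L : ℕ) : Module.Free S (Tr S L) :=
  (monic_X_pow (L + 1)).free_adjoinRoot

lemma tr_functional (S : Type) [CommRing S] (L : ℕ) :
    ∃ l : Tr S L →ₗ[S] S, ∀ b, l (tr S L ^ L * b) = trε S L b := by
  refine ⟨(Polynomial.lcoeff S L) ∘ₗ (AdjoinRoot.modByMonicHom (monic_X_pow (L + 1))), fun b => ?_⟩
  obtain ⟨c, hc⟩ := tr_decomp S L b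
  have h1 : tr S L ^ L * b = trε S L b • tr S L ^ L := by
    conv_lhs => rw [hc]
    rw [mul_add, ← mul_assoc, ← pow_succ, tr_pow, zero_mul, add_zero, Algebra.smul_def, mul_comm]
  rw [h1, map_smul]
  suffices h : ((Polynomial.lcoeff S L) ∘ₗ (AdjoinRoot.modByMonicHom (monic_X_pow (L + 1)))) (tr S L ^ L) = 1 by
    rw [h]; simp
  nontriviality S
  have : tr S L ^ L = AdjoinRoot.mk _ (X ^ L) := by
    rw [map_pow]; rfl
  rw [this, LinearMap.comp_apply, AdjoinRoot.modByMonicHom_mk,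
    (Polynomial.modByMonic_eq_self_iff (monic_X_pow (L + 1))).2 (by
      rw [degree_X_pow, degree_X_pow]; exact_mod_cast Nat.lt_succ_self L)]
  simp

lemma rT_contract {S : Type} [CommRing S] {N : Type} [AddCommGroup N] [Module S N] {B : Type}
    [CommRing B] [Algebra S B] (l : B →ₗ[S] S) :
    ∃ ψ : B ⊗[S] N →ₗ[S] N, ∀ b n, ψ (b ⊗ₜ n) = l b • n :=
  ⟨(TensorProduct.lid S N).toLinearMap ∘ₗ l.rTensor N, fun b n => by simp⟩

lemma kash_step {S : Type} [CommRing S] {N : Type} [AddCommGroup N] [Module S N] (hN : IsCrys S N)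
    {ι : Type} (z : ι → S) (i : ι) (s : ℕ) (φ : S →+* Tr S s)
    (hε : ∀ r, trε S s (φ r) = r) (J : Set ι) (hJ : ∀ j ∈ J, φ (z j) = algebraMap S _ (z j))
    (hi : φ (z i) = algebraMap S _ (z i) + tr S s)
    (n : N) (hn : ∀ j ∈ J, z j • n = 0) (hs : z i ^ s • n = 0) :
    ∃ m, n = z i • m ∧ ∀ j ∈ J, z j • m = 0 := by
  obtain ⟨δ, hδ⟩ := hN (Tr S s) S (trε S s) φ (tr_ker S s) (fun r => hε r)
  obtain ⟨l, hl⟩ := tr_functional S s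
  obtain ⟨ψ, hψ⟩ := rT_contract (N := N) l
  have h1 : ∀ ξ : Tr S s ⊗[S] N, ψ (tr S s ^ s • ξ) = TensorProduct.lid S N ((trε S s).toLinearMap.rTensor N ξ) := by
    intro ξ
    induction ξ using TensorProduct.induction_on with
    | zero => simp
    | tmul b n => rw [TensorProduct.smul_tmul', hψ, smul_eq_mul, hl]; simp
    | add x y hx hy => simp only [smul_add, map_add, hx, hy]
  have h2 : TensorProduct.lid S N ((trε S s).toLinearMap.rTensor N (δ n)) = n := by
    rw [hδ n]; simp
  have h3 : ∃ c, (algebraMap S _ (z i) + tr S s) ^ s = tr S s ^ s + algebraMap S (Tr S s) (z i) * c := by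
    have : (algebraMap S (Tr S s) (z i)) ∣ (algebraMap S _ (z i) + tr S s) ^ s - tr S s ^ s := by
      have := sub_dvd_pow_sub_pow (algebraMap S (Tr S s) (z i) + tr S s) (tr S s) s
      simpa using this
    obtain ⟨c, hc⟩ := this
    exact ⟨c, by rw [← hc]; ring⟩
  obtain ⟨c, hc⟩ := h3
  have h4 : (0 : Tr S s ⊗[S] N) = tr S s ^ s • δ n + z i • (c • δ n) := by
    have : δ (z i ^ s • n) = _ := map_smulₛₗ δ (z i ^ s) n
    rw [hs, map_zero, map_pow, hi, hc, add_smul, mul_smul, algebraMap_smul] at this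
    exact this
  have h5 := congrArg ψ h4
  rw [map_zero, map_add, h1, h2, map_smul] at h5
  refine ⟨- ψ (c • δ n), ?_, fun j hj => ?_⟩
  · rw [smul_neg]; exact eq_neg_of_add_eq_zero_left h5.symm
  · have : δ (z j • n) = _ := map_smulₛₗ δ (z j) n
    rw [hn j hj, map_zero, hJ j hj, algebraMap_smul] at this
    rw [smul_neg, ← map_smul, smul_comm, ← this, smul_zero, map_zero, neg_zero]

lemma kash_closed {S : Type} [CommRing S] {N : Type} [AddCommGroup N] [Module S N] (hN : IsCrys S N)
    {e : ℕ} (z : Fin e → S) (m : Ideal S) (hm : m = Ideal.span (Set.range z))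
    (hφ : ∀ i s, ∃ φ : S →+* Tr S s, (∀ r, trε S s (φ r) = r) ∧
      (∀ j, j ≠ i → φ (z j) = algebraMap S _ (z j)) ∧ φ (z i) = algebraMap S _ (z i) + tr S s)
    (htors : ∀ x : N, ∃ k : ℕ, ∀ a ∈ m ^ k, a • x = 0)
    (g : m →ₗ[S] N) : ∃ n : N, ∀ a : m, g a = (a : S) • n := by
  have hz : ∀ i, z i ∈ m := fun i => hm ▸ Ideal.subset_span ⟨i, rfl⟩
  have key : ∀ k : ℕ, ∃ n : N, ∀ j : Fin e, (j : ℕ) < k → g ⟨z j, hz j⟩ = z j • n := by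
    intro k
    induction k with
    | zero => exact ⟨0, fun j hj => absurd hj (Nat.not_lt_zero _)⟩
    | succ k ih =>
      obtain ⟨n, hn⟩ := ih
      by_cases hk : k < e
      · let i : Fin e := ⟨k, hk⟩
        let w : N := g ⟨z i, hz i⟩ - z i • n
        obtain ⟨s, hs⟩ := htors w
        obtain ⟨φ, h1, h2, h3⟩ := hφ i s
        obtain ⟨m', hm1, hm2⟩ := kash_step hN z i s φ h1 {j | (j : ℕ) < k}
          (fun j hj => h2 j (by rintro rfl; exact lt_irrefl k hj)) h3 w
          (by
            intro j hj
            simp only [w]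
            have : z j • g ⟨z i, hz i⟩ = z i • g ⟨z j, hz j⟩ := by
              rw [← map_smul, ← map_smul]; congr 1; ext; simp [mul_comm]
            rw [smul_sub, this, hn j hj, smul_comm (z j), sub_self])
          (hs _ (Ideal.pow_mem_pow (hz i) s))
        refine ⟨n + m', fun j hj => ?_⟩
        rcases Nat.lt_succ_iff_lt_or_eq.1 hj with h | h
        · rw [smul_add, hm2 j h, add_zero, hn j h]
        · have : j = i := Fin.ext h
          subst this
          rw [smul_add, ← hm1]; simp [w]
      · exact ⟨n, fun j hj => hn j (by omega)⟩
  obtain ⟨n, hn⟩ := key e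
  refine ⟨n, ?_⟩
  have h : ∀ a ∈ Ideal.span (Set.range z), ∀ ha : a ∈ m, g ⟨a, ha⟩ = a • n := by
    intro a ha'
    induction ha' using Submodule.span_induction with
    | mem x hx =>
      intro ha
      obtain ⟨j, rfl⟩ := hx
      exact hn j j.2
    | zero => intro ha; rw [zero_smul]; exact map_zero g
    | add x y hx hy hx' hy' =>
      intro ha
      have hx : x ∈ m := hm ▸ hx
      have hy : y ∈ m := hm ▸ hy
      have : (⟨x + y, ha⟩ : m) = ⟨x, hx⟩ + ⟨y, hy⟩ := rfl
      rw [this, map_add, hx' hx, hy' hy, add_smul]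
    | smul r x hx hx' =>
      intro ha
      have hx : x ∈ m := hm ▸ hx
      have : (⟨r • x, ha⟩ : m) = r • ⟨x, hx⟩ := rfl
      rw [this, map_smul, hx' hx, smul_assoc]
  exact fun a => h a (hm ▸ a.2) a.2

/-- Injectivity of `M` from a good flat local extension. -/
lemma baer_of_ext {R : Type} [CommRing R] [IsNoetherianRing R] {M : Type} [AddCommGroup M] [Module R M]
    (hM : IsCrys R M) (p : Ideal R)
    (htors : ∀ x : M, ∃ k : ℕ, ∀ a ∈ p ^ k, a • x = 0)
    (hbij : ∀ s, s ∉ p → Function.Bijective (fun x : M => s • x))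
    (S : Type) [CommRing S] [IsNoetherianRing S] [IsLocalRing S] [Algebra R S] [Module.Flat R S]
    (hp : p.map (algebraMap R S) ≤ IsLocalRing.maximalIdeal S)
    {e : ℕ} (z : Fin e → S) (hm : IsLocalRing.maximalIdeal S = Ideal.span (Set.range z))
    (hφ : ∀ i s, ∃ φ : S →+* Tr S s, (∀ r, trε S s (φ r) = r) ∧
      (∀ j, j ≠ i → φ (z j) = algebraMap S _ (z j)) ∧ φ (z i) = algebraMap S _ (z i) + tr S s)
    (hrad : ∃ k, IsLocalRing.maximalIdeal S ^ k ≤ p.map (algebraMap R S)) :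
    Module.Baer R M := by
  refine baer_of_torsion p htors hbij fun g => ?_
  have hN := hM.baseChange S
  have hT : ∀ x : S ⊗[R] M, ∃ k : ℕ, ∀ a ∈ IsLocalRing.maximalIdeal S ^ k, a • x = 0 := by
    obtain ⟨k, hk⟩ := hrad
    intro x
    induction x using TensorProduct.induction_on with
    | zero => exact ⟨0, by simp⟩
    | tmul s x =>
      obtain ⟨l, hl⟩ := htors x
      refine ⟨k * l, fun a ha => ?_⟩
      rw [pow_mul] at ha
      have h1 := Ideal.pow_right_mono hk l ha
      rw [← Ideal.map_pow] at h1
      have : ∀ a ∈ (p ^ l).map (algebraMap R S), a • (s ⊗ₜ[R] x) = 0 := by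
        intro a ha
        refine Submodule.span_induction ?_ ?_ ?_ ?_ ha
        · rintro _ ⟨r, hr, rfl⟩
          rw [algebraMap_smul, ← TensorProduct.tmul_smul, hl r hr, TensorProduct.tmul_zero]
        · simp
        · intro x y _ _ hx hy; rw [add_smul, hx, hy, add_zero]
        · intro r x _ hx; rw [smul_assoc, hx, smul_zero]
      exact this a h1
    | add x y hx hy =>
      obtain ⟨k1, h1⟩ := hx
      obtain ⟨k2, h2⟩ := hy
      refine ⟨k1 + k2, fun a ha => ?_⟩
      rw [smul_add, h1 a (Ideal.pow_le_pow_right (by omega) ha), h2 a (Ideal.pow_le_pow_right (by omega) ha), add_zero]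
  have hbS : Module.Baer S (S ⊗[R] M) := by
    refine baer_of_torsion (IsLocalRing.maximalIdeal S) hT ?_ (kash_closed hN z _ hm hφ hT)
    intro s hs
    have hu : IsUnit s := by simpa using hs
    exact (Module.End.isUnit_iff _).1 (hu.map (algebraMap S (Module.End S (S ⊗[R] M))))
  -- extend `1 ⊗ g`
  let gS : S ⊗[R] p →ₗ[S] S ⊗[R] M := g.baseChange S
  let j : S ⊗[R] p →ₗ[S] S := 
    (TensorProduct.AlgebraTensorModule.rid R S S).toLinearMap ∘ₗ (Submodule.subtype p).baseChange S
  have hj : Function.Injective j := by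
    rw [LinearMap.coe_comp]
    refine (LinearEquiv.injective _).comp ?_
    exact Module.Flat.lTensor_preserves_injective_linearMap (M := S) _ (Submodule.injective_subtype _)
  let ej := LinearEquiv.ofInjective j hj
  obtain ⟨G, hG⟩ := hbS (LinearMap.range j) (gS ∘ₗ ej.symm.toLinearMap)
  have hG' : ∀ y, G (j y) = gS y := by
    intro y
    rw [hG (j y) ⟨y, rfl⟩]
    simp only [LinearMap.comp_apply, LinearEquiv.coe_coe]
    congr 1
    rw [LinearEquiv.symm_apply_eq]; rfl
  obtain ⟨t, ht⟩ := (IsNoetherian.noetherian (⊤ : Submodule R p))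
  obtain ⟨n, hn⟩ := flat_descent p S (by
      intro K hK hKp
      have := (Ideal.map_mono hKp).trans hp
      rw [hK] at this
      exact (IsLocalRing.maximalIdeal.isMaximal S).ne_top (top_le_iff.1 this)) hbij
    (fun i : t => ((i : p) : R)) (fun i : t => g i) ⟨G 1, fun i => by
      have := hG' (1 ⊗ₜ (i : p))
      simp only [j, gS, LinearMap.comp_apply, LinearMap.baseChange_tmul] at this
      rw [← this]
      simp only [Submodule.subtype_apply, LinearEquiv.coe_coe, TensorProduct.AlgebraTensorModule.rid_tmul]
      rw [← algebraMap_smul S, ← map_smul, Algebra.smul_def]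
      simp [Algebra.smul_def]⟩
  refine ⟨n, fun a => ?_⟩
  have ha : a ∈ Submodule.span R (t : Set p) := by rw [ht]; trivial
  induction ha using Submodule.span_induction with
  | mem x hx => exact (hn ⟨x, hx⟩).symm
  | zero => simp
  | add x y _ _ hx hy => rw [map_add, hx, hy, Submodule.coe_add, add_smul]
  | smul r x _ hx => rw [map_smul, hx, Submodule.coe_smul, smul_assoc]

end LyuB

end

section

open TensorProduct

namespace LyuB
section ps
open MvPowerSeries

lemma ps_mem_span {σ : Type} [Finite σ] {A : Type} [CommRing A] (f : MvPowerSeries σ A)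
    (hf : constantCoeff f = 0) : f ∈ Ideal.span (Set.range (X : σ → MvPowerSeries σ A)) := by
  classical
  have := Fintype.ofFinite σ
  have hne : ∀ d : σ →₀ ℕ, d ≠ 0 → ∃ i, d i ≠ 0 := fun d hd => by
    by_contra! h
    exact hd (Finsupp.ext h)
  let ch : (σ →₀ ℕ) → Option σ := fun d => if h : d ≠ 0 then some (hne d h).choose else none
  have hch : ∀ d i, ch d = some i → d i ≠ 0 := by
    intro d i h
    simp only [ch] at h
    split_ifs at h with h0
    simp only [Option.some.injEq] at h
    rw [← h]; exact (hne d h0).choose_spec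
  let g : σ → MvPowerSeries σ A := fun i d =>
    if ch (d + Finsupp.single i 1) = some i then coeff (d + Finsupp.single i 1) f else 0
  have hg : ∀ i d, coeff d (g i) = if ch (d + Finsupp.single i 1) = some i then coeff (d + Finsupp.single i 1) f else 0 := fun i d => rfl
  have : f = ∑ i, X i * g i := by
    ext d
    rw [map_sum]
    have h1 : ∀ i, coeff d (X i * g i) = if ch d = some i then coeff d f else 0 := by
      intro i
      rw [X_def, coeff_monomial_mul]
      by_cases hd : Finsupp.single i 1 ≤ d
      · rw [if_pos hd, hg, tsub_add_cancel_of_le hd, one_mul]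
      · rw [if_neg hd, if_neg]
        intro h
        apply hd
        have := hch d i h
        rw [Finsupp.single_le_iff]; omega
    simp_rw [h1]
    by_cases h0 : d = 0
    · have : ch d = none := by simp [ch, h0]
      simp only [this]
      rw [h0]
      simpa using hf
    · have : ch d = some (hne d h0).choose := by simp [ch, h0]
      rw [this]
      simp
  rw [this]
  exact Ideal.sum_mem _ fun i _ => Ideal.mul_mem_right _ _ (Ideal.subset_span ⟨i, rfl⟩)

lemma ps_decomp {σ : Type} [Finite σ] {A : Type} [CommRing A] (f : MvPowerSeries σ A) :
    ∃ y ∈ Ideal.span (Set.range (X : σ → MvPowerSeries σ A)), f = C (constantCoeff f) + y :=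
  ⟨f - C (constantCoeff f), ps_mem_span _ (by simp), by ring⟩

lemma ps_hom_ext {σ : Type} [Finite σ] {A S : Type} [CommRing A] [CommRing S] (J : Ideal S)
    (hH : ∀ x, (∀ n, x ∈ J ^ n) → x = 0) (F G : MvPowerSeries σ A →+* S)
    (hC : ∀ a, F (C a) = G (C a)) (hX : ∀ i, F (X i) = G (X i)) (hJ : ∀ i, F (X i) ∈ J) : F = G := by
  have key : ∀ n f, F f - G f ∈ J ^ n := by
    intro n
    induction n with
    | zero => intro f; simp
    | succ n ih =>
      intro f
      obtain ⟨y, hy, hf⟩ := ps_decomp f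
      have h2 : ∀ y ∈ Ideal.span (Set.range (X : σ → MvPowerSeries σ A)), F y - G y ∈ J ^ (n + 1) := by
        intro y hy
        induction hy using Submodule.span_induction with
        | mem x hx => obtain ⟨i, rfl⟩ := hx; rw [hX, sub_self]; exact zero_mem _
        | zero => simp
        | add x y _ _ hx hy =>
          have : F (x + y) - G (x + y) = (F x - G x) + (F y - G y) := by simp only [map_add]; ring
          rw [this]; exact add_mem hx hy
        | smul r x hx hx' =>
          have h3 : F x ∈ J := by
            have : Ideal.span (Set.range (X : σ → MvPowerSeries σ A)) ≤ J.comap F := by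
              rw [Ideal.span_le]; rintro _ ⟨i, rfl⟩; exact hJ i
            exact this hx
          have : F (r • x) - G (r • x) = (F r - G r) * F x + G r * (F x - G x) := by
            simp only [smul_eq_mul, map_mul]; ring
          rw [this, pow_succ]
          exact add_mem (Ideal.mul_mem_mul (ih r) h3) (by rw [← pow_succ]; exact Ideal.mul_mem_left _ _ hx')
      rw [hf]
      have : F (C (constantCoeff f) + y) - G (C (constantCoeff f) + y) = F y - G y := by
        simp only [map_add, hC]; ring
      rw [this]
      exact h2 y hy
  ext f
  exact sub_eq_zero.1 (hH _ fun n => key n f)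

lemma exists_nev {σ : Type} [Finite σ] {A B : Type} [CommRing A] [CommRing B] (g : A →+* B)
    (ε : σ → B) (N : ℕ) (hN : Ideal.span (Set.range ε) ^ N = ⊥) :
    ∃ F : MvPowerSeries σ A →+* B, (∀ a, F (C a) = g a) ∧ ∀ i, F (X i) = ε i := by
  let q : MvPolynomial σ A ⧸ (MvPolynomial.idealOfVars σ A) ^ N →+* B :=
    Ideal.Quotient.lift _ (MvPolynomial.eval₂Hom g ε) (by
      have : (MvPolynomial.idealOfVars σ A) ^ N ≤ RingHom.ker (MvPolynomial.eval₂Hom g ε) := by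
        rw [RingHom.ker_eq_comap_bot, ← Ideal.map_le_iff_le_comap, Ideal.map_pow, ← hN]
        apply Ideal.pow_right_mono
        rw [MvPolynomial.idealOfVars, Ideal.map_span, Ideal.span_le]
        rintro _ ⟨_, ⟨i, rfl⟩, rfl⟩
        simp only [MvPolynomial.coe_eval₂Hom, MvPolynomial.eval₂_X]
        exact Ideal.subset_span ⟨i, rfl⟩
      intro a ha; exact this ha)
  have key : ∀ p : MvPolynomial σ A, truncTotalAlgHom σ A N (p : MvPowerSeries σ A) = Ideal.Quotient.mk _ p := by
    intro p
    have := (truncTotalAlgHom σ A N).commutes p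
    exact this
  refine ⟨q.comp (truncTotalAlgHom σ A N : MvPowerSeries σ A →+* _), fun a => ?_, fun i => ?_⟩
  · rw [RingHom.comp_apply, ← MvPolynomial.coe_C]
    erw [key]
    exact (Ideal.Quotient.lift_mk _ _ _).trans (by simp)
  · rw [RingHom.comp_apply, ← MvPolynomial.coe_X]
    erw [key]
    exact (Ideal.Quotient.lift_mk _ _ _).trans (by simp)

open scoped MvPowerSeries.WithPiTopology in
lemma exists_ev_taylor {σ τ : Type} [Finite σ] {A S : Type} [CommRing A] [CommRing S] (J : Ideal S)
    [IsAdicComplete J S] (g : A →+* S) (x : σ → S) (hx : ∀ i, x i ∈ J) (y : σ → MvPowerSeries τ S)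
    (hy : ∀ i, constantCoeff (y i) = 0) :
    ∃ F : MvPowerSeries σ A →+* MvPowerSeries τ S, (∀ a, F (C a) = C (g a)) ∧
      ∀ i, F (X i) = C (x i) + y i := by
  letI : WithIdeal S := ⟨J⟩
  letI : UniformSpace A := ⊥
  haveI : DiscreteTopology A := ⟨rfl⟩
  haveI : IsUniformAddGroup A := inferInstance
  have hS := (IsAdic.isAdicComplete_iff (R := S) (I := J) rfl).1 inferInstance
  haveI := hS.1
  haveI := hS.2
  have hc : Continuous ((C (σ := τ)).comp g : A →+* MvPowerSeries τ S) := continuous_of_discreteTopology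
  haveI : IsLinearTopology S S := inferInstance
  have hn : ∀ i, IsTopologicallyNilpotent (x i) := by
    intro i
    have hA : IsAdic J := rfl
    have hb := hA.hasBasis_nhds_zero
    rw [IsTopologicallyNilpotent, hb.tendsto_right_iff]
    intro n _
    filter_upwards [Filter.eventually_ge_atTop n] with m hm
    exact Ideal.pow_le_pow_right hm (Ideal.pow_mem_pow (hx i) m)
  have he : HasEval (fun i => C (x i) + y i : σ → MvPowerSeries τ S) := by
    refine ⟨fun i => IsTopologicallyNilpotent.add ?_ ?_, ?_⟩
    · exact (hn i).map (φ := (C : S →+* MvPowerSeries τ S)) MvPowerSeries.WithPiTopology.continuous_C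
    · exact MvPowerSeries.WithPiTopology.isTopologicallyNilpotent_of_constantCoeff_zero (hy i)
    · simp
  refine ⟨eval₂Hom hc he, fun a => ?_, fun i => ?_⟩
  · rw [coe_eval₂Hom, eval₂_C]; rfl
  · rw [coe_eval₂Hom, eval₂_X]

lemma exists_ev {σ : Type} [Finite σ] {A S : Type} [CommRing A] [CommRing S] (J : Ideal S)
    [IsAdicComplete J S] (g : A →+* S) (x : σ → S) (hx : ∀ i, x i ∈ J) :
    ∃ F : MvPowerSeries σ A →+* S, (∀ a, F (C a) = g a) ∧ ∀ i, F (X i) = x i := by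
  obtain ⟨F, h1, h2⟩ := exists_ev_taylor (τ := σ) J g x hx 0 (by simp)
  exact ⟨constantCoeff.comp F, fun a => by simp [h1], fun i => by simp [h2]⟩

end ps
end LyuB

end

section

open TensorProduct

namespace LyuB
section cd
open MvPowerSeries IsLocalRing

lemma precomplete_pi {A : Type} [CommRing A] (J : Ideal A) [IsAdicComplete J A] {ι : Type} [Fintype ι] :
    IsPrecomplete J (ι → A) := by
  classical
  have hm : ∀ (m : ℕ) (v : ι → A), v ∈ (J ^ m • ⊤ : Submodule A (ι → A)) ↔ ∀ i, v i ∈ J ^ m := by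
    intro m v
    constructor
    · intro hv i
      have : (J ^ m • ⊤ : Submodule A (ι → A)).map (LinearMap.proj i) ≤ J ^ m • (⊤ : Submodule A A) := by
        rw [Submodule.map_smul'']
        exact Submodule.smul_mono le_rfl le_top
      have := this (Submodule.mem_map_of_mem hv)
      simpa using this
    · intro hv
      rw [pi_eq_sum_univ v]
      exact Submodule.sum_mem _ fun i _ => Submodule.smul_mem_smul (hv i) trivial
  constructor
  intro f hf
  have hL : ∀ i, ∃ L : A, ∀ n, f n i ≡ L [SMOD (J ^ n • ⊤ : Submodule A A)] := by
    intro i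
    apply IsPrecomplete.prec (I := J) inferInstance
    intro m n hmn
    have := hf hmn
    rw [SModEq.sub_mem, hm] at this
    rw [SModEq.sub_mem]
    simpa using this i
  choose L hL using hL
  refine ⟨L, fun n => ?_⟩
  rw [SModEq.sub_mem, hm]
  intro i
  have := hL i n
  rw [SModEq.sub_mem] at this
  simpa using this

lemma adic_span_top {A M : Type} [CommRing A] (J : Ideal A) [IsAdicComplete J A] [AddCommGroup M]
    [Module A M] [IsHausdorff J M] {ι : Type} [Finite ι] (t : ι → M)
    (h : ∀ m : M, m ∈ Submodule.span A (Set.range t) ⊔ J • (⊤ : Submodule A M)) :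
    Submodule.span A (Set.range t) = ⊤ := by
  classical
  have := Fintype.ofFinite ι
  haveI : IsPrecomplete J (ι → A) := precomplete_pi J
  have hs : Function.Surjective (Fintype.linearCombination A t) := by
    apply surjective_of_mkQ_comp_surjective (I := J)
    intro y
    obtain ⟨m, rfl⟩ := Submodule.mkQ_surjective _ y
    obtain ⟨a, ha, b, hb, hab⟩ := Submodule.mem_sup.1 (h m)
    rw [← Fintype.range_linearCombination A] at ha
    obtain ⟨v, rfl⟩ := ha
    refine ⟨v, ?_⟩
    rw [LinearMap.comp_apply, ← hab, map_add]
    have : (J • (⊤ : Submodule A M)).mkQ b = 0 := by simpa using hb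
    rw [this, add_zero]
  rw [← Fintype.range_linearCombination A]
  exact LinearMap.range_eq_top.2 hs

structure CD (C : Type) [CommRing C] [IsLocalRing C] (k : Type) [Field k] (n : ℕ) (g : k →+* C) : Prop where
  complete : IsAdicComplete (maximalIdeal C) C
  res : ∀ c : C, ∃ a, c - g a ∈ maximalIdeal C
  dim : (n : WithBot ℕ∞) ≤ ringKrullDim C

variable {C k : Type} [CommRing C] [IsLocalRing C] [Field k] {n : ℕ} {g : k →+* C}

lemma ps_dim_le (k : Type) [Field k] (σ : Type) [Fintype σ] : ringKrullDim (MvPowerSeries σ k) ≤ Fintype.card σ := by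
  classical
  have h := ringKrullDim_le_ringKrullDim_quotient_add_card (R := MvPowerSeries σ k)
    (s := Finset.univ.image X) (by
      rw [Finset.coe_image, Finset.coe_univ, Set.image_univ]
      rintro _ ⟨i, rfl⟩
      rw [IsLocalRing.ringJacobson_eq_maximalIdeal]
      simp only [SetLike.mem_coe, IsLocalRing.mem_maximalIdeal, mem_nonunits_iff]
      rw [MvPowerSeries.isUnit_iff_constantCoeff]
      simp)
  refine h.trans ?_
  have h2 : ringKrullDim (MvPowerSeries σ k ⧸ Ideal.span ((Finset.univ.image X : Finset (MvPowerSeries σ k)) : Set (MvPowerSeries σ k))) ≤ 0 := by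
    have : ringKrullDim (MvPowerSeries σ k ⧸ Ideal.span ((Finset.univ.image X : Finset (MvPowerSeries σ k)) : Set (MvPowerSeries σ k))) ≤ ringKrullDim k := by
      let f : k →+* (MvPowerSeries σ k ⧸ Ideal.span ((Finset.univ.image X : Finset (MvPowerSeries σ k)) : Set (MvPowerSeries σ k))) := (Ideal.Quotient.mk _).comp MvPowerSeries.C
      apply ringKrullDim_le_of_surjective f
      intro y
      obtain ⟨y, rfl⟩ := Ideal.Quotient.mk_surjective y
      obtain ⟨z, hz, hy⟩ := ps_decomp y
      refine ⟨constantCoeff y, ?_⟩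
      show Ideal.Quotient.mk _ _ = _
      rw [Ideal.Quotient.eq]
      rw [Finset.coe_image, Finset.coe_univ, Set.image_univ]
      have : (MvPowerSeries.C (constantCoeff y)) - y = - z := by
        rw [sub_eq_iff_eq_add]; nth_rw 2 [hy]; ring
      rw [this]; exact neg_mem hz
    rwa [ringKrullDim_eq_zero_of_field] at this
  calc _ ≤ (0 : WithBot ℕ∞) + ((Finset.univ.image X : Finset (MvPowerSeries σ k)).card : WithBot ℕ∞) := by gcongr
    _ ≤ (Fintype.card σ : WithBot ℕ∞) := by
      rw [zero_add]
      have := Finset.card_image_le (s := (Finset.univ : Finset σ)) (f := (X : σ → MvPowerSeries σ k))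
      rw [Finset.card_univ] at this
      exact_mod_cast this

lemma CD.exists_phi (h : CD C k n g) {σ : Type} [Finite σ] (x : σ → C) (hx : ∀ i, x i ∈ maximalIdeal C) :
    ∃ F : MvPowerSeries σ k →+* C, (∀ a, F (MvPowerSeries.C a) = g a) ∧ ∀ i, F (X i) = x i := by
  haveI := h.complete
  exact exists_ev (maximalIdeal C) g x hx

lemma CD.phi_surj (h : CD C k n g) {σ : Type} [Finite σ] (x : σ → C)
    (hx : Ideal.span (Set.range x) = maximalIdeal C) (F : MvPowerSeries σ k →+* C)
    (h1 : ∀ a, F (MvPowerSeries.C a) = g a) (h2 : ∀ i, F (X i) = x i) : Function.Surjective F := by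
  haveI := h.complete
  have hm : (Ideal.span (Set.range (X : σ → MvPowerSeries σ k))).map F = maximalIdeal C := by
    rw [Ideal.map_span, ← Set.range_comp, ← hx]
    congr 2; funext i; exact h2 i
  haveI : IsHausdorff ((Ideal.span (Set.range (X : σ → MvPowerSeries σ k))).map F) C := by
    rw [hm]; infer_instance
  apply surjective_of_mk_map_comp_surjective (I := Ideal.span (Set.range (X : σ → MvPowerSeries σ k)))
  intro y
  obtain ⟨y, rfl⟩ := Ideal.Quotient.mk_surjective y
  obtain ⟨a, ha⟩ := h.res y
  refine ⟨MvPowerSeries.C a, ?_⟩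
  rw [RingHom.comp_apply, h1, eq_comm, Ideal.Quotient.eq, hm]
  exact ha

lemma CD.phi_bij (h : CD C k n g) (x : Fin n → C)
    (hx : Ideal.span (Set.range x) = maximalIdeal C) (F : MvPowerSeries (Fin n) k →+* C)
    (h1 : ∀ a, F (MvPowerSeries.C a) = g a) (h2 : ∀ i, F (X i) = x i) : Function.Bijective F := by
  have hs := h.phi_surj x hx F h1 h2
  refine ⟨?_, hs⟩
  rw [injective_iff_map_eq_zero]
  intro f hf
  by_contra h0
  have h3 := ringKrullDim_quotient_succ_le_of_nonZeroDivisor (mem_nonZeroDivisors_of_ne_zero h0)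
  have h4 : ringKrullDim C ≤ ringKrullDim (MvPowerSeries (Fin n) k ⧸ Ideal.span {f}) := by
    refine ringKrullDim_le_of_surjective (Ideal.Quotient.lift (Ideal.span {f}) F ?_) ?_
    · intro a ha
      obtain ⟨b, rfl⟩ := Ideal.mem_span_singleton.1 ha
      simp [hf]
    · exact Ideal.Quotient.lift_surjective_of_surjective _ _ hs
  have h5 : (n : WithBot ℕ∞) + 1 ≤ n := by
    calc (n : WithBot ℕ∞) + 1 ≤ ringKrullDim (MvPowerSeries (Fin n) k ⧸ Ideal.span {f}) + 1 := by
          gcongr; exact h.dim.trans h4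
      _ ≤ _ := h3
      _ ≤ n := by simpa using ps_dim_le k (Fin n)
  have : n + 1 ≤ n := by exact_mod_cast h5
  omega

lemma CD.noeth (h : CD C k n g) (x : Fin n → C)
    (hx : Ideal.span (Set.range x) = maximalIdeal C) : IsNoetherianRing C := by
  obtain ⟨F, h1, h2⟩ := h.exists_phi x (fun i => hx ▸ Ideal.subset_span ⟨i, rfl⟩)
  exact isNoetherianRing_of_surjective _ _ F (h.phi_surj x hx F h1 h2)

lemma CD.taylor (h : CD C k n g) (x : Fin n → C) (hx : Ideal.span (Set.range x) = maximalIdeal C)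
    {B : Type} [CommRing B] [Algebra C B] (ε : Fin n → B) (N : ℕ)
    (hN : Ideal.span (Set.range ε) ^ N = ⊥) :
    ∃ φ : C →+* B, (∀ a, φ (g a) = algebraMap C B (g a)) ∧
      (∀ i, φ (x i) = algebraMap C B (x i) + ε i) ∧
      ∀ c, φ c - algebraMap C B c ∈ Ideal.span (Set.range ε) := by
  haveI := h.complete
  have hxm : ∀ i, x i ∈ maximalIdeal C := fun i => hx ▸ Ideal.subset_span ⟨i, rfl⟩
  obtain ⟨F, h1, h2⟩ := h.exists_phi x hxm
  have hb := h.phi_bij x hx F h1 h2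
  obtain ⟨Ta, t1, t2⟩ := exists_ev_taylor (maximalIdeal C) g x hxm (X : Fin n → MvPowerSeries (Fin n) C) (by simp)
  obtain ⟨Ev, e1, e2⟩ := exists_nev (algebraMap C B) ε N hN
  have hct : constantCoeff.comp Ta = F := by
    apply ps_hom_ext (maximalIdeal C)
    · intro x hx
      refine IsHausdorff.haus (I := maximalIdeal C) inferInstance x fun m => ?_
      rw [SModEq.zero]; simpa using hx m
    · intro a; simp [t1, h1]
    · intro i; simp [t2, h2]
    · intro i; simp [t2, hxm i]
  let e := RingEquiv.ofBijective F hb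
  have he : ∀ f, e.symm (F f) = f := fun f => e.symm_apply_apply f
  refine ⟨(Ev.comp Ta).comp e.symm.toRingHom, fun a => ?_, fun i => ?_, fun c => ?_⟩
  · show Ev (Ta (e.symm (g a))) = _
    rw [← h1, he, t1, e1]; simp [h1]
  · show Ev (Ta (e.symm (x i))) = _
    rw [← h2, he, t2, map_add, e1, e2, h2]
  · obtain ⟨f, rfl⟩ := hb.2 c
    show Ev (Ta (e.symm (F f))) - _ ∈ _
    rw [he]
    obtain ⟨y, hy, hf⟩ := ps_decomp (Ta f)
    rw [hf, map_add, e1]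
    have : constantCoeff (Ta f) = F f := by rw [← hct]; rfl
    rw [this, add_sub_cancel_left]
    have h3 : (Ideal.span (Set.range (X : Fin n → MvPowerSeries (Fin n) C))).map Ev ≤ Ideal.span (Set.range ε) := by
      rw [Ideal.map_span, ← Set.range_comp]
      apply le_of_eq; congr 2; funext i; exact e2 i
    exact h3 (Ideal.mem_map_of_mem _ hy)

end cd
end LyuB

end

section

open TensorProduct

namespace LyuB
section coeff
open Algebra

lemma h1_crit (K L : Type) [Field K] [Field L] [Algebra K L] :
    Subsingleton (H1Cotangent K L) ↔ ∀ f : MvPolynomial L K, MvPolynomial.aeval (id : L → L) f = 0 →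
      (∀ i, MvPolynomial.aeval (id : L → L) (MvPolynomial.pderiv i f) = 0) →
      f ∈ (RingHom.ker (MvPolynomial.aeval (R := K) (id : L → L))) ^ 2 := by
  have hk : (Generators.self K L).toExtension.ker = RingHom.ker (MvPolynomial.aeval (R := K) (id : L → L)) := rfl
  have key : ∀ (f : (Generators.self K L).toExtension.ker),
      (Generators.self K L).toExtension.cotangentComplex (Extension.Cotangent.mk f) = 0 ↔
       (∀ i, MvPolynomial.aeval (id : L → L) (MvPolynomial.pderiv i f.1) = 0) := by
    intro f
    rw [Extension.cotangentComplex_mk, ← (Generators.self K L).cotangentSpaceBasis.repr.map_eq_zero_iff, Finsupp.ext_iff]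
    apply forall_congr'
    intro i
    erw [(Generators.self K L).cotangentSpaceBasis_repr_one_tmul]
    rfl
  rw [Extension.subsingleton_h1Cotangent]
  constructor
  · intro hi f h0 h1
    have := (key ⟨f, h0⟩).2 h1
    have h2 := hi (this.trans (map_zero _).symm)
    rw [Extension.Cotangent.mk_eq_zero_iff] at h2
    exact h2
  · intro h
    rw [injective_iff_map_eq_zero]
    intro a ha
    obtain ⟨f, rfl⟩ := Extension.Cotangent.mk_surjective a
    rw [Extension.Cotangent.mk_eq_zero_iff]
    exact h f.1 f.2 ((key f).1 ha)

lemma fsmooth_perfect (K L : Type) [Field K] [PerfectField K] [Field L] [Algebra K L] :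
    FormallySmooth K L := by
  refine ⟨inferInstance, ?_⟩
  rw [h1_crit]
  intro f h0 h1
  let E := IntermediateField.adjoin K (f.vars : Set L)
  haveI : Algebra.EssFiniteType K E := by
    rw [IntermediateField.essFiniteType_iff]
    exact ⟨f.vars, rfl⟩
  haveI : FormallySmooth K E := inferInstance
  have hE := (h1_crit K E).1 inferInstance
  obtain ⟨f', hf'⟩ : ∃ f' : MvPolynomial E K, MvPolynomial.rename (Subtype.val : E → L) f' = f := by
    have := MvPolynomial.exists_rename_eq_of_vars_subset_range f (Subtype.val : E → L) Subtype.val_injective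
      (by intro x hx; simp only [Subtype.range_coe_subtype]; exact IntermediateField.subset_adjoin K _ hx)
    exact this
  have hc : ∀ g : MvPolynomial E K, MvPolynomial.aeval (id : L → L) (MvPolynomial.rename (Subtype.val : E → L) g) =
      ((MvPolynomial.aeval (id : E → E) g : E) : L) := by
    intro g
    rw [MvPolynomial.aeval_rename]
    have := MvPolynomial.comp_aeval (R := K) (id : E → E) E.val
    exact (DFunLike.congr_fun this g).symm
  have h2 := hE f' (by
    apply Subtype.val_injective
    rw [← hc, hf', h0]; rfl) (by
    intro i
    apply Subtype.val_injective
    rw [← hc]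
    have : MvPolynomial.rename (Subtype.val : E → L) (MvPolynomial.pderiv i f') = MvPolynomial.pderiv (i : L) f := by
      rw [← hf', MvPolynomial.pderiv_rename Subtype.val_injective]
    rw [this, h1]; rfl)
  have h3 : (RingHom.ker (MvPolynomial.aeval (R := K) (id : E → E))).map (MvPolynomial.rename (R := K) (Subtype.val : E → L)) ≤
      RingHom.ker (MvPolynomial.aeval (R := K) (id : L → L)) := by
    rw [Ideal.map_le_iff_le_comap]
    intro a ha
    rw [Ideal.mem_comap, RingHom.mem_ker, hc, (RingHom.mem_ker).1 ha]; rfl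
  rw [← hf']
  have h4 := Ideal.mem_map_of_mem (MvPolynomial.rename (R := K) (Subtype.val : E → L)) h2
  rw [Ideal.map_pow] at h4
  exact Ideal.pow_right_mono h3 2 h4

open IsLocalRing in
lemma exists_coeff (C : Type) [CommRing C] [IsLocalRing C] [IsAdicComplete (maximalIdeal C) C]
    (F : Type) [Field F] (i : F →+* C) :
    ∃ (k : Type) (_ : Field k) (g : k →+* C), ∀ c : C, ∃ a, c - g a ∈ maximalIdeal C := by
  have main : ∀ (K : Type) [Field K] [PerfectField K] [Algebra K C], ∃ (k : Type) (_ : Field k) (g : k →+* C), ∀ c : C, ∃ a, c - g a ∈ maximalIdeal C := by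
    intro K _ _ _
    haveI := fsmooth_perfect K (ResidueField C)
    obtain ⟨g, hg⟩ := FormallySmooth.exists_mkₐ_comp_eq_of_isAdicComplete (R := K) (A := ResidueField C) (S := C)
      (I := maximalIdeal C) (AlgHom.id K (ResidueField C))
    refine ⟨ResidueField C, inferInstance, g, fun c => ⟨residue C c, ?_⟩⟩
    rw [← Ideal.Quotient.eq]
    have := DFunLike.congr_fun hg (residue C c)
    exact this.symm
  obtain ⟨p, hp⟩ := CharP.exists F
  rcases hp.char_is_prime_or_zero F p with h | h
  · haveI : Fact p.Prime := ⟨h⟩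
    letI := ZMod.algebra F p
    letI : Algebra (ZMod p) C := (i.comp (algebraMap (ZMod p) F)).toAlgebra
    exact main (ZMod p)
  · subst h
    haveI : CharZero F := CharP.charP_to_charZero F
    letI : Algebra ℚ C := (i.comp (algebraMap ℚ F)).toAlgebra
    exact main ℚ

end coeff
end LyuB

end

section

open TensorProduct

namespace LyuB
section param
open IsLocalRing

lemma rsp_avoid {C : Type} [CommRing C] [IsLocalRing C] [IsNoetherianRing C] {n : ℕ} (x : Fin n → C)
    (hx : Ideal.span (Set.range x) = maximalIdeal C) (σ : Finset (Fin n))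
    (hσ : Ideal.span (x '' σ) ≠ maximalIdeal C) (P : Set (Ideal C)) (hP : P.Finite)
    (hP1 : ∀ p ∈ P, p.IsPrime) (hP2 : ∀ p ∈ P, p ≠ maximalIdeal C) :
    ∃ i ∉ σ, ∃ z ∈ maximalIdeal C, (∀ p ∈ P, z ∉ p) ∧ Ideal.span (Set.range (Function.update x i z)) = maximalIdeal C := by
  classical
  set I0 : Ideal C := Ideal.span (x '' σ) ⊔ maximalIdeal C • maximalIdeal C with hI0
  have hxm : ∀ i, x i ∈ maximalIdeal C := fun i => hx ▸ Ideal.subset_span ⟨i, rfl⟩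
  have hsm : Ideal.span (x '' σ) ≤ maximalIdeal C := by
    rw [Ideal.span_le]; rintro _ ⟨i, _, rfl⟩; exact hxm i
  have h0 : ¬ maximalIdeal C ≤ I0 := by
    intro h
    apply hσ
    apply le_antisymm hsm
    exact Submodule.le_of_le_smul_of_le_jacobson_bot (IsNoetherian.noetherian _)
      (by rw [IsLocalRing.jacobson_eq_maximalIdeal ⊥ bot_ne_top]) h
  have h1 : ¬ ((maximalIdeal C : Set C) ⊆ ⋃ I ∈ insert I0 P, ((id I : Ideal C) : Set C)) := by
    rw [Ideal.subset_union_prime_finite (hP.insert I0) (f := id) I0 I0]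
    · rintro ⟨I, hI, hI2⟩
      rcases hI with rfl | hI
      · exact h0 hI2
      · have := (IsLocalRing.maximalIdeal.isMaximal C).eq_of_le (hP1 I hI).ne_top hI2
        exact hP2 I hI this.symm
    · intro i hi hne _
      rcases hi with rfl | hi
      · exact absurd rfl hne
      · exact hP1 i hi
  obtain ⟨z, hz, hz2⟩ := Set.not_subset.1 h1
  simp only [Set.mem_iUnion, not_exists] at hz2
  have hzI : z ∉ I0 := fun h => hz2 I0 (Set.mem_insert _ _) h
  have hzP : ∀ p ∈ P, z ∉ p := fun p hp h => hz2 p (Set.mem_insert_of_mem _ hp) h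
  have hz' : z ∈ Ideal.span (Set.range x) := hx ▸ hz
  obtain ⟨a, ha⟩ := Ideal.mem_span_range_iff_exists_fun.1 hz'
  obtain ⟨i, hi, hu⟩ : ∃ i ∉ σ, IsUnit (a i) := by
    by_contra! hcon
    apply hzI
    rw [← ha]
    refine Ideal.sum_mem _ fun i _ => ?_
    by_cases hi : i ∈ σ
    · exact Ideal.mul_mem_left _ _ (Ideal.mem_sup_left (Ideal.subset_span ⟨i, hi, rfl⟩))
    · exact Ideal.mem_sup_right (Submodule.smul_mem_smul ((mem_maximalIdeal _).2 (hcon i hi)) (hxm i))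
  refine ⟨i, hi, z, hz, hzP, le_antisymm ?_ ?_⟩
  · rw [Ideal.span_le]
    rintro _ ⟨j, rfl⟩
    by_cases hj : j = i
    · subst hj; simpa using hz
    · simpa [Function.update_of_ne hj] using hxm j
  · rw [← hx, Ideal.span_le]
    have hj : ∀ j, j ≠ i → x j ∈ Ideal.span (Set.range (Function.update x i z)) := fun j hj =>
      Ideal.subset_span ⟨j, by rw [Function.update_of_ne hj]⟩
    rintro _ ⟨j, rfl⟩
    by_cases hji : j = i
    · subst hji
      have hz3 : z ∈ Ideal.span (Set.range (Function.update x j z)) := Ideal.subset_span ⟨j, by simp⟩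
      rw [← Finset.add_sum_erase _ _ (Finset.mem_univ j)] at ha
      have h5 : a j * x j ∈ Ideal.span (Set.range (Function.update x j z)) := by
        rw [eq_sub_of_add_eq ha]
        exact sub_mem hz3 (Ideal.sum_mem _ fun l hl => Ideal.mul_mem_left _ _ (hj l (Finset.ne_of_mem_erase hl)))
      exact (Ideal.unit_mul_mem_iff_mem _ hu).1 h5
    · exact hj j hji

lemma dim_drop {C : Type} [CommRing C] (K : Ideal C) (z : C) (hz : ∀ p ∈ K.minimalPrimes, z ∉ p) :
    ringKrullDim (C ⧸ (K ⊔ Ideal.span {z})) + 1 ≤ ringKrullDim (C ⧸ K) := by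
  have h := Module.supportDim_quotSMulTop_succ_le_of_notMem_minimalPrimes (R := C) (M := C ⧸ K) (x := z)
    (by rwa [Ideal.annihilator_quotient])
  rw [Module.supportDim, Module.supportDim, Module.support_quotSMulTop, Module.support_eq_zeroLocus,
    Ideal.annihilator_quotient] at h
  rw [ringKrullDim_quotient, ringKrullDim_quotient]
  have e : PrimeSpectrum.zeroLocus ((K ⊔ Ideal.span {z} : Ideal C) : Set C) =
    PrimeSpectrum.zeroLocus (K : Set C) ∩ PrimeSpectrum.zeroLocus {z} := by
    rw [PrimeSpectrum.zeroLocus_sup, PrimeSpectrum.zeroLocus_span]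
  rw [e]
  exact h

lemma exists_params {C : Type} [CommRing C] [IsLocalRing C] [IsNoetherianRing C] {n : ℕ} (x : Fin n → C)
    (hx : Ideal.span (Set.range x) = maximalIdeal C) (Q : Ideal C) (hQ : Q ≠ ⊤) :
    ∃ (x : Fin n → C) (σ : Finset (Fin n)), Ideal.span (Set.range x) = maximalIdeal C ∧
      (∃ N, maximalIdeal C ^ N ≤ Q ⊔ Ideal.span (x '' σ)) ∧ (σ.card : WithBot ℕ∞) ≤ ringKrullDim (C ⧸ Q) := by
  classical
  have key : ∀ (e : ℕ) (x : Fin n → C) (σ : Finset (Fin n)), n - σ.card = e → Ideal.span (Set.range x) = maximalIdeal C →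
      ringKrullDim (C ⧸ (Q ⊔ Ideal.span (x '' σ))) + σ.card ≤ ringKrullDim (C ⧸ Q) →
      ∃ (x : Fin n → C) (σ : Finset (Fin n)), Ideal.span (Set.range x) = maximalIdeal C ∧
      (∃ N, maximalIdeal C ^ N ≤ Q ⊔ Ideal.span (x '' σ)) ∧ (σ.card : WithBot ℕ∞) ≤ ringKrullDim (C ⧸ Q) := by
    intro e
    induction e with
    | zero => ?_
    | succ e ih => ?_
    all_goals
      intro x σ hσ hx hd
      have hxm : ∀ i, x i ∈ maximalIdeal C := fun i => hx ▸ Ideal.subset_span ⟨i, rfl⟩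
      have hsm : Ideal.span (x '' σ) ≤ maximalIdeal C := by
        rw [Ideal.span_le]; rintro _ ⟨i, _, rfl⟩; exact hxm i
      have hne : Q ⊔ Ideal.span (x '' σ) ≠ ⊤ := by
        intro h
        have := sup_le (le_maximalIdeal hQ) hsm
        rw [h, top_le_iff] at this
        exact (maximalIdeal.isMaximal C).ne_top this
      have hcard : (σ.card : WithBot ℕ∞) ≤ ringKrullDim (C ⧸ Q) := by
        refine le_trans ?_ hd
        haveI : Nontrivial (C ⧸ (Q ⊔ Ideal.span (x '' σ))) := Ideal.Quotient.nontrivial_iff.2 hne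
        have := ringKrullDim_nonneg_of_nontrivial (R := C ⧸ (Q ⊔ Ideal.span (x '' σ)))
        calc (σ.card : WithBot ℕ∞) = 0 + σ.card := by rw [zero_add]
          _ ≤ _ := by gcongr
      by_cases hmin : maximalIdeal C ∈ (Q ⊔ Ideal.span (x '' σ)).minimalPrimes
      · refine ⟨x, σ, hx, ?_, hcard⟩
        apply Ideal.exists_pow_le_of_le_radical_of_fg _ (IsNoetherian.noetherian _)
        rw [Ideal.radical_eq_sInf]
        refine le_sInf fun J hJ => ?_
        exact hmin.2 ⟨hJ.2, hJ.1⟩ (le_maximalIdeal hJ.2.ne_top)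
    · exfalso
      apply hmin
      have : Ideal.span (x '' σ) = maximalIdeal C := by
        have h1 : σ = Finset.univ := by
          rw [← Finset.card_eq_iff_eq_univ, Fintype.card_fin]
          have := Finset.card_le_univ σ
          rw [Fintype.card_fin] at this
          omega
        rw [h1, Finset.coe_univ, Set.image_univ, hx]
      rw [this, sup_eq_right.2 (le_maximalIdeal hQ)]
      rw [Ideal.minimalPrimes_eq_subsingleton_self]; rfl
    · have hspan : Ideal.span (x '' σ) ≠ maximalIdeal C := by
        intro this
        apply hmin
        rw [this, sup_eq_right.2 (le_maximalIdeal hQ)]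
        rw [Ideal.minimalPrimes_eq_subsingleton_self]; rfl
      obtain ⟨i, hi, z, hz, hzP, hup⟩ := rsp_avoid x hx σ hspan _ (Ideal.finite_minimalPrimes_of_isNoetherianRing C (Q ⊔ Ideal.span (x '' σ)))
        (fun p hp => hp.1.1) (fun p hp h => hmin (h ▸ hp))
      have him : (Function.update x i z) '' (insert i σ : Finset (Fin n)) = insert z (x '' σ) := by
        rw [Finset.coe_insert, Set.image_insert_eq, Function.update_self]
        congr 1
        apply Set.image_congr
        intro j hj
        rw [Function.update_of_ne]
        rintro rfl; exact hi hj
      refine ih (Function.update x i z) (insert i σ) ?_ hup ?_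
      · rw [Finset.card_insert_of_notMem hi]; omega
      · rw [him, Set.insert_eq, Ideal.span_union, Finset.card_insert_of_notMem hi]
        have h1 := dim_drop _ z hzP
        rw [sup_assoc, sup_comm (Ideal.span (x '' σ))] at h1
        refine le_trans ?_ hd
        push_cast
        rw [add_comm (σ.card : WithBot ℕ∞) 1, ← add_assoc]
        gcongr
  refine key _ x ∅ rfl hx ?_
  have : Q ⊔ Ideal.span (x '' ((∅ : Finset (Fin n)) : Set (Fin n))) = Q := by simp
  rw [this]; simp

end param
end LyuB

end

section

open TensorProduct

namespace LyuB
section nn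
open MvPowerSeries IsLocalRing

lemma dim_le_of_int {A D : Type} [CommRing A] [CommRing D] [Algebra A D] (hint : Algebra.IsIntegral A D)
    (a : A) (ha : algebraMap A D a = 0) : ringKrullDim D ≤ ringKrullDim (A ⧸ Ideal.span {a}) := by
  rw [ringKrullDim_quotient]
  refine Order.krullDim_le_of_strictMono
    (fun P : PrimeSpectrum D => (⟨P.comap (algebraMap A D), ?_⟩ : PrimeSpectrum.zeroLocus ((Ideal.span {a} : Ideal A) : Set A))) ?_
  · rw [PrimeSpectrum.zeroLocus_span]
    simp [PrimeSpectrum.mem_zeroLocus, ha]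
  · intro P P' h
    obtain ⟨x, hx, hx2⟩ := Set.exists_of_ssubset (show (P.asIdeal : Set D) ⊂ P'.asIdeal from h)
    exact Ideal.comap_lt_comap_of_integral_mem_sdiff (hI := P.2) h.le ⟨hx, hx2⟩ (hint.isIntegral x)

variable {C k : Type} [CommRing C] [IsLocalRing C] [IsNoetherianRing C] [Field k] {n : ℕ} {g : k →+* C}
variable (h : CD C k n g) {x : Fin n → C} (hx : Ideal.span (Set.range x) = maximalIdeal C) {σ : Finset (Fin n)}
  [Algebra (MvPowerSeries σ k) C] (hF1 : ∀ a, algebraMap (MvPowerSeries σ k) C (MvPowerSeries.C a) = g a)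
  (hF2 : ∀ i, algebraMap (MvPowerSeries σ k) C (X i) = x i)

include hx hF2 in
lemma nn_haus (K : Ideal C) : IsHausdorff (Ideal.span (Set.range (X : σ → MvPowerSeries σ k))) (C ⧸ K) := by
  rw [← IsHausdorff.map_algebraMap_iff (S := C)]
  apply IsHausdorff.of_le_jacobson
  rw [IsLocalRing.jacobson_eq_maximalIdeal ⊥ bot_ne_top, Ideal.map_span, Ideal.span_le]
  rintro _ ⟨_, ⟨i, rfl⟩, rfl⟩
  rw [hF2, ← hx]
  exact Ideal.subset_span ⟨_, rfl⟩

include hF2 in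
lemma nn_mem (K : Ideal C) (c : C) (hc : c ∈ Ideal.span (x '' σ)) :
    Ideal.Quotient.mk K c ∈ Ideal.span (Set.range (X : σ → MvPowerSeries σ k)) • (⊤ : Submodule (MvPowerSeries σ k) (C ⧸ K)) := by
  induction hc using Submodule.span_induction with
  | mem c hc =>
    obtain ⟨i, hi, rfl⟩ := hc
    have : Ideal.Quotient.mk K (x i) = (X ⟨i, hi⟩ : MvPowerSeries σ k) • (1 : C ⧸ K) := by
      rw [Algebra.smul_def, mul_one, IsScalarTower.algebraMap_apply _ C (C ⧸ K), hF2]; rfl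
    rw [this]
    exact Submodule.smul_mem_smul (Ideal.subset_span ⟨_, rfl⟩) trivial
  | zero => simp
  | add a b _ _ ha hb => rw [map_add]; exact add_mem ha hb
  | smul a b _ hb =>
    rw [smul_eq_mul, map_mul]
    let f : (C ⧸ K) →ₗ[MvPowerSeries σ k] (C ⧸ K) := LinearMap.mulLeft _ (Ideal.Quotient.mk K a)
    have h1 : (Ideal.span (Set.range (X : σ → MvPowerSeries σ k)) • (⊤ : Submodule (MvPowerSeries σ k) (C ⧸ K))).map f ≤
       Ideal.span (Set.range (X : σ → MvPowerSeries σ k)) • (⊤ : Submodule (MvPowerSeries σ k) (C ⧸ K)) := by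
      rw [Submodule.map_smul'']
      exact Submodule.smul_mono le_rfl le_top
    exact h1 (Submodule.mem_map_of_mem hb)

include h hF1 in
lemma nn_gen (j : ℕ) : ∃ T : Finset C, ∀ c : C, ∃ c' ∈ maximalIdeal C ^ j, c - c' ∈ Submodule.span (MvPowerSeries σ k) (T : Set C) := by
  classical
  induction j with
  | zero => exact ⟨∅, fun c => ⟨c, by simp, by simp⟩⟩
  | succ j ih =>
    obtain ⟨T, hT⟩ := ih
    obtain ⟨G, hG⟩ := IsNoetherian.noetherian (maximalIdeal C ^ j)
    refine ⟨T ∪ G, fun c => ?_⟩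
    obtain ⟨c', hc', hcc⟩ := hT c
    rw [← hG] at hc'
    have key : ∃ c'' ∈ maximalIdeal C ^ (j+1), c' - c'' ∈ Submodule.span (MvPowerSeries σ k) (G : Set C) := by
      clear hcc
      have hG' : ∀ x ∈ Submodule.span C (G : Set C), x ∈ maximalIdeal C ^ j := by rw [hG]; exact fun x hx => hx
      obtain ⟨f, -, hf⟩ := Submodule.mem_span_finset.1 hc'
      choose a ha using h.res
      refine ⟨∑ b ∈ G, (f b - g (a (f b))) * b, ?_, ?_⟩
      · refine Ideal.sum_mem _ fun b hb => ?_
        rw [pow_succ']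
        exact Ideal.mul_mem_mul (ha _) (hG' _ (Submodule.subset_span hb))
      · rw [← hf, ← Finset.sum_sub_distrib]
        refine Submodule.sum_mem _ fun b hb => ?_
        have : f b • b - (f b - g (a (f b))) * b = (MvPowerSeries.C (a (f b)) : MvPowerSeries σ k) • b := by
          rw [Algebra.smul_def (MvPowerSeries.C (a (f b))), hF1, smul_eq_mul]; ring
        rw [this]
        exact Submodule.smul_mem _ _ (Submodule.subset_span hb)
    obtain ⟨c'', hc'', h3⟩ := key
    refine ⟨c'', hc'', ?_⟩
    rw [show c - c'' = (c - c') + (c' - c'') by ring]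
    refine add_mem (Submodule.span_mono (by simp) hcc) (Submodule.span_mono (by simp) h3)

include h hx hF1 hF2 in
lemma nn_finite (Q : Ideal C) (N : ℕ) (hN : maximalIdeal C ^ N ≤ Q ⊔ Ideal.span (x '' σ)) :
    Module.Finite (MvPowerSeries σ k) (C ⧸ Q) := by
  obtain ⟨T, hT⟩ := nn_gen h hF1 N
  haveI := nn_haus hx hF2 Q
  let f : C →ₗ[MvPowerSeries σ k] (C ⧸ Q) := (Ideal.Quotient.mkₐ (MvPowerSeries σ k) Q).toLinearMap
  have := adic_span_top (Ideal.span (Set.range (X : σ → MvPowerSeries σ k))) (M := C ⧸ Q) (fun b : T => f b) (by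
    intro m
    obtain ⟨c, rfl⟩ := Ideal.Quotient.mk_surjective m
    obtain ⟨c', hc', hcc⟩ := hT c
    obtain ⟨q, hq, w, hw, hqw⟩ := Submodule.mem_sup.1 (hN hc')
    refine Submodule.mem_sup.2 ⟨f (c - c'), ?_, f w, nn_mem hF2 Q w hw, ?_⟩
    · have := Submodule.mem_map_of_mem (f := f) hcc
      rw [Submodule.map_span] at this
      have h6 : (Set.range fun b : T => f b) = f '' (T : Set C) := by
        rw [Set.image_eq_range]; rfl
      rw [h6]
      exact this
    · rw [← map_add]
      show Ideal.Quotient.mk Q _ = Ideal.Quotient.mk Q _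
      rw [Ideal.Quotient.eq, ← hqw]
      have : c - (q + w) + w - c = - q := by ring
      rw [this]; exact neg_mem hq)
  exact ⟨Submodule.fg_def.2 ⟨_, Set.finite_range _, this⟩⟩

include h hx hF1 hF2 in
lemma nn_decomp (c : C) : ∃ a : MvPowerSeries σ k, c - algebraMap _ C a ∈ Ideal.span (x '' (σ : Set (Fin n))ᶜ) := by
  set K := Ideal.span (x '' (σ : Set (Fin n))ᶜ) with hK
  haveI := nn_haus hx hF2 K
  have := adic_span_top (Ideal.span (Set.range (X : σ → MvPowerSeries σ k))) (M := C ⧸ K) (fun b : Unit => 1) (by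
    intro m
    obtain ⟨c, rfl⟩ := Ideal.Quotient.mk_surjective m
    obtain ⟨a, ha⟩ := h.res c
    have h1 : maximalIdeal C ≤ K ⊔ Ideal.span (x '' σ) := by
      rw [hK, ← Ideal.span_union, ← Set.image_union, ← hx]
      simp
    obtain ⟨q, hq, w, hw, hqw⟩ := Submodule.mem_sup.1 (h1 ha)
    refine Submodule.mem_sup.2 ⟨(MvPowerSeries.C a : MvPowerSeries σ k) • (1 : C ⧸ K), ?_, Ideal.Quotient.mk K w, nn_mem hF2 K w hw, ?_⟩
    · exact Submodule.smul_mem _ _ (Submodule.subset_span ⟨(), rfl⟩)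
    · rw [Algebra.smul_def, mul_one, IsScalarTower.algebraMap_apply _ C (C ⧸ K), hF1]
      show Ideal.Quotient.mk K _ + _ = _
      rw [← map_add, Ideal.Quotient.eq]
      have : g a + w - c = - q := by linear_combination hqw
      rw [this]; exact neg_mem hq)
  have h2 : Ideal.Quotient.mk K c ∈ Submodule.span (MvPowerSeries σ k) (Set.range (fun b : Unit => (1 : C ⧸ K))) := by
    rw [this]; trivial
  rw [Set.range_const, Submodule.mem_span_singleton] at h2
  obtain ⟨a, ha⟩ := h2
  refine ⟨a, ?_⟩
  rw [Algebra.smul_def, mul_one, IsScalarTower.algebraMap_apply _ C (C ⧸ K)] at ha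
  rw [← Ideal.Quotient.eq]; exact ha.symm

lemma nn_inj (Q : Ideal C) [Module.Finite (MvPowerSeries σ k) (C ⧸ Q)] (hd : (σ.card : WithBot ℕ∞) ≤ ringKrullDim (C ⧸ Q)) :
    Function.Injective (algebraMap (MvPowerSeries σ k) (C ⧸ Q)) := by
  rw [injective_iff_map_eq_zero]
  intro a ha
  by_contra h0
  have h3 := ringKrullDim_quotient_succ_le_of_nonZeroDivisor (mem_nonZeroDivisors_of_ne_zero h0)
  have h4 := dim_le_of_int (A := MvPowerSeries σ k) (D := C ⧸ Q) inferInstance a ha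
  have h5 : (σ.card : WithBot ℕ∞) + 1 ≤ σ.card := by
    calc (σ.card : WithBot ℕ∞) + 1 ≤ ringKrullDim (MvPowerSeries σ k ⧸ Ideal.span {a}) + 1 := by
          gcongr; exact hd.trans h4
      _ ≤ _ := h3
      _ ≤ σ.card := by simpa using ps_dim_le k σ
  have : σ.card + 1 ≤ σ.card := by exact_mod_cast h5
  omega

include h hx hF1 hF2 in
lemma nn_taylor (i : Fin n) (hi : i ∉ σ) (s : ℕ) : ∃ φ : C →ₐ[MvPowerSeries σ k] Tr C s,
    (∀ c, trε C s (φ c) = c) ∧ (∀ j, j ≠ i → φ (x j) = algebraMap C _ (x j)) ∧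
      φ (x i) = algebraMap C _ (x i) + tr C s := by
  classical
  obtain ⟨φ, h1, h2, h3⟩ := h.taylor x hx (fun j => if j = i then tr C s else 0) (s + 1) (by
    rw [eq_bot_iff]
    have : Ideal.span (Set.range (fun j => if j = i then tr C s else 0)) ≤ Ideal.span {tr C s} := by
      rw [Ideal.span_le]; rintro _ ⟨j, rfl⟩
      dsimp only
      split_ifs
      · exact Ideal.mem_span_singleton_self _
      · exact zero_mem _
    refine (Ideal.pow_right_mono this _).trans ?_
    rw [Ideal.span_singleton_pow, tr_pow]; simp)
  have key : φ.comp (algebraMap (MvPowerSeries σ k) C) = algebraMap (MvPowerSeries σ k) (Tr C s) := by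
    rw [IsScalarTower.algebraMap_eq _ C (Tr C s)]
    have hxm : ∀ i, x i ∈ maximalIdeal C := fun i => hx ▸ Ideal.subset_span ⟨i, rfl⟩
    apply ps_hom_ext ((maximalIdeal C).map (algebraMap C (Tr C s)))
    · intro y hy
      haveI : Module.Finite C (Tr C s) := (Polynomial.monic_X_pow (s + 1)).finite_adjoinRoot
      haveI : IsHausdorff (maximalIdeal C) (Tr C s) := IsHausdorff.of_le_jacobson _ _ (by
        rw [IsLocalRing.jacobson_eq_maximalIdeal ⊥ bot_ne_top])
      refine IsHausdorff.haus (I := maximalIdeal C) inferInstance y fun m => ?_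
      rw [SModEq.zero]
      have := hy m
      rw [← Ideal.map_pow] at this
      rw [Ideal.smul_top_eq_map]
      exact this
    · intro a
      simp [hF1, h1]
    · intro j
      have : (j : Fin n) ≠ i := by rintro rfl; exact hi j.2
      simp [hF2, h2, this]
    · intro j
      have : (j : Fin n) ≠ i := by rintro rfl; exact hi j.2
      simp only [RingHom.comp_apply, hF2, h2, this, if_false, add_zero]
      exact Ideal.mem_map_of_mem _ (hxm _)
  refine ⟨⟨φ, fun a => RingHom.congr_fun key a⟩, fun c => ?_, fun j hj => ?_, ?_⟩
  · have h4 := h3 c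
    have : Ideal.span (Set.range (fun j => if j = i then tr C s else 0)) ≤ RingHom.ker (trε C s) := by
      rw [Ideal.span_le]; rintro _ ⟨j, rfl⟩
      dsimp only
      split_ifs
      · exact trε_t C s
      · exact zero_mem _
    have h5 := this h4
    rw [RingHom.mem_ker, map_sub, sub_eq_zero] at h5
    show trε C s (φ c) = c
    rw [h5]; exact (trε C s).commutes c
  · show φ _ = _
    simp [h2, hj]
  · show φ _ = _
    simp [h2]

end nn
end LyuB

end

section

open TensorProduct

namespace LyuB
section sc
open IsLocalRing

variable (A C D L : Type) [CommRing A] [IsDomain A] [IsNoetherianRing A] [CommRing C] [IsLocalRing C] [IsNoetherianRing C]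
  [CommRing D] [IsDomain D] [Field L] [Algebra A C] [Algebra A D] [Algebra A L] [Algebra C D] [Algebra C L] [Algebra D L]
  [IsScalarTower A C D] [IsScalarTower A C L] [IsScalarTower A D L] [IsScalarTower C D L]
  [Module.Finite A D] [IsFractionRing D L]

noncomputable def sπ : C ⊗[A] L →ₐ[A] L :=
  Algebra.TensorProduct.productMap (IsScalarTower.toAlgHom A C L) (AlgHom.id A L)

lemma sπ_tmul (c : C) (l : L) : sπ A C L (c ⊗ₜ l) = algebraMap C L c * l := by
  simp [sπ]

def sK (b : C) : C ⊗[A] D := b ⊗ₜ 1 - 1 ⊗ₜ algebraMap C D b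

noncomputable def sψ : C ⊗[A] D →ₐ[C] C ⊗[A] L := Algebra.TensorProduct.map (AlgHom.id C C) (IsScalarTower.toAlgHom A D L)

def szz {e : ℕ} (y : Fin e → C) (i : Fin e) : C ⊗[A] L := y i ⊗ₜ 1 - 1 ⊗ₜ algebraMap C L (y i)

variable {e : ℕ} (y : Fin e → C) (hy : ∀ i, y i ∈ maximalIdeal C)
  (hdec : ∀ c : C, ∃ a : A, c - algebraMap A C a ∈ Ideal.span (Set.range y))

include hy hdec in
lemma sK_le : Ideal.span (Set.range (sK A C D)) ≤ Ideal.span (Set.range fun i => sK A C D (y i)) := by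
  set J := Ideal.span (Set.range (sK A C D)) with hJ
  set Z := Ideal.span (Set.range fun i => sK A C D (y i)) with hZ
  suffices h : J.restrictScalars C ≤ Z.restrictScalars C from h
  apply Submodule.le_of_le_smul_of_le_jacobson_bot (I := maximalIdeal C) (IsNoetherian.noetherian _)
  · rw [IsLocalRing.jacobson_eq_maximalIdeal ⊥ bot_ne_top]
  · have key : ∀ (b : C) (u : C ⊗[A] D), u * sK A C D b ∈ Z.restrictScalars C ⊔ maximalIdeal C • J.restrictScalars C := by
      intro b u
      obtain ⟨a, ha⟩ := hdec b
      obtain ⟨f, hf⟩ := Ideal.mem_span_range_iff_exists_fun.1 ha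
      have h1 : sK A C D b = ∑ i, (((1 : C) ⊗ₜ[A] algebraMap C D (f i)) * sK A C D (y i) + y i • sK A C D (f i)) := by
        have hb : b = algebraMap A C a + ∑ i, f i * y i := by rw [hf]; ring
        have h2 : sK A C D b = ∑ i, sK A C D (f i * y i) := by
          simp only [sK]
          rw [Finset.sum_sub_distrib, ← TensorProduct.sum_tmul, ← TensorProduct.tmul_sum, ← map_sum]
          generalize ∑ i, f i * y i = w at hb ⊢
          subst hb
          rw [map_add, TensorProduct.add_tmul, TensorProduct.tmul_add, ← IsScalarTower.algebraMap_apply A C D]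
          rw [show (algebraMap A C a) ⊗ₜ[A] (1:D) = (1:C) ⊗ₜ algebraMap A D a by
            rw [Algebra.algebraMap_eq_smul_one, Algebra.algebraMap_eq_smul_one, TensorProduct.smul_tmul]]
          ring
        rw [h2]
        refine Finset.sum_congr rfl fun i _ => ?_
        simp only [sK, mul_sub, Algebra.TensorProduct.tmul_mul_tmul, smul_sub, TensorProduct.smul_tmul', smul_eq_mul, map_mul,
          mul_one, one_mul]
        rw [mul_comm (f i) (y i)]
        abel
      rw [h1, Finset.mul_sum]
      refine Submodule.sum_mem _ fun i _ => ?_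
      rw [mul_add]
      refine add_mem (Submodule.mem_sup_left ?_) (Submodule.mem_sup_right ?_)
      · exact Ideal.mul_mem_left _ _ (Ideal.mul_mem_left _ _ (Ideal.subset_span ⟨i, rfl⟩))
      · rw [mul_smul_comm]
        exact Submodule.smul_mem_smul (hy i) (Ideal.mul_mem_left _ _ (Ideal.subset_span ⟨_, rfl⟩))
    intro u hu
    suffices h : ∀ v, v * u ∈ Z.restrictScalars C ⊔ maximalIdeal C • J.restrictScalars C by simpa using h 1
    rw [Submodule.restrictScalars_mem, hJ] at hu
    induction hu using Submodule.span_induction with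
    | mem u hu =>
      obtain ⟨b, rfl⟩ := hu
      exact key b
    | zero => intro v; rw [mul_zero]; exact zero_mem _
    | add _ _ _ _ h1 h2 => intro v; rw [mul_add]; exact add_mem (h1 v) (h2 v)
    | smul a b hb h1 => intro v; rw [smul_eq_mul, ← mul_assoc]; exact h1 _

include hy hdec in
lemma sker_le (hsurj : Function.Surjective (algebraMap C D)) (u : C ⊗[A] D)
    (hu : sπ A C L (sψ A C D L u) = 0) : u ∈ Ideal.span (Set.range fun i => sK A C D (y i)) := by
  apply sK_le A C D y hy hdec
  have key : ∀ u : C ⊗[A] D, ∃ c : C, u - c ⊗ₜ 1 ∈ Ideal.span (Set.range (sK A C D)) := by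
    intro u
    induction u using TensorProduct.induction_on with
    | zero => exact ⟨0, by simp⟩
    | tmul c d =>
      obtain ⟨b, rfl⟩ := hsurj d
      refine ⟨c * b, ?_⟩
      have : (c ⊗ₜ algebraMap C D b : C ⊗[A] D) - (c * b) ⊗ₜ 1 = - (c ⊗ₜ 1 * sK A C D b) := by
        simp [sK, mul_sub]
      rw [this]
      exact neg_mem (Ideal.mul_mem_left _ _ (Ideal.subset_span ⟨_, rfl⟩))
    | add u v hu hv =>
      obtain ⟨c, hc⟩ := hu
      obtain ⟨c', hc'⟩ := hv
      refine ⟨c + c', ?_⟩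
      rw [TensorProduct.add_tmul, add_sub_add_comm]
      exact add_mem hc hc'
  obtain ⟨c, hc⟩ := key u
  have h0 : ∀ v ∈ Ideal.span (Set.range (sK A C D)), sπ A C L (sψ A C D L v) = 0 := by
    intro v hv
    induction hv using Submodule.span_induction with
    | mem u hu =>
      obtain ⟨b, rfl⟩ := hu
      simp [sK, sψ, sπ_tmul, ← IsScalarTower.algebraMap_apply C D L]
    | zero => simp
    | add _ _ _ _ h1 h2 => rw [map_add, map_add, h1, h2, add_zero]
    | smul a b hb h1 => rw [smul_eq_mul, map_mul, map_mul, h1, mul_zero]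
  have h1 := h0 _ hc
  rw [map_sub, map_sub, hu, zero_sub, neg_eq_zero] at h1
  have h2 : algebraMap C L c = 0 := by simpa [sψ, sπ_tmul] using h1
  rw [IsScalarTower.algebraMap_apply C D L, FaithfulSMul.algebraMap_eq_zero_iff] at h2
  have h3 : c ⊗ₜ 1 = sK A C D c := by simp [sK, h2]
  rw [h3] at hc
  have := add_mem hc (Ideal.subset_span ⟨c, rfl⟩)
  simpa using this

include hy hdec in
lemma sq_eq (hsurj : Function.Surjective (algebraMap C D)) :
    RingHom.ker (sπ A C L) = Ideal.span (Set.range (szz A C L y)) := by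
  apply le_antisymm
  · intro u hu
    rw [RingHom.mem_ker] at hu
    have key : ∀ u : C ⊗[A] L, ∃ d : D, d ≠ 0 ∧ ∃ v, sψ A C D L v = (1 ⊗ₜ algebraMap D L d) * u := by
      intro u
      induction u using TensorProduct.induction_on with
      | zero => exact ⟨1, one_ne_zero, 0, by simp⟩
      | tmul c l =>
        obtain ⟨a, d, hd, rfl⟩ := IsFractionRing.div_surjective (A := D) l
        refine ⟨d, nonZeroDivisors.ne_zero hd, c ⊗ₜ a, ?_⟩
        have : algebraMap D L d ≠ 0 := by
          rw [Ne, FaithfulSMul.algebraMap_eq_zero_iff]; exact nonZeroDivisors.ne_zero hd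
        simp [sψ, mul_div_cancel₀ _ this]
      | add u v hu hv =>
        obtain ⟨d, hd, a, ha⟩ := hu
        obtain ⟨d', hd', a', ha'⟩ := hv
        refine ⟨d * d', mul_ne_zero hd hd', (1 ⊗ₜ d') * a + (1 ⊗ₜ d) * a', ?_⟩
        rw [map_add, map_mul, map_mul, ha, ha', map_mul]
        have h1 : ∀ d, sψ A C D L (1 ⊗ₜ d) = 1 ⊗ₜ algebraMap D L d := fun d => by simp [sψ]
        rw [h1, h1, show ((1 : C) ⊗ₜ[A] (algebraMap D L d * algebraMap D L d')) = 
          (1 ⊗ₜ algebraMap D L d) * (1 ⊗ₜ algebraMap D L d') by simp]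
        ring
    obtain ⟨d, hd, v, hv⟩ := key u
    have h1 : v ∈ Ideal.span (Set.range fun i => sK A C D (y i)) := by
      apply sker_le A C D L y hy hdec hsurj
      rw [hv, map_mul, hu, mul_zero]
    have h2 := Ideal.mem_map_of_mem (sψ A C D L) h1
    rw [Ideal.map_span, ← Set.range_comp, hv] at h2
    have h3 : sψ A C D L ∘ (fun i => sK A C D (y i)) = szz A C L y := by
      funext i
      simp [sψ, sK, szz, ← IsScalarTower.algebraMap_apply C D L]
    rw [h3] at h2
    have : algebraMap D L d ≠ 0 := by
      rwa [Ne, FaithfulSMul.algebraMap_eq_zero_iff]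
    have h4 := Ideal.mul_mem_left _ ((1 : C) ⊗ₜ[A] (algebraMap D L d)⁻¹) h2
    rw [← mul_assoc, Algebra.TensorProduct.tmul_mul_tmul, inv_mul_cancel₀ this, one_mul, ← Algebra.TensorProduct.one_def, one_mul] at h4
    exact h4
  · rw [Ideal.span_le]
    rintro _ ⟨i, rfl⟩
    simp [szz, sπ_tmul]

end sc
end LyuB

end

section

open TensorProduct

namespace LyuB
set_option linter.unusedSectionVars false
section tr
variable {C S : Type} [CommRing C] [CommRing S] [Algebra C S]

noncomputable def trMap (C S : Type) [CommRing C] [CommRing S] [Algebra C S] (s : ℕ) : Tr C s →ₐ[C] Tr S s :=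
  AdjoinRoot.liftAlgHom _ (Algebra.ofId C (Tr S s)) (tr S s) (by simp [tr_pow])

lemma trMap_t (s : ℕ) : trMap C S s (tr C s) = tr S s := by
  simp [trMap, tr]

lemma trε_trMap (s : ℕ) (u : Tr C s) : trε S s (trMap C S s u) = algebraMap C S (trε C s u) := by
  have : ((trε S s).restrictScalars C).comp (trMap C S s) = (Algebra.ofId C S).comp (trε C s) := by
    apply AdjoinRoot.algHom_ext
    have h1 := trMap_t (C := C) (S := S) s
    have h2 := trε_t C s
    rw [tr] at h1 h2
    simp [h1, h2]
  exact DFunLike.congr_fun this u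

lemma tr_isUnit (s : ℕ) (u : Tr S s) (hu : IsUnit (trε S s u)) : IsUnit u := by
  obtain ⟨c, hc⟩ := tr_decomp S s u
  rw [hc]
  have hn : IsNilpotent (tr S s * c) := ⟨s + 1, by rw [mul_pow, tr_pow, zero_mul]⟩
  refine (add_comm (tr S s * c) _) ▸ ?_
  exact hn.isUnit_add_right_of_commute (hu.map (algebraMap S (Tr S s))) (Commute.all _ _)
end tr

section sc
open IsLocalRing
variable (A C D L : Type) [CommRing A] [IsDomain A] [IsNoetherianRing A] [CommRing C] [IsLocalRing C] [IsNoetherianRing C]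
  [CommRing D] [IsDomain D] [Field L] [Algebra A C] [Algebra A D] [Algebra A L] [Algebra C D] [Algebra C L] [Algebra D L]
  [IsScalarTower A C D] [IsScalarTower A C L] [IsScalarTower A D L] [IsScalarTower C D L]
  [Module.Finite A D] [IsFractionRing D L]

noncomputable abbrev sq : Ideal (C ⊗[A] L) := RingHom.ker (sπ A C L)

instance : (sq A C L).IsPrime := RingHom.ker_isPrime _

abbrev sS : Type := Localization.AtPrime (sq A C L)

variable (hinj : Function.Injective (algebraMap A D))

include D hinj in
lemma sflatL : Module.Flat A L := by
  have h : Function.Injective (algebraMap A L) := by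
    rw [IsScalarTower.algebraMap_eq A D L]
    exact (FaithfulSMul.algebraMap_injective D L).comp hinj
  haveI : FaithfulSMul A L := (faithfulSMul_iff_algebraMap_injective A L).2 h
  letI := FractionRing.liftAlgebra A L
  exact Module.Flat.trans A (FractionRing A) L

include D in
lemma snoeth0 : IsNoetherianRing (C ⊗[A] L) := by
  haveI : Algebra.EssFiniteType D L := Algebra.EssFiniteType.of_isLocalization L (nonZeroDivisors D)
  haveI : Algebra.EssFiniteType A L := Algebra.EssFiniteType.comp A D L
  exact Algebra.EssFiniteType.isNoetherianRing C _

include D in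
lemma snoeth : IsNoetherianRing (sS A C L) := by
  haveI := snoeth0 A C D L
  infer_instance

include D hinj in
lemma sflat : Module.Flat C (sS A C L) := by
  haveI := sflatL A D L hinj
  exact Module.Flat.trans C (C ⊗[A] L) _

lemma s_tower : IsScalarTower C (C ⊗[A] L) (sS A C L) := inferInstance

lemma s_comap (c : C) : algebraMap C (sS A C L) c ∈ maximalIdeal (sS A C L) ↔ algebraMap C L c = 0 := by
  rw [IsScalarTower.algebraMap_apply C (C ⊗[A] L) (sS A C L),
    IsLocalization.AtPrime.to_map_mem_maximal_iff (sS A C L) (sq A C L), RingHom.mem_ker]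
  simp [sπ_tmul]

variable {e : ℕ} (y : Fin e → C) (hy : ∀ i, y i ∈ maximalIdeal C)
  (hdec : ∀ c : C, ∃ a : A, c - algebraMap A C a ∈ Ideal.span (Set.range y))

include D hy hdec in
lemma s_max (hsurj : Function.Surjective (algebraMap C D)) : maximalIdeal (sS A C L) =
    Ideal.span (Set.range fun i => algebraMap (C ⊗[A] L) (sS A C L) (szz A C L y i)) := by
  rw [← Localization.AtPrime.map_eq_maximalIdeal]
  have hq : sq A C L = _ := sq_eq A C D L y hy hdec hsurj
  have := congrArg (Ideal.map (algebraMap (C ⊗[A] L) (sS A C L))) hq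
  rw [Ideal.map_span, ← Set.range_comp] at this
  exact this

lemma s_phi (i : Fin e) (s : ℕ) (φ : C →ₐ[A] Tr C s) (h1 : ∀ c, trε C s (φ c) = c)
    (h2 : ∀ j, j ≠ i → φ (y j) = algebraMap C _ (y j))
    (h3 : φ (y i) = algebraMap C _ (y i) + tr C s) :
    ∃ Φ : sS A C L →+* Tr (sS A C L) s, (∀ r, trε _ s (Φ r) = r) ∧
      (∀ j, j ≠ i → Φ (algebraMap (C ⊗[A] L) (sS A C L) (szz A C L y j)) = 
        algebraMap _ _ (algebraMap (C ⊗[A] L) (sS A C L) (szz A C L y j))) ∧ 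
        Φ (algebraMap (C ⊗[A] L) (sS A C L) (szz A C L y i)) = 
          algebraMap _ _ (algebraMap (C ⊗[A] L) (sS A C L) (szz A C L y i)) + tr _ s := by
  set S := sS A C L
  let f1 : C →ₐ[A] Tr S s := ((trMap C S s).restrictScalars A).comp φ
  let f2 : L →ₐ[A] Tr S s := (IsScalarTower.toAlgHom A S (Tr S s)).comp 
    ((IsScalarTower.toAlgHom A (C ⊗[A] L) S).comp Algebra.TensorProduct.includeRight)
  let Φ0 : C ⊗[A] L →ₐ[A] Tr S s := Algebra.TensorProduct.productMap f1 f2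
  have hf2 : ∀ l, f2 l = algebraMap S (Tr S s) (algebraMap (C ⊗[A] L) S (1 ⊗ₜ l)) := fun l => rfl
  have hf1 : ∀ c, f1 c = trMap C S s (φ c) := fun l => rfl
  have hε : ∀ u, trε S s (Φ0 u) = algebraMap (C ⊗[A] L) S u := by
    intro u
    have : ((trε S s).restrictScalars A).comp Φ0 = IsScalarTower.toAlgHom A (C ⊗[A] L) S := by
      apply Algebra.TensorProduct.ext'
      intro c l
      simp only [AlgHom.comp_apply, AlgHom.restrictScalars_apply, Φ0, Algebra.TensorProduct.productMap_apply_tmul, map_mul,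
        hf1, hf2, trε_trMap, h1, IsScalarTower.coe_toAlgHom']
      rw [show (c ⊗ₜ l : C ⊗[A] L) = (c ⊗ₜ 1) * (1 ⊗ₜ l) by simp, map_mul, AlgHom.commutes]
      rfl
    exact DFunLike.congr_fun this u
  have hunit : ∀ u : (sq A C L).primeCompl, IsUnit ((Φ0 : C ⊗[A] L →+* Tr S s) u) := by
    intro u
    apply tr_isUnit
    show IsUnit (trε S s (Φ0 u))
    rw [hε]
    exact IsLocalization.map_units S u
  let Φ : S →+* Tr S s := IsLocalization.lift (M := (sq A C L).primeCompl) (g := (Φ0 : C ⊗[A] L →+* Tr S s)) hunit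
  have hΦ : ∀ u, Φ (algebraMap (C ⊗[A] L) S u) = Φ0 u := fun u => IsLocalization.lift_eq hunit u
  have e1 : ∀ c, Φ0 (c ⊗ₜ 1) = trMap C S s (φ c) := fun c => by
    simp only [Φ0, Algebra.TensorProduct.productMap_apply_tmul, map_one, mul_one, hf1]
  have e2 : ∀ l, Φ0 (1 ⊗ₜ l) = algebraMap S (Tr S s) (algebraMap (C ⊗[A] L) S (1 ⊗ₜ l)) := fun l => by
    simp only [Φ0, Algebra.TensorProduct.productMap_apply_tmul, map_one, one_mul, hf2]
  have e3 : ∀ c, algebraMap C (Tr S s) c = algebraMap S (Tr S s) (algebraMap (C ⊗[A] L) S (c ⊗ₜ 1)) := fun c => rfl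
  refine ⟨Φ, ?_, ?_, ?_⟩
  · intro r
    have : ((trε S s : Tr S s →+* S).comp Φ) = RingHom.id S := by
      apply IsLocalization.ringHom_ext (sq A C L).primeCompl
      ext u
      · show trε S s (Φ (algebraMap _ _ _)) = _
        rw [hΦ, hε]; rfl
      · show trε S s (Φ (algebraMap _ _ _)) = _
        rw [hΦ, hε]; rfl
    exact RingHom.congr_fun this r
  · intro j hj
    rw [hΦ, szz, map_sub, e1, e2, h2 j hj, AlgHom.commutes, e3, map_sub, map_sub]
  · rw [hΦ, szz, map_sub, e1, e2, h3, map_add, AlgHom.commutes, e3, map_sub, map_sub, trMap_t]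
    ring

include D in
lemma s_rad1 (Q : Ideal C) (hQ : ∀ c, algebraMap C D c = 0 ↔ c ∈ Q) (c : C) :
    ∃ a : ℕ, algebraMap (C ⊗[A] L) (sS A C L) (c ⊗ₜ 1 - 1 ⊗ₜ algebraMap C L c) ^ a ∈ Q.map (algebraMap C (sS A C L)) := by
  obtain ⟨P, hP, hP0⟩ := (inferInstance : Algebra.IsIntegral A D).isIntegral (algebraMap C D c)
  have hPQ : Polynomial.aeval c P ∈ Q := by
    rw [← hQ, ← Polynomial.aeval_algebraMap_apply]; exact hP0
  let PL := P.map (algebraMap A L)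
  have hPL : PL ≠ 0 := (hP.map _).ne_zero
  obtain ⟨P1, hP1, hnd⟩ := Polynomial.exists_eq_pow_rootMultiplicity_mul_and_not_dvd PL hPL (algebraMap C L c)
  set a := Polynomial.rootMultiplicity (algebraMap C L c) PL
  let ι : L →+* C ⊗[A] L := (Algebra.TensorProduct.includeRight : L →ₐ[A] C ⊗[A] L)
  have hι : ι.comp (algebraMap A L) = algebraMap A (C ⊗[A] L) := by
    ext r; exact (Algebra.TensorProduct.includeRight : L →ₐ[A] C ⊗[A] L).commutes r
  have h1 : Polynomial.eval₂ ι (c ⊗ₜ 1) PL = (Polynomial.aeval c P) ⊗ₜ 1 := by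
    rw [Polynomial.eval₂_map, hι]
    exact Polynomial.aeval_algHom_apply (Algebra.TensorProduct.includeLeft : C →ₐ[A] C ⊗[A] L) c P
  rw [hP1, Polynomial.eval₂_mul, Polynomial.eval₂_pow, Polynomial.eval₂_sub, Polynomial.eval₂_X, Polynomial.eval₂_C] at h1
  have h2 : IsUnit (algebraMap (C ⊗[A] L) (sS A C L) (Polynomial.eval₂ ι (c ⊗ₜ 1) P1)) := by
    refine IsLocalization.map_units (sS A C L) (⟨_, ?_⟩ : (sq A C L).primeCompl)
    show _ ∉ sq A C L
    rw [RingHom.mem_ker]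
    have h3 : sπ A C L (Polynomial.eval₂ ι (c ⊗ₜ 1) P1) = Polynomial.eval (algebraMap C L c) P1 := by
      have := Polynomial.hom_eval₂ P1 ι (sπ A C L : C ⊗[A] L →+* L) (c ⊗ₜ 1)
      refine this.trans ?_
      have h4 : ((sπ A C L : C ⊗[A] L →+* L).comp ι) = RingHom.id L := by
        ext l
        show sπ A C L (1 ⊗ₜ l) = l
        simp [sπ_tmul]
      rw [h4]
      show Polynomial.eval₂ _ (sπ A C L (c ⊗ₜ 1)) _ = _
      rw [sπ_tmul, mul_one]
      rfl
    rw [h3]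
    intro h0
    exact hnd (Polynomial.dvd_iff_isRoot.2 h0)
  refine ⟨a, ?_⟩
  have h5 := congrArg (algebraMap (C ⊗[A] L) (sS A C L)) h1
  rw [map_mul, map_pow] at h5
  rw [← Ideal.mul_unit_mem_iff_mem _ h2]
  show algebraMap (C ⊗[A] L) (sS A C L) (c ⊗ₜ 1 - ι _) ^ a * _ ∈ _
  rw [h5]
  exact Ideal.mem_map_of_mem _ hPQ

include D hy hdec in
lemma s_rad (hsurj : Function.Surjective (algebraMap C D)) (Q : Ideal C) (hQ : ∀ c, algebraMap C D c = 0 ↔ c ∈ Q) :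
    ∃ k, maximalIdeal (sS A C L) ^ k ≤ Q.map (algebraMap C (sS A C L)) := by
  haveI := snoeth A C D L
  apply Ideal.exists_pow_le_of_le_radical_of_fg
  · rw [s_max A C D L y hy hdec hsurj, Ideal.span_le]
    rintro _ ⟨i, rfl⟩
    exact s_rad1 A C D L Q hQ (y i)
  · exact IsNoetherian.noetherian _

end sc
end LyuB

end

section

open TensorProduct

namespace LyuB
section sx
open IsLocalRing

lemma exists_S {C k : Type} [CommRing C] [IsLocalRing C] [Field k] {n : ℕ} {g : k →+* C} (h : CD C k n g)
    (x : Fin n → C) (hx : Ideal.span (Set.range x) = maximalIdeal C) (Q : Ideal C) [Q.IsPrime] :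
    ∃ (S : Type) (_ : CommRing S) (_ : IsLocalRing S) (_ : IsNoetherianRing S) (_ : Algebra C S) (_ : Module.Flat C S)
      (e : ℕ) (z : Fin e → S), maximalIdeal S = Ideal.span (Set.range z) ∧
      (∀ i s, ∃ φ : S →+* Tr S s, (∀ r, trε S s (φ r) = r) ∧
      (∀ j, j ≠ i → φ (z j) = algebraMap S _ (z j)) ∧ φ (z i) = algebraMap S _ (z i) + tr S s) ∧
      (∃ k, maximalIdeal S ^ k ≤ Q.map (algebraMap C S)) ∧
      (∀ c, algebraMap C S c ∈ maximalIdeal S ↔ c ∈ Q) := by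
  classical
  haveI := h.noeth x hx
  obtain ⟨x, σ, hx, ⟨N, hN⟩, hd⟩ := exists_params x hx Q (Ideal.IsPrime.ne_top inferInstance)
  have hxm : ∀ i, x i ∈ maximalIdeal C := fun i => hx ▸ Ideal.subset_span ⟨i, rfl⟩
  obtain ⟨F, hF1, hF2⟩ := h.exists_phi (σ := σ) (fun i => x i) (fun i => hxm i)
  letI : Algebra (MvPowerSeries σ k) C := F.toAlgebra
  replace hF1 : ∀ a, algebraMap (MvPowerSeries σ k) C (MvPowerSeries.C a) = g a := hF1
  replace hF2 : ∀ i, algebraMap (MvPowerSeries σ k) C (MvPowerSeries.X i) = x i := hF2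
  haveI := nn_finite h hx hF1 hF2 Q N hN
  have hinj := nn_inj (k := k) (σ := σ) Q hd
  have hφ := nn_taylor h hx hF1 hF2
  let eq := Fintype.equivFin {i // i ∉ σ}
  let y : Fin (Fintype.card {i // i ∉ σ}) → C := fun j => x (eq.symm j).1
  have hdec : ∀ c : C, ∃ a : MvPowerSeries σ k, c - algebraMap _ C a ∈ Ideal.span (Set.range y) := by
    intro c
    obtain ⟨a, ha⟩ := nn_decomp h hx hF1 hF2 c
    refine ⟨a, ?_⟩
    convert ha using 3
    ext w
    constructor
    · rintro ⟨j, rfl⟩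
      exact ⟨_, (eq.symm j).2, rfl⟩
    · rintro ⟨j, hj, rfl⟩
      exact ⟨eq ⟨j, hj⟩, by simp [y]⟩
  have hy : ∀ i, y i ∈ maximalIdeal C := fun i => hxm _
  have hsurj : Function.Surjective (algebraMap C (C ⧸ Q)) := Ideal.Quotient.mk_surjective
  let A := MvPowerSeries σ k
  haveI : IsDomain A := (NoZeroDivisors.to_isDomain (MvPowerSeries σ k) :)
  let L := FractionRing (C ⧸ Q)
  refine ⟨sS A C L, inferInstance, inferInstance, snoeth A C (C ⧸ Q) L, inferInstance, sflat A C (C ⧸ Q) L hinj,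
    _, _, s_max A C (C ⧸ Q) L y hy hdec hsurj, ?_, s_rad A C (C ⧸ Q) L y hy hdec hsurj Q (fun c => Ideal.Quotient.eq_zero_iff_mem), ?_⟩
  · intro i s
    obtain ⟨φ, h1, h2, h3⟩ := hφ (eq.symm i).1 (eq.symm i).2 s
    refine s_phi A C L y i s φ h1 (fun j hj => h2 _ ?_) h3
    intro h4
    exact hj (eq.symm.injective (Subtype.ext h4))
  · intro c
    rw [s_comap, IsScalarTower.algebraMap_apply C (C ⧸ Q) L, FaithfulSMul.algebraMap_eq_zero_iff]
    exact Ideal.Quotient.eq_zero_iff_mem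

lemma baer_cd {R : Type} [CommRing R] [IsNoetherianRing R] {C k : Type} [CommRing C] [IsLocalRing C] [Field k] {n : ℕ} {g : k →+* C}
    (h : CD C k n g) (x : Fin n → C) (hx : Ideal.span (Set.range x) = maximalIdeal C)
    [Algebra R C] [Module.FaithfullyFlat R C] {M : Type} [AddCommGroup M] [Module R M]
    (hM : IsCrys R M) (p : Ideal R) [p.IsPrime]
    (htors : ∀ x : M, ∃ k : ℕ, ∀ a ∈ p ^ k, a • x = 0)
    (hbij : ∀ s, s ∉ p → Function.Bijective (fun x : M => s • x)) : Module.Baer R M := by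
  haveI := h.noeth x hx
  obtain ⟨P, hP, hPp⟩ := Ideal.exists_isPrime_liesOver_of_faithfullyFlat (B := C) p
  have hle : p.map (algebraMap R C) ≤ P := by
    rw [Ideal.map_le_iff_le_comap]; exact hPp.over.le
  obtain ⟨Q, hQ, hQP⟩ := Ideal.exists_minimalPrimes_le hle
  haveI := hQ.1.1
  obtain ⟨S, _, _, _, _, _, e, z, hz, hφ, ⟨k', hk⟩, hcomap⟩ := exists_S h x hx Q
  letI : Algebra R S := ((algebraMap C S).comp (algebraMap R C)).toAlgebra
  haveI : IsScalarTower R C S := IsScalarTower.of_algebraMap_eq fun _ => rfl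
  haveI : Module.Flat R S := Module.Flat.trans R C S
  have hmap : p.map (algebraMap R S) = (p.map (algebraMap R C)).map (algebraMap C S) := by
    rw [Ideal.map_map]; rfl
  refine baer_of_ext hM p htors hbij S ?_ z hz hφ ?_
  · rw [hmap, Ideal.map_le_iff_le_comap]
    intro c hc
    exact (hcomap c).2 (hQ.1.2 hc)
  · have h1 : Q.map (algebraMap C S) ≤ (p.map (algebraMap R S)).radical := by
      rw [hmap, Ideal.map_le_iff_le_comap]
      intro q hq
      have h2 := IsLocalization.AtPrime.radical_map_of_mem_minimalPrimes (A := Localization.AtPrime Q) Q _ hQ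
      have h3 : algebraMap C (Localization.AtPrime Q) q ∈ ((p.map (algebraMap R C)).map (algebraMap C (Localization.AtPrime Q))).radical := by
        rw [h2]; exact Ideal.mem_map_of_mem _ hq
      obtain ⟨a, ha⟩ := h3
      rw [← map_pow, IsLocalization.algebraMap_mem_map_algebraMap_iff Q.primeCompl] at ha
      obtain ⟨t, ht, ht2⟩ := ha
      refine ⟨a, ?_⟩
      have h4 := Ideal.mem_map_of_mem (algebraMap C S) ht2
      rw [map_mul, map_pow] at h4
      refine (Ideal.unit_mul_mem_iff_mem _ ?_).1 h4
      by_contra hu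
      exact ht ((hcomap t).1 ((mem_maximalIdeal _).2 hu))
    obtain ⟨l, hl⟩ := Ideal.exists_pow_le_of_le_radical_of_fg h1 (IsNoetherian.noetherian _)
    refine ⟨k' * l, ?_⟩
    rw [pow_mul]
    exact (Ideal.pow_right_mono hk l).trans hl

end sx
end LyuB

end

section

open TensorProduct
open IsLocalRing
namespace LyuB

open RingTheory.Sequence in
lemma reg_step {R : Type} [CommRing R] [IsLocalRing R] [IsNoetherianRing R] {n : ℕ} (x : Fin (n+1) → R)
    (hx : Ideal.span (Set.range x) = maximalIdeal R) (hn : ((n+1 : ℕ) : WithBot ℕ∞) ≤ ringKrullDim R) (i : Fin (n+1)) :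
    ∃ _ : IsLocalRing (R ⧸ Ideal.span {x i}),
    Ideal.span (Set.range fun j => Ideal.Quotient.mk (Ideal.span {x i}) (x (i.succAbove j))) =
      maximalIdeal (R ⧸ Ideal.span {x i}) ∧ (n : WithBot ℕ∞) ≤ ringKrullDim (R ⧸ Ideal.span {x i}) := by
  have hxm : ∀ i, x i ∈ maximalIdeal R := fun i => hx ▸ Ideal.subset_span ⟨i, rfl⟩
  have hle : Ideal.span {x i} ≤ maximalIdeal R := by
    rw [Ideal.span_le]; rintro _ rfl; exact hxm i
  haveI : Nontrivial (R ⧸ Ideal.span {x i}) := Ideal.Quotient.nontrivial_iff.2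
    (ne_top_of_le_ne_top (Ideal.IsPrime.ne_top inferInstance) hle)
  haveI : IsLocalRing (R ⧸ Ideal.span {x i}) := IsLocalRing.of_surjective' (Ideal.Quotient.mk _) Ideal.Quotient.mk_surjective
  refine ⟨this, ?_, ?_⟩
  · have h1 : maximalIdeal (R ⧸ Ideal.span {x i}) = (maximalIdeal R).map (Ideal.Quotient.mk _) := by
      haveI : IsLocalHom (Ideal.Quotient.mk (Ideal.span {x i})) := IsLocalHom.of_surjective _ Ideal.Quotient.mk_surjective
      have h2 : (maximalIdeal _).comap (Ideal.Quotient.mk (Ideal.span {x i})) = maximalIdeal R :=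
        ((local_hom_TFAE (Ideal.Quotient.mk (Ideal.span {x i}))).out 0 4).1 this
      rw [← h2, Ideal.map_comap_of_surjective _ Ideal.Quotient.mk_surjective]
    rw [h1, ← hx, Ideal.map_span, ← Set.range_comp]
    apply le_antisymm
    · apply Ideal.span_mono
      rintro _ ⟨j, rfl⟩; exact ⟨_, rfl⟩
    · rw [Ideal.span_le]
      rintro _ ⟨j, rfl⟩
      rcases eq_or_ne j i with rfl | hj
      · have : Ideal.Quotient.mk (Ideal.span {x j}) (x j) = 0 := Ideal.Quotient.eq_zero_iff_mem.2 (Ideal.mem_span_singleton_self _)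
        simp [this]
      · obtain ⟨l, rfl⟩ := Fin.exists_succAbove_eq hj
        exact Ideal.subset_span ⟨l, rfl⟩
  · have := ringKrullDim_le_ringKrullDim_quotient_add_card {x i} (by
      rw [IsLocalRing.ringJacobson_eq_maximalIdeal]; simpa using hxm i)
    rw [Finset.coe_singleton, Finset.card_singleton] at this
    have := hn.trans this
    push_cast at this
    exact ENat.WithBot.add_le_add_one_right_iff.1 this

lemma regular_domain (n : ℕ) : ∀ (R : Type) [CommRing R] [IsLocalRing R] [IsNoetherianRing R] (x : Fin n → R)
    (_ : Ideal.span (Set.range x) = maximalIdeal R) (_ : (n : WithBot ℕ∞) ≤ ringKrullDim R), IsDomain R := by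
  induction n with
  | zero =>
    intro R _ _ _ x hx hn
    have : maximalIdeal R = ⊥ := by rw [← hx]; simp
    exact (IsLocalRing.isField_iff_maximalIdeal_eq.2 this).isDomain
  | succ n ih =>
    intro R _ _ _ x hx hn
    have hmin : ∀ p ∈ minimalPrimes R, p ≠ maximalIdeal R := by
      rintro p hp rfl
      have h0 : ringKrullDim R = 0 := by
        rw [← IsLocalRing.maximalIdeal_height_eq_ringKrullDim, Ideal.height_eq_zero_iff.2 hp]; rfl
      rw [h0] at hn
      have : ((n+1 : ℕ) : WithBot ℕ∞) ≤ ((0:ℕ) : WithBot ℕ∞) := hn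
      rw [Nat.cast_le] at this; omega
    have hne : maximalIdeal R ≠ ⊥ := by
      intro h
      obtain ⟨p, hp⟩ := (⊥ : Ideal R).nonempty_minimalPrimes bot_ne_top
      refine hmin p hp (le_antisymm (le_maximalIdeal hp.1.1.ne_top) (h ▸ bot_le))
    obtain ⟨i, -, z, hz, hzp, hx'⟩ := rsp_avoid x hx ∅ (by simpa using hne.symm) (minimalPrimes R)
      (minimalPrimes.finite_of_isNoetherianRing R) (fun p hp => hp.1.1) hmin
    obtain ⟨_, h1, h2⟩ := reg_step _ hx' hn i
    have hdom := ih _ _ h1 h2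
    rw [show Function.update x i z i = z from Function.update_self ..] at hdom
    have hpz : (Ideal.span {z}).IsPrime := (Ideal.Quotient.isDomain_iff_prime _).1 hdom
    obtain ⟨P, hP, hPz⟩ := Ideal.exists_minimalPrimes_le (I := ⊥) (J := Ideal.span {z}) bot_le
    have hPp := hP.1.1
    have : P ≤ maximalIdeal R • P := by
      intro a ha
      obtain ⟨b, rfl⟩ := Ideal.mem_span_singleton'.1 (hPz ha)
      have hb := (hPp.mem_or_mem ha).resolve_right (hzp P hP)
      rw [mul_comm]
      exact Submodule.smul_mem_smul hz hb
    have hP0 : P = ⊥ := by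
      refine Submodule.eq_bot_of_le_smul_of_le_jacobson_bot _ _ (IsNoetherian.noetherian _) this ?_
      rw [IsLocalRing.jacobson_eq_maximalIdeal ⊥ bot_ne_top]
    haveI : (⊥ : Ideal R).IsPrime := hP0 ▸ hPp
    exact IsDomain.of_bot_isPrime R  

open RingTheory.Sequence in
lemma regular_seq (n : ℕ) : ∀ (R : Type) [CommRing R] [IsLocalRing R] [IsNoetherianRing R] (x : Fin n → R)
    (_ : Ideal.span (Set.range x) = maximalIdeal R) (_ : (n : WithBot ℕ∞) ≤ ringKrullDim R),
    IsWeaklyRegular R (List.ofFn x) := by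
  induction n with
  | zero => intro R _ _ _ x hx hn; simp
  | succ n ih =>
    intro R _ _ _ x hx hn
    haveI := regular_domain _ R x hx hn
    obtain ⟨_, h1, h2⟩ := reg_step x hx hn 0
    rw [List.ofFn_succ, isWeaklyRegular_cons_iff']
    constructor
    · rw [isSMulRegular_iff_right_eq_zero_of_smul]
      intro a ha
      refine (mul_eq_zero.1 ha).resolve_left ?_
      intro h0
      have h3 := ringKrullDim_le_spanFinrank_maximalIdeal R
      have h4 : Ideal.span (Set.range (fun j => x (Fin.succ j))) = maximalIdeal R := by
        rw [← hx]
        apply le_antisymm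
        · apply Ideal.span_mono; rintro _ ⟨j, rfl⟩; exact ⟨_, rfl⟩
        · rw [Ideal.span_le]
          rintro _ ⟨j, rfl⟩
          refine Fin.cases ?_ (fun j => Ideal.subset_span ⟨j, rfl⟩) j
          rw [h0]; exact zero_mem _
      have h5 := Submodule.spanFinrank_span_le_ncard_of_finite (R := R) (Set.finite_range (fun j => x (Fin.succ j)))
      rw [show Submodule.span R _ = _ from h4] at h5
      have h6 : (Set.range (fun j => x (Fin.succ j))).ncard ≤ n := by
        rw [← Set.image_univ]
        refine (Set.ncard_image_le Set.finite_univ).trans ?_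
        simp [Set.ncard_univ]
      have h7 := hn.trans (h3.trans (Nat.cast_le.2 (h5.trans h6)))
      rw [Nat.cast_le] at h7; omega
    · have h3 := ih _ _ h1 h2
      have h4 : (R ⧸ Ideal.span {x 0}) ≃ₗ[R ⧸ Ideal.span {x 0}] QuotSMulTop (x 0) R := by
        have e : (R ⧸ Ideal.span {x 0}) ≃ₗ[R] QuotSMulTop (x 0) R :=
          Submodule.quotEquivOfEq _ _ (by rw [← Submodule.ideal_span_singleton_smul]; simp)
        exact LinearEquiv.extendScalarsOfSurjective Ideal.Quotient.mk_surjective e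
      rw [← h4.isWeaklyRegular_congr]
      rw [List.map_ofFn]
      exact h3

/-- Everything about completion. -/
lemma exists_cd {R : Type} [CommRing R] [IsLocalRing R] [IsNoetherianRing R] {n : ℕ} (x : Fin n → R)
    (hx : Ideal.span (Set.range x) = maximalIdeal R) (hn : (n : WithBot ℕ∞) ≤ ringKrullDim R)
    (F : Type) [Field F] (i : F →+* R) :
    ∃ (C : Type) (_ : CommRing C) (_ : IsLocalRing C) (_ : Algebra R C) (_ : Module.FaithfullyFlat R C)
      (k : Type) (_ : Field k) (g : k →+* C), CD C k n g ∧
      Ideal.span (Set.range fun j => algebraMap R C (x j)) = maximalIdeal C := by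
  let C := AdicCompletion (maximalIdeal R) R
  haveI : Module.Flat R C := AdicCompletion.flat_of_isNoetherian _
  haveI : Module.FaithfullyFlat R C := Module.FaithfullyFlat.of_flat_of_isLocalHom
  obtain ⟨k, _, g, hg⟩ := exists_coeff C F ((algebraMap R C).comp i)
  have hmax : Ideal.span (Set.range fun j => algebraMap R C (x j)) = maximalIdeal C := by
    have e1 : maximalIdeal C = (maximalIdeal R).map (algebraMap R C) := AdicCompletion.maximalIdeal_eq_map (R := R)
    have e2 := congrArg (Ideal.map (algebraMap R C)) hx
    rw [e1, ← e2, Ideal.map_span, ← Set.range_comp]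
    rfl
  have h0 : CD C k 0 g := ⟨inferInstance, hg, ringKrullDim_nonneg_of_nontrivial⟩
  haveI : IsNoetherianRing C := by
    have hm' : ∀ j, algebraMap R C (x j) ∈ maximalIdeal C := fun j => by
      rw [← hmax]; exact Ideal.subset_span ⟨j, rfl⟩
    obtain ⟨F, h1, h2⟩ := h0.exists_phi (fun j => algebraMap R C (x j)) hm'
    exact isNoetherianRing_of_surjective _ _ F (h0.phi_surj _ hmax F h1 h2)
  have hreg := regular_seq n R x hx hn
  have hxm : ∀ i, x i ∈ maximalIdeal R := fun i => hx ▸ Ideal.subset_span ⟨i, rfl⟩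
  have hreg2 := RingTheory.Sequence.IsRegular.of_isWeaklyRegular_of_mem_maximalIdeal R (rs := List.ofFn x) (by
    intro r hr; obtain ⟨j, rfl⟩ := (List.mem_ofFn' _ _).1 hr; exact hxm j) hreg
  have hreg3 := RingTheory.Sequence.IsRegular.of_faithfullyFlat (S := C) hreg2
  have hd := ringKrullDim_add_length_eq_ringKrullDim_of_isRegular _ hreg3
  refine ⟨C, inferInstance, inferInstance, inferInstance, inferInstance, k, inferInstance, g, ⟨inferInstance, hg, ?_⟩, hmax⟩
  rw [← hd, List.length_map, List.length_ofFn]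
  haveI : Nontrivial (C ⧸ Ideal.ofList (List.map (algebraMap R C) (List.ofFn x))) := by
    refine Ideal.Quotient.nontrivial_iff.2 (fun h => hreg3.2 ?_)
    rw [h]; simp
  exact le_add_of_nonneg_left ringKrullDim_nonneg_of_nontrivial

end LyuB

end

section

open TensorProduct
open IsLocalRing CategoryTheory CategoryTheory.Abelian
namespace LyuB

section
variable {R : Type} [CommRing R] {A B C : Type} [AddCommGroup A] [AddCommGroup B] [AddCommGroup C]
  [Module R A] [Module R B] [Module R C]

/-- short complex of modules -/
noncomputable def sc (f : A →ₗ[R] B) (g : B →ₗ[R] C) (h : Function.Exact f g) : ShortComplex (ModuleCat.{0} R) :=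
  ShortComplex.mk (ModuleCat.ofHom f) (ModuleCat.ofHom g) (by
    ext a; exact h.apply_apply_eq_zero a)

lemma sc_se (f : A →ₗ[R] B) (g : B →ₗ[R] C) (h : Function.Exact f g) (hf : Function.Injective f)
    (hg : Function.Surjective g) : (sc f g h).ShortExact where
  exact := (ShortComplex.ShortExact.moduleCat_exact_iff_function_exact _).2 h
  mono_f := (ModuleCat.mono_iff_injective _).2 hf
  epi_g := (ModuleCat.epi_iff_surjective _).2 hg

lemma ext_mid_left (f : A →ₗ[R] B) (g : B →ₗ[R] C) (h : Function.Exact f g) (hf : Function.Injective f)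
    (hg : Function.Surjective g) (M : ModuleCat.{0} R) (i : ℕ) (hA : Subsingleton (Ext (ModuleCat.of R A) M i))
    (hC : Subsingleton (Ext (ModuleCat.of R C) M i)) : Subsingleton (Ext (ModuleCat.of R B) M i) := by
  refine subsingleton_of_forall_eq 0 fun y => ?_
  obtain ⟨z, rfl⟩ := Ext.contravariant_sequence_exact₂ (sc_se f g h hf hg) M y (hA.elim _ _)
  rw [show z = 0 from hC.elim _ _, Ext.comp_zero]
  rfl

lemma ext_iso_left (e : A ≃ₗ[R] B) (M : ModuleCat.{0} R) (i : ℕ) (hA : Subsingleton (Ext (ModuleCat.of R A) M i)) :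
    Subsingleton (Ext (ModuleCat.of R B) M i) := by
  refine subsingleton_of_forall_eq 0 fun y => ?_
  have h1 : (Ext.mk₀ (ModuleCat.ofHom e.symm.toLinearMap)).comp ((Ext.mk₀ (ModuleCat.ofHom e.toLinearMap)).comp y (zero_add i)) (zero_add i) = y := by
    rw [← Ext.comp_assoc_of_second_deg_zero, Ext.mk₀_comp_mk₀, ← ModuleCat.ofHom_comp]
    simp
  rw [← h1, show (Ext.mk₀ (ModuleCat.ofHom e.toLinearMap)).comp y (zero_add i) = 0 from hA.elim _ _, Ext.comp_zero]

lemma ext_of_subsingleton [Subsingleton A] (M : ModuleCat.{0} R) (i : ℕ) : Subsingleton (Ext (ModuleCat.of R A) M i) := by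
  refine subsingleton_of_forall_eq 0 fun y => ?_
  rw [← Ext.mk₀_id_comp y, show 𝟙 (ModuleCat.of R A) = 0 from (ModuleCat.isZero_of_subsingleton _).eq_of_src _ _, Ext.mk₀_zero,
    Ext.zero_comp]

lemma ext_smul_surj (x : R) (g : A →ₗ[R] C) (h : Function.Exact (LinearMap.lsmul R A x) g) (hf : Function.Injective (LinearMap.lsmul R A x))
    (hg : Function.Surjective g) (M : ModuleCat.{0} R) (i : ℕ) 
    (hC : Subsingleton (Ext (ModuleCat.of R C) M (i+1))) (y : Ext (ModuleCat.of R A) M i) : ∃ z, y = x • z := by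
  obtain ⟨z, hz⟩ := Ext.contravariant_sequence_exact₁ (sc_se _ g h hf hg) _ y (add_comm 1 i) (hC.elim _ _)
  have key : ∀ z : Ext (ModuleCat.of R A) M i, (Ext.mk₀ (x • 𝟙 (ModuleCat.of R A))).comp z (zero_add i) = x • z := by
    intro z
    rw [Ext.mk₀_smul, Ext.smul_comp, Ext.mk₀_id_comp]
  exact ⟨z, hz.symm.trans (key z)⟩
end

lemma ischebeck {R : Type} [CommRing R] [IsLocalRing R] [IsNoetherianRing R] (M : ModuleCat.{0} R) [Module.Finite R M]
    (n : ℕ) (h0 : ∀ i < n, Subsingleton (Ext (ModuleCat.of R (R ⧸ maximalIdeal R)) M i)) (r : ℕ) :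
    ∀ (N : Type) [AddCommGroup N] [Module R N] [Module.Finite R N]
      (_ : ∀ p ∈ Module.support R N, ringKrullDim (R ⧸ p.asIdeal) < r) (i : ℕ) (_ : i + r ≤ n),
      Subsingleton (Ext (ModuleCat.of R N) M i) := by
  induction r with
  | zero =>
    intro N _ _ _ hN i hi
    have : Subsingleton N := by
      rw [← Module.support_eq_empty_iff (R := R), Set.eq_empty_iff_forall_notMem]
      intro p hp
      have h1 := hN p hp
      have h2 : 0 ≤ ringKrullDim (R ⧸ p.asIdeal) := ringKrullDim_nonneg_of_nontrivial
      exact absurd (h2.trans_lt h1) (by simp)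
    exact ext_of_subsingleton M i
  | succ r ih =>
    intro N _ _ hfin hN i hi
    revert hN
    induction hfin using IsNoetherianRing.induction_on_isQuotientEquivQuotientPrime with
    | subsingleton N => intro _; exact ext_of_subsingleton M i
    | exact N₁ N₂ N₃ f g hf hg hfg h₁ h₃ =>
      intro hN
      refine ext_mid_left f g hfg hf hg M i (h₁ fun p hp => hN p ?_) (h₃ fun p hp => hN p ?_)
      · exact Module.support_subset_of_injective f hf hp
      · exact Module.support_subset_of_surjective g hg hp
    | quotient N p e =>
      intro hN
      refine ext_iso_left e.symm M i ?_
      have hp := p.2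
      have hdp : ringKrullDim (R ⧸ p.asIdeal) < (r + 1 : ℕ) := by
        apply hN p
        rw [e.support_eq, Module.support_eq_zeroLocus, Ideal.annihilator_quotient]
        exact fun x hx => hx
      by_cases hm : p.asIdeal = maximalIdeal R
      · rw [hm]; exact h0 i (by omega)
      · obtain ⟨x, hx, hxp⟩ : ∃ x ∈ maximalIdeal R, x ∉ p.asIdeal := by
          by_contra hcon
          push Not at hcon
          exact hm (le_antisymm (le_maximalIdeal hp.ne_top) hcon)
        let q := p.asIdeal ⊔ Ideal.span {x}
        have hle : p.asIdeal ≤ q := le_sup_left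
        let g : (R ⧸ p.asIdeal) →ₗ[R] (R ⧸ q) := (Ideal.Quotient.factorₐ R hle).toLinearMap
        have hgm : ∀ a, g (Ideal.Quotient.mk _ a) = Ideal.Quotient.mk _ a := fun a => rfl
        have hg : Function.Surjective g := Ideal.Quotient.factor_surjective hle
        have hdom : IsDomain (R ⧸ p.asIdeal) := inferInstance
        have hsm : ∀ b, LinearMap.lsmul R (R ⧸ p.asIdeal) x b = Ideal.Quotient.mk _ x * b := fun b => by
          obtain ⟨b, rfl⟩ := Ideal.Quotient.mk_surjective b; rfl
        have hinj : Function.Injective (LinearMap.lsmul R (R ⧸ p.asIdeal) x) := by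
          rw [injective_iff_map_eq_zero]
          intro b hb
          rw [hsm] at hb
          exact (mul_eq_zero.1 hb).resolve_left (fun h => hxp (Ideal.Quotient.eq_zero_iff_mem.1 h))
        have hex : Function.Exact (LinearMap.lsmul R (R ⧸ p.asIdeal) x) g := by
          intro b
          constructor
          · intro hb
            obtain ⟨b, rfl⟩ := Ideal.Quotient.mk_surjective b
            rw [hgm, Ideal.Quotient.eq_zero_iff_mem, Submodule.mem_sup] at hb
            obtain ⟨u, hu, v, hv, rfl⟩ := hb
            obtain ⟨c, rfl⟩ := Ideal.mem_span_singleton'.1 hv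
            refine ⟨Ideal.Quotient.mk _ c, ?_⟩
            rw [hsm, map_add, Ideal.Quotient.eq_zero_iff_mem.2 hu, zero_add, map_mul, mul_comm]
          · rintro ⟨b, rfl⟩
            obtain ⟨b, rfl⟩ := Ideal.Quotient.mk_surjective b
            rw [hsm, ← map_mul, hgm, Ideal.Quotient.eq_zero_iff_mem]
            exact Ideal.mul_mem_right _ _ (le_sup_right (a := p.asIdeal) (Ideal.mem_span_singleton_self x))
        have hS : Subsingleton (Ext (ModuleCat.of R (R ⧸ q)) M (i+1)) := by
          refine ih (R ⧸ q) (fun P hP => ?_) (i+1) (by omega)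
          rw [Module.support_eq_zeroLocus, Ideal.annihilator_quotient] at hP
          have hP' : q ≤ P.asIdeal := hP
          have hPp := P.2
          have hxP : x ∈ P.asIdeal := hP' (le_sup_right (a := p.asIdeal) (Ideal.mem_span_singleton_self x))
          have h2 : ringKrullDim (R ⧸ P.asIdeal) + 1 ≤ ringKrullDim (R ⧸ p.asIdeal) := by
            have h3 : ringKrullDim (R ⧸ P.asIdeal) ≤ ringKrullDim ((R ⧸ q)) :=
              ringKrullDim_le_of_surjective (Ideal.Quotient.factor hP') (Ideal.Quotient.factor_surjective hP')
            have h4 := dim_drop p.asIdeal x (by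
              intro p' hp'
              rw [Ideal.minimalPrimes_eq_subsingleton_self] at hp'
              rw [show p' = p.asIdeal from hp']; exact hxp)
            exact (add_le_add_left h3 1).trans h4
          have h5 := h2.trans_lt hdp
          push_cast at h5
          rw [ENat.WithBot.lt_add_one_iff, ENat.WithBot.add_one_le_natCast_iff] at h5
          exact h5
        have hfinE : Module.Finite R (Ext (ModuleCat.of R (R ⧸ p.asIdeal)) M i) := inferInstance
        have htop : (⊤ : Submodule R (Ext (ModuleCat.of R (R ⧸ p.asIdeal)) M i)) ≤ maximalIdeal R • ⊤ := by
          intro y _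
          obtain ⟨z, rfl⟩ := ext_smul_surj x g hex hinj hg M i hS y
          exact Submodule.smul_mem_smul hx trivial
        have := Submodule.eq_bot_of_le_smul_of_le_jacobson_bot _ _ hfinE.1 htop (by
          rw [IsLocalRing.jacobson_eq_maximalIdeal ⊥ bot_ne_top])
        exact (Submodule.subsingleton_iff R).1 (subsingleton_of_bot_eq_top this.symm)

end LyuB

end

section

open TensorProduct
open IsLocalRing CategoryTheory CategoryTheory.Abelian
open RingTheory.Sequence
namespace LyuB

lemma ext_iso_right {R : Type} [CommRing R] (N : ModuleCat.{0} R) {A B : Type} [AddCommGroup A] [AddCommGroup B]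
    [Module R A] [Module R B] (e : A ≃ₗ[R] B) (i : ℕ) (hA : Subsingleton (Ext N (ModuleCat.of R A) i)) :
    Subsingleton (Ext N (ModuleCat.of R B) i) := by
  refine subsingleton_of_forall_eq 0 fun y => ?_
  have h1 : (y.comp (Ext.mk₀ (ModuleCat.ofHom e.symm.toLinearMap)) (add_zero i)).comp (Ext.mk₀ (ModuleCat.ofHom e.toLinearMap)) (add_zero i) = y := by
    rw [Ext.comp_assoc_of_third_deg_zero, Ext.mk₀_comp_mk₀, ← ModuleCat.ofHom_comp]
    simp
  rw [← h1, show y.comp (Ext.mk₀ (ModuleCat.ofHom e.symm.toLinearMap)) (add_zero i) = 0 from hA.elim _ _, Ext.zero_comp]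

lemma depth_quot {R : Type} [CommRing R] (N : ModuleCat.{0} R) (rs : List R) :
    ∀ (M : Type) [AddCommGroup M] [Module R M] (_ : IsWeaklyRegular M rs) (a : ℕ)
    (_ : ∀ i < a + rs.length, Subsingleton (Ext N (ModuleCat.of R M) i)),
    ∀ i < a, Subsingleton (Ext N (ModuleCat.of R (M ⧸ (Ideal.ofList rs • ⊤ : Submodule R M))) i) := by
  induction rs with
  | nil =>
    intro M _ _ _ a h i hi
    have hb : (Ideal.ofList ([] : List R) • ⊤ : Submodule R M) = ⊥ :=
      Eq.trans (congrArg (· • (⊤ : Submodule R M)) Ideal.ofList_nil) (Submodule.bot_smul ⊤)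
    have e : M ≃ₗ[R] (M ⧸ (Ideal.ofList ([] : List R) • ⊤ : Submodule R M)) := (Submodule.quotEquivOfEqBot _ hb).symm
    haveI := h i (by simpa using hi)
    exact ext_iso_right N e i this
  | cons r rs ih =>
    intro M _ _ hM a h i hi
    rw [isWeaklyRegular_cons_iff] at hM
    have h1 : ∀ i < a + rs.length, Subsingleton (Ext N (ModuleCat.of R (QuotSMulTop r M)) i) := by
      intro i hi
      simp only [List.length_cons] at h
      have zero1 := AddCommGrpCat.isZero_of_iff_subsingleton.mpr (h i (by omega))
      have zero2 := AddCommGrpCat.isZero_of_iff_subsingleton.mpr (h (i + 1) (by omega))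
      exact AddCommGrpCat.subsingleton_of_isZero <| ShortComplex.Exact.isZero_of_both_zeros
        ((Ext.covariant_sequence_exact₃' N (IsSMulRegular.smulShortComplex_shortExact (M := ModuleCat.of R M) hM.1)) i (i + 1) rfl)
        (zero1.eq_zero_of_src _) (zero2.eq_zero_of_tgt _)
    exact ext_iso_right N (Submodule.quotOfListConsSMulTopEquivQuotSMulTopInner M r rs).symm i (ih _ hM.2 a h1 i hi)

lemma exists_reg {R : Type} [CommRing R] [IsLocalRing R] [IsNoetherianRing R] {n : ℕ} (x : Fin n → R)
    (hx : Ideal.span (Set.range x) = maximalIdeal R) (hn : (n : WithBot ℕ∞) ≤ ringKrullDim R) (fs : List R) 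
    (hfs : IsWeaklyRegular R fs) (j : ℕ) (hj : fs.length + j ≤ n) :
    ∃ (y : Fin n → R) (l : List (Fin n)), Ideal.span (Set.range y) = maximalIdeal R ∧ l.Nodup ∧ l.length = j ∧
      IsWeaklyRegular R (fs ++ l.map y) := by
  induction j with
  | zero => exact ⟨x, [], hx, List.nodup_nil, rfl, by simpa using hfs⟩
  | succ j ih =>
    obtain ⟨y, l, hy, hl, hlj, hr⟩ := ih (by omega)
    have hreg := regular_seq n R x hx hn
    have hxm : ∀ i, x i ∈ maximalIdeal R := fun i => hx ▸ Ideal.subset_span ⟨i, rfl⟩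
    have hxr := IsRegular.of_isWeaklyRegular_of_mem_maximalIdeal R (rs := List.ofFn x) (by
      intro r hr; obtain ⟨j, rfl⟩ := (List.mem_ofFn' _ _).1 hr; exact hxm j) hreg
    have hext := ModuleCat.subsingleton_ext_of_exists_isRegular (maximalIdeal R) (ModuleCat.of R (R ⧸ maximalIdeal R))
      (by rw [Module.support_eq_zeroLocus, Ideal.annihilator_quotient]) (ModuleCat.of R R)
      (by simpa [lt_top_iff_ne_top] using (maximalIdeal.isMaximal R).ne_top) (List.ofFn x) (by
      intro r hr; obtain ⟨j, rfl⟩ := (List.mem_ofFn' _ _).1 hr; exact hxm j) hxr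
    rw [List.length_ofFn] at hext
    set rs := fs ++ l.map y with hrs
    have hrl : rs.length = fs.length + j := by simp [hrs, hlj]
    have h0 := depth_quot _ rs R hr 1 (fun i hi => hext i (by omega)) 0 (by omega)
    set Q := R ⧸ (Ideal.ofList rs • ⊤ : Submodule R R)
    have h1 : Subsingleton ((R ⧸ maximalIdeal R) →ₗ[R] Q) :=
      (Ext.addEquiv₀.trans (ModuleCat.homAddEquiv (M := ModuleCat.of R (R ⧸ maximalIdeal R)) (N := ModuleCat.of R Q))).symm.subsingleton
    obtain ⟨b, hb, hbr⟩ := IsSMulRegular.subsingleton_linearMap_iff.1 h1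
    rw [Ideal.annihilator_quotient] at hb
    have hσ : Ideal.span (y '' (l.toFinset : Set (Fin n))) ≠ maximalIdeal R := by
      intro h
      have h3 := ringKrullDim_le_spanFinrank_maximalIdeal R
      have h5 := Submodule.spanFinrank_span_le_ncard_of_finite (R := R) ((Finset.finite_toSet l.toFinset).image y)
      rw [show Submodule.span R _ = _ from h] at h5
      have h6 := Set.ncard_image_le (f := y) (Finset.finite_toSet l.toFinset)
      rw [Set.ncard_coe_finset] at h6
      have h8 := l.toFinset_card_le
      have h7 := hn.trans (h3.trans (Nat.cast_le.2 (h5.trans h6)))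
      rw [Nat.cast_le] at h7; omega
    obtain ⟨i, hi, z, hz, hzP, hz2⟩ := rsp_avoid y hy l.toFinset hσ (associatedPrimes R Q) (associatedPrimes.finite R Q)
      (fun p hp => hp.1) (by
        rintro p hp rfl
        have : b ∈ ⋃ p ∈ associatedPrimes R Q, (p : Set R) := Set.mem_biUnion hp hb
        rw [biUnion_associatedPrimes_eq_compl_regular] at this
        exact this hbr)
    have hzr : IsSMulRegular Q z := by
      by_contra hcon
      have : z ∈ ⋃ p ∈ associatedPrimes R Q, (p : Set R) := by
        rw [biUnion_associatedPrimes_eq_compl_regular]; exact hcon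
      obtain ⟨p, hp, hzp⟩ := Set.mem_iUnion₂.1 this
      exact hzP p hp hzp
    have hil : i ∉ l := by simpa using hi
    refine ⟨Function.update y i z, l ++ [i], hz2, ?_, by simp [hlj], ?_⟩
    · rw [List.nodup_append]; refine ⟨hl, List.nodup_singleton i, ?_⟩
      intro a ha b hb h; rw [List.mem_singleton] at hb; subst hb; exact hil (h ▸ ha)
    · have e1 : l.map (Function.update y i z) = l.map y := by
        apply List.map_congr_left
        intro a ha
        exact Function.update_of_ne (by rintro rfl; exact hil ha) _ _
      rw [List.map_append, e1, ← List.append_assoc, isWeaklyRegular_append_iff]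
      refine ⟨hr, ?_⟩
      rw [List.map_singleton, Function.update_self, isWeaklyRegular_cons_iff]
      exact ⟨hzr, .nil _ _⟩

lemma exists_fs {R : Type} [CommRing R] [IsLocalRing R] [IsNoetherianRing R] {n : ℕ} (x : Fin n → R)
    (hx : Ideal.span (Set.range x) = maximalIdeal R) (hn : (n : WithBot ℕ∞) ≤ ringKrullDim R) (I : Ideal R) (hI : I ≠ ⊤)
    (d r : ℕ) (hd : d + r = n) (hdim : ∀ p : Ideal R, p.IsPrime → I ≤ p → ringKrullDim (R ⧸ p) ≤ r) :
    ∃ fs : List R, fs.length = d ∧ (∀ a ∈ fs, a ∈ I) ∧ IsRegular R fs := by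
  have hreg := regular_seq n R x hx hn
  have hxm : ∀ i, x i ∈ maximalIdeal R := fun i => hx ▸ Ideal.subset_span ⟨i, rfl⟩
  have hxr := IsRegular.of_isWeaklyRegular_of_mem_maximalIdeal R (rs := List.ofFn x) (by
    intro r hr; obtain ⟨j, rfl⟩ := (List.mem_ofFn' _ _).1 hr; exact hxm j) hreg
  have hext := ModuleCat.subsingleton_ext_of_exists_isRegular (maximalIdeal R) (ModuleCat.of R (R ⧸ maximalIdeal R))
    (by rw [Module.support_eq_zeroLocus, Ideal.annihilator_quotient]) (ModuleCat.of R R)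
    (by simpa [lt_top_iff_ne_top] using (maximalIdeal.isMaximal R).ne_top) (List.ofFn x) (by
    intro r hr; obtain ⟨j, rfl⟩ := (List.mem_ofFn' _ _).1 hr; exact hxm j) hxr
  rw [List.length_ofFn] at hext
  have hs : Module.support R (R ⧸ I) = PrimeSpectrum.zeroLocus I := by
    rw [Module.support_eq_zeroLocus, Ideal.annihilator_quotient]
  refine ModuleCat.exists_isRegular_of_exists_subsingleton_ext I d (ModuleCat.of R R)
    (by simpa [lt_top_iff_ne_top] using hI) (ModuleCat.of R (R ⧸ I)) hs (fun i hi => ?_)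
  refine ischebeck (ModuleCat.of R R) n hext (r+1) (R ⧸ I) (fun p hp => ?_) i (by omega)
  rw [hs] at hp
  have := hdim p.asIdeal p.2 hp
  push_cast
  exact ENat.WithBot.lt_add_one_iff.2 this
end LyuB

end

section

open TensorProduct
open CategoryTheory CategoryTheory.Abelian Opposite
namespace LyuB

section
variable {R : Type} [CommRing R] {N N' : ModuleCat.{0} R} (P : ProjectiveResolution N) (P' : ProjectiveResolution N')
  (Y : ModuleCat.{0} R) (n : ℕ)

/-- old Ext -/
noncomputable abbrev OE (N : ModuleCat.{0} R) (Y : ModuleCat.{0} R) (n : ℕ) : ModuleCat.{0} R :=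
  ((_root_.Ext R (ModuleCat.{0} R) n).obj (op N)).obj Y

/-- cocycles -/
def Zc : Submodule R (P.complex.X n ⟶ Y) := LinearMap.ker (Linear.leftComp R Y (P.complex.d (n+1) n))

lemma mem_Zc {f : P.complex.X n ⟶ Y} : f ∈ Zc P Y n ↔ P.complex.d (n+1) n ≫ f = 0 := Iff.rfl

/-- the Hom complex -/
abbrev KY := P.complex.linearYonedaObj R Y

/-- inclusion of cocycles -/
def zi : ModuleCat.of R (Zc P Y n) ⟶ (KY P Y).X n := ModuleCat.ofHom (Zc P Y n).subtype

lemma KY_d (i j : ℕ) (f : P.complex.X i ⟶ Y) : (ConcreteCategory.hom ((KY P Y).d i j)) f = P.complex.d j i ≫ f := by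
  simp [KY]
  rfl

lemma zi_d : zi P Y n ≫ (KY P Y).d n (n+1) = 0 := by
  ext f
  have := KY_d P Y n (n+1) f.1
  exact this.trans f.2

/-- class map -/
noncomputable def clh : ModuleCat.of R (Zc P Y n) ⟶ OE N Y n :=
  (KY P Y).liftCycles (zi P Y n) (n+1) (by simp) (zi_d P Y n) ≫ (KY P Y).homologyπ n ≫ (P.isoExt n Y).inv

lemma clh_surj : Function.Surjective (clh P Y n) := by
  rw [← ModuleCat.epi_iff_surjective]
  have : IsIso ((KY P Y).liftCycles (zi P Y n) (n+1) (by simp) (zi_d P Y n)) := by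
    have hm : Mono ((KY P Y).liftCycles (zi P Y n) (n+1) (by simp) (zi_d P Y n)) := by
      have h1 : Mono (zi P Y n) := (ModuleCat.mono_iff_injective _).2 Subtype.val_injective
      have : Mono ((KY P Y).liftCycles (zi P Y n) (n+1) (by simp) (zi_d P Y n) ≫ (KY P Y).iCycles n) := by
        rw [HomologicalComplex.liftCycles_i]; exact h1
      exact mono_of_mono _ ((KY P Y).iCycles n)
    have he : Epi ((KY P Y).liftCycles (zi P Y n) (n+1) (by simp) (zi_d P Y n)) := by
      rw [ModuleCat.epi_iff_surjective]
      intro z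
      have h1 : (ConcreteCategory.hom ((KY P Y).d n (n+1))) ((ConcreteCategory.hom ((KY P Y).iCycles n)) z) = 0 := by
        rw [← ConcreteCategory.comp_apply, HomologicalComplex.iCycles_d]; rfl
      have h2 : ((KY P Y).iCycles n) z ∈ Zc P Y n := 
        (KY_d P Y n (n+1) _).symm.trans h1
      refine ⟨⟨_, h2⟩, ?_⟩
      apply (ModuleCat.mono_iff_injective ((KY P Y).iCycles n)).1 inferInstance
      rw [← ConcreteCategory.comp_apply, HomologicalComplex.liftCycles_i]
      rfl
    exact isIso_of_mono_of_epi _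
  unfold clh
  infer_instance

lemma clh_zero_aux (f : Zc P Y n) : clh P Y n f = 0 ↔ ∃ g : (KY P Y).X ((ComplexShape.up ℕ).prev n), (KY P Y).d _ n g = zi P Y n f := by
  have e1 : clh P Y n f = (P.isoExt n Y).inv ((KY P Y).homologyπ n ((KY P Y).liftCycles (zi P Y n) (n+1) (by simp) (zi_d P Y n) f)) := rfl
  have hinj := (ModuleCat.mono_iff_injective (P.isoExt (R := R) n Y).inv).1 inferInstance
  have hinj2 := (ModuleCat.mono_iff_injective ((KY P Y).iCycles n)).1 inferInstance
  have hex : (ShortComplex.mk _ _ ((KY P Y).toCycles_comp_homologyπ ((ComplexShape.up ℕ).prev n) n)).Exact :=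
    ShortComplex.exact_of_g_is_cokernel _ ((KY P Y).homologyIsCokernel _ n rfl)
  rw [ShortComplex.moduleCat_exact_iff] at hex
  have e2 : (KY P Y).iCycles n ((KY P Y).liftCycles (zi P Y n) (n+1) (by simp) (zi_d P Y n) f) = zi P Y n f := by
    rw [← ConcreteCategory.comp_apply, HomologicalComplex.liftCycles_i]
  have e3 : ∀ g, (KY P Y).iCycles n ((KY P Y).toCycles ((ComplexShape.up ℕ).prev n) n g) = (KY P Y).d _ n g := by
    intro g
    rw [← ConcreteCategory.comp_apply, HomologicalComplex.toCycles_i]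
  rw [e1]
  constructor
  · intro h
    obtain ⟨g, hg⟩ := hex _ (hinj (h.trans (map_zero _).symm))
    exact ⟨g, (e3 g).symm.trans ((congrArg _ hg).trans e2)⟩
  · rintro ⟨g, hg⟩
    have h1 := hinj2 ((e2.trans hg.symm).trans (e3 g).symm)
    rw [h1, ← ConcreteCategory.comp_apply ((KY P Y).toCycles _ n), HomologicalComplex.toCycles_comp_homologyπ]
    exact map_zero _

lemma clh_zero (f : Zc P Y n) : clh P Y n f = 0 ↔ ((∃ (p : ℕ) (_ : p + 1 = n) (g : P.complex.X p ⟶ Y), P.complex.d n p ≫ g = f.1) ∨ f.1 = 0) := by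
  rw [clh_zero_aux]
  constructor
  · rintro ⟨g, hg⟩
    rcases n with _ | p
    · right
      refine hg.symm.trans ?_
      rw [HomologicalComplex.shape _ _ _ (by simp)]
      rfl
    · left
      have hp : (ComplexShape.up ℕ).prev (p+1) = p := by simp
      revert g
      rw [hp]
      intro g hg
      exact ⟨p, rfl, g, (KY_d P Y p (p+1) g).symm.trans hg⟩
  · rintro (⟨p, rfl, g, hg⟩ | h)
    · have hp : (ComplexShape.up ℕ).prev (p+1) = p := by simp
      rw [hp]
      exact ⟨g, (KY_d P Y p (p+1) g).trans hg⟩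
    · exact ⟨0, (map_zero _).trans h.symm⟩

lemma newExt_zero (f : Zc P Y n) : P.extMk f.1 (n+1) rfl ((mem_Zc P Y n).1 f.2) = 0 ↔ ((∃ (p : ℕ) (_ : p + 1 = n) (g : P.complex.X p ⟶ Y), P.complex.d n p ≫ g = f.1) ∨ f.1 = 0) := by
  rcases n with _ | p
  · constructor
    · intro h
      right
      simp only [← P.extEquivCohomologyClass.apply_eq_iff_eq,
        ProjectiveResolution.extEquivCohomologyClass_extMk, ProjectiveResolution.extEquivCohomologyClass_zero,
        CochainComplex.HomComplex.CohomologyClass.mk_eq_zero_iff] at h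
      rw [CochainComplex.HomComplex.Cocycle.toSingleMk_mem_coboundaries_iff _ _ _ _ _ 1 (by simp)] at h
      obtain ⟨g, hg⟩ := h
      have h0 : g = 0 := (CochainComplex.isZero_of_isStrictlyLE P.cochainComplex 0 1 (by simp)).eq_of_src _ _
      rw [h0, Limits.comp_zero] at hg
      rw [← cancel_epi (P.cochainComplexXIso (-(0:ℕ)) 0 rfl).hom, Limits.comp_zero]
      exact hg.symm
    · rintro (⟨p, hp, -⟩ | h)
      · omega
      · have : f = 0 := Subtype.ext h
        subst this
        exact P.extMk_zero _ _
  · rw [P.extMk_eq_zero_iff _ _ _ _ p rfl]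
    constructor
    · rintro ⟨g, hg⟩; exact Or.inl ⟨p, rfl, g, hg⟩
    · rintro (⟨q, hq, g, hg⟩ | h)
      · obtain rfl : q = p := by omega
        exact ⟨g, hg⟩
      · exact ⟨0, by simp [h]⟩

/-- extMk linear -/
noncomputable def nlh : Zc P Y n →ₗ[R] Ext N Y n where
  toFun f := P.extMk f.1 (n+1) rfl ((mem_Zc P Y n).1 f.2)
  map_add' f g := (P.add_extMk _ _ _ _ _ _).symm
  map_smul' r f := by
    have h := P.extMk_comp_mk₀ f.1 (n+1) rfl ((mem_Zc P Y n).1 f.2) (r • 𝟙 Y)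
    rw [Ext.mk₀_smul, Ext.comp_smul, Ext.comp_mk₀_id] at h
    simp only [RingHom.id_apply]
    rw [h]
    congr 1

lemma nlh_surj : Function.Surjective (nlh P Y n) := by
  intro a
  obtain ⟨f, hf, h⟩ := P.extMk_surjective a (n+1) rfl
  exact ⟨⟨f, hf⟩, h⟩

lemma ker_eq : LinearMap.ker (clh P Y n).hom = LinearMap.ker (nlh P Y n) := by
  ext f
  rw [LinearMap.mem_ker, LinearMap.mem_ker]
  exact (clh_zero P Y n f).trans (newExt_zero P Y n f).symm

/-- comparison -/
noncomputable def cmp : OE N Y n ≃ₗ[R] Ext N Y n :=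
  (LinearMap.quotKerEquivOfSurjective (clh P Y n).hom (clh_surj P Y n)).symm ≪≫ₗ
    (Submodule.quotEquivOfEq _ _ (ker_eq P Y n)) ≪≫ₗ LinearMap.quotKerEquivOfSurjective (nlh P Y n) (nlh_surj P Y n)

lemma cmp_clh (f : Zc P Y n) : cmp P Y n (clh P Y n f) = P.extMk f.1 (n+1) rfl ((mem_Zc P Y n).1 f.2) := by
  have : (LinearMap.quotKerEquivOfSurjective (clh P Y n).hom (clh_surj P Y n)).symm (clh P Y n f) = Submodule.Quotient.mk f := by
    rw [LinearEquiv.symm_apply_eq]; rfl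
  simp only [cmp, LinearEquiv.trans_apply]
  rw [this]
  rfl

lemma comp_sq {C : Type*} [Category C] {A B D E F' G : C} {a : A ⟶ B} {b : B ⟶ D} {c : D ⟶ E} {m : A ⟶ F'} {a' : F' ⟶ G} {b' : G ⟶ E}
    {k : B ⟶ G} (h1 : b ≫ c = k ≫ b') (h2 : a ≫ k = m ≫ a') : (a ≫ b) ≫ c = m ≫ (a' ≫ b') := by
  rw [Category.assoc, h1, ← Category.assoc, h2, Category.assoc]

variable {P P'} in
lemma clh_nat {g : N' ⟶ N} (φ : ProjectiveResolution.Hom P' P g) (f : Zc P Y n) :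
    ∃ f' : Zc P' Y n, f'.1 = φ.hom.f n ≫ f.1 ∧ ((_root_.Ext R (ModuleCat.{0} R) n).map g.op).app Y (clh P Y n f) = clh P' Y n f' := by
  have hz : φ.hom.f n ≫ f.1 ∈ Zc P' Y n := by
    rw [mem_Zc, ← φ.hom.comm_assoc, (mem_Zc P Y n).1 f.2, Limits.comp_zero]
  refine ⟨⟨_, hz⟩, rfl, ?_⟩
  let F := ((linearYoneda R (ModuleCat.{0} R)).obj Y).rightOp
  let ψ : (F.mapHomologicalComplex _).obj P'.complex ⟶ (F.mapHomologicalComplex _).obj P.complex := (F.mapHomologicalComplex _).map φ.hom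
  have h1 := ProjectiveResolution.isoLeftDerivedObj_hom_naturality g P' P φ.hom (by simpa using φ.hom_f_zero_comp_π_f_zero) F n
  have h2 : (P.isoLeftDerivedObj F n).hom.unop ≫ ((F.leftDerived n).map g).unop = (HomologicalComplex.homologyMap ψ n).unop ≫ (P'.isoLeftDerivedObj F n).hom.unop := congrArg Quiver.Hom.unop h1
  let χ : KY P Y ⟶ KY P' Y := (HomologicalComplex.unopFunctor _ _).map ψ.op
  have h3 := HomologicalComplex.homologyOp_hom_naturality χ n
  have h4 : (HomologicalComplex.homologyUnop ((F.mapHomologicalComplex _).obj P.complex) n).hom ≫ (HomologicalComplex.homologyMap ψ n).unop = HomologicalComplex.homologyMap χ n ≫ (HomologicalComplex.homologyUnop ((F.mapHomologicalComplex _).obj P'.complex) n).hom :=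
    (congrArg Quiver.Hom.unop h3)
  have h5 : (P.isoExt n Y).inv ≫ ((_root_.Ext R (ModuleCat.{0} R) n).map g.op).app Y = HomologicalComplex.homologyMap χ n ≫ (P'.isoExt n Y).inv := by
    exact comp_sq h2 h4
  have h6 : clh P Y n ≫ ((_root_.Ext R (ModuleCat.{0} R) n).map g.op).app Y = 
      HomologicalComplex.liftCycles (KY P' Y) (zi P Y n ≫ χ.f n) (n+1) (by simp) (by
        rw [Category.assoc, χ.comm, ← Category.assoc, zi_d, Limits.zero_comp]) ≫ HomologicalComplex.homologyπ _ n ≫ (P'.isoExt n Y).inv := by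
    unfold clh
    rw [Category.assoc, Category.assoc, h5, HomologicalComplex.homologyπ_naturality_assoc, HomologicalComplex.liftCycles_comp_cyclesMap_assoc]
  have h7 := congrArg (fun u => (ConcreteCategory.hom u) f) h6
  refine h7.trans ?_
  unfold clh
  change ((HomologicalComplex.homologyπ _ n ≫ (P'.isoExt n Y).inv)) _ = ((HomologicalComplex.homologyπ _ n ≫ (P'.isoExt n Y).inv)) _
  congr 1
  apply (ModuleCat.mono_iff_injective ((KY P' Y).iCycles n)).1 inferInstance
  have e1 := congrArg (fun u => (ConcreteCategory.hom u) f) ((KY P' Y).liftCycles_i (zi P Y n ≫ χ.f n) (n+1) (by simp) (by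
        rw [Category.assoc, χ.comm, ← Category.assoc, zi_d, Limits.zero_comp]))
  have e2 := congrArg (fun u => (ConcreteCategory.hom u) (⟨_, hz⟩ : Zc P' Y n)) ((KY P' Y).liftCycles_i (zi P' Y n) (n+1) (by simp) (zi_d P' Y n))
  exact e1.trans e2.symm

lemma cmp_nat (g : N' ⟶ N) (a : OE N Y n) : cmp P' Y n (((_root_.Ext R (ModuleCat.{0} R) n).map g.op).app Y a) = (Ext.mk₀ g).comp (cmp P Y n a) (zero_add n) := by
  obtain ⟨f, rfl⟩ := clh_surj P Y n a
  have φ : ProjectiveResolution.Hom P' P g := ⟨ProjectiveResolution.lift g P' P, by simpa using ProjectiveResolution.lift_commutes_zero g P' P⟩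
  obtain ⟨f', h1, h2⟩ := clh_nat Y n φ f
  rw [h2, cmp_clh, cmp_clh, ProjectiveResolution.mk₀_comp_extMk _ _ _ _ φ]
  congr 1

end
end LyuB

end

section

open TensorProduct
open IsLocalRing CategoryTheory CategoryTheory.Abelian Opposite RingTheory.Sequence
namespace LyuB

section
variable {R : Type} [CommRing R] {T L : Type} [AddCommGroup T] [AddCommGroup L] [Module R T] [Module R L]
  (f : R) (lam : T →ₗ[R] L) (hbij : ∀ k : ℕ, Function.Bijective (fun z : L => f^k • z))
  (hsurj : ∀ z : L, ∃ (k : ℕ) (s : T), f^k • z = lam s) (heq : ∀ s : T, lam s = 0 → ∃ k : ℕ, f^k • s = 0)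

include hbij hsurj heq

omit hbij heq in
lemma loc_smul_top (J : Ideal R) (w : L) (hw : w ∈ (J • ⊤ : Submodule R L)) : ∃ (m : ℕ) (w' : T), w' ∈ (J • ⊤ : Submodule R T) ∧ f^m • w = lam w' := by
  induction hw using Submodule.smul_induction_on' with
  | smul r hr z _ =>
    obtain ⟨k, s, hs⟩ := hsurj z
    exact ⟨k, r • s, Submodule.smul_mem_smul hr trivial, by rw [smul_comm, hs, map_smul]⟩
  | add x _ y _ hx hy =>
    obtain ⟨m, w, hw, h⟩ := hx
    obtain ⟨m', w', hw', h'⟩ := hy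
    refine ⟨m + m', f^m' • w + f^m • w', Submodule.add_mem _ (Submodule.smul_mem _ _ hw) (Submodule.smul_mem _ _ hw'), ?_⟩
    rw [map_add, map_smul, map_smul, ← h, ← h', smul_add, smul_smul, smul_smul]
    congr 2 <;> ring

omit hsurj heq in
lemma loc_div (J : Ideal R) (k : ℕ) (w : L) (hw : f^k • w ∈ (J • ⊤ : Submodule R L)) : w ∈ (J • ⊤ : Submodule R L) := by
  have : ∀ y ∈ (J • ⊤ : Submodule R L), ∃ w ∈ (J • ⊤ : Submodule R L), f^k • w = y := by
    intro y hy
    induction hy using Submodule.smul_induction_on' with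
    | smul r hr z _ =>
      obtain ⟨w, hw⟩ := (hbij k).2 z
      exact ⟨r • w, Submodule.smul_mem_smul hr trivial, by rw [smul_comm]; exact congrArg _ hw⟩
    | add x _ y _ hx hy =>
      obtain ⟨w, hw, h⟩ := hx
      obtain ⟨w', hw', h'⟩ := hy
      exact ⟨w + w', Submodule.add_mem _ hw hw', by rw [smul_add, h, h']⟩
  obtain ⟨w', h1, h2⟩ := this _ hw
  rw [← (hbij k).1 h2]; exact h1

omit [AddCommGroup L] [Module R L] hbij hsurj heq lam in
lemma pow_reg (J : Ideal R) (hJ : ∀ t : T, f • t ∈ (J • ⊤ : Submodule R T) → t ∈ (J • ⊤ : Submodule R T)) (k : ℕ) (t : T)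
    (h : f^k • t ∈ (J • ⊤ : Submodule R T)) : t ∈ (J • ⊤ : Submodule R T) := by
  induction k generalizing t with
  | zero => simpa using h
  | succ k ih => rw [pow_succ, mul_smul] at h; exact hJ _ (ih _ h)

omit hbij in
lemma loc_quot (J : Ideal R) (hJ : ∀ t : T, f • t ∈ (J • ⊤ : Submodule R T) → t ∈ (J • ⊤ : Submodule R T))
    (z : L) (k : ℕ) (s : T) (hs : f^k • z = lam s)
    (h : (Submodule.Quotient.mk z : L ⧸ LinearMap.range lam) ∈ (J • ⊤ : Submodule R (L ⧸ LinearMap.range lam))) :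
    ∃ u : T, s - f^k • u ∈ (J • ⊤ : Submodule R T) := by
  have h1 : (J • ⊤ : Submodule R (L ⧸ LinearMap.range lam)) = Submodule.map (LinearMap.range lam).mkQ (J • ⊤) := by
    rw [Submodule.map_smul'', Submodule.map_top, Submodule.range_mkQ]
  rw [h1] at h
  obtain ⟨w, hw, hwz⟩ := h
  have hwz' : z - w ∈ LinearMap.range lam := by
    rw [← Submodule.Quotient.eq]; exact hwz.symm
  obtain ⟨u, hu⟩ := hwz'
  refine ⟨u, ?_⟩
  obtain ⟨m, w', hw', hm⟩ := loc_smul_top f lam hsurj J w hw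
  have h2 : lam (f^m • (s - f^k • u) - f^k • w') = 0 := by
    rw [map_sub, map_smul, map_sub, map_smul, map_smul, ← hs, hu, ← hm, smul_comm (f^k) (f^m) w, ← smul_sub (f^k),
      sub_sub_cancel, sub_self]
  obtain ⟨c, hc⟩ := heq _ h2
  rw [smul_sub, sub_eq_zero, smul_smul, ← pow_add] at hc
  apply pow_reg f J hJ (c + m)
  rw [hc]
  exact Submodule.smul_mem _ _ (Submodule.smul_mem _ _ hw')

omit [AddCommGroup L] [Module R L] hbij hsurj heq lam in
lemma mem_cons_smul (xs : List R) (s : T) : s ∈ (Ideal.ofList (f :: xs) • ⊤ : Submodule R T) ↔ ∃ u, s - f • u ∈ (Ideal.ofList xs • ⊤ : Submodule R T) := by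
  rw [Ideal.ofList_cons, Submodule.sup_smul, Submodule.mem_sup]
  constructor
  · rintro ⟨y, hy, z, hz, rfl⟩
    rw [Submodule.ideal_span_singleton_smul] at hy
    obtain ⟨u, -, rfl⟩ := hy
    exact ⟨u, by simpa using hz⟩
  · rintro ⟨u, hu⟩
    refine ⟨f • u, Submodule.smul_mem_smul (Ideal.mem_span_singleton_self f) trivial, _, hu, by abel⟩

lemma loc_reg (xs : List R) (a : R)
    (hJ : ∀ t : T, f • t ∈ (Ideal.ofList xs • ⊤ : Submodule R T) → t ∈ (Ideal.ofList xs • ⊤ : Submodule R T))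
    (ha : ∀ t : T, a • t ∈ (Ideal.ofList (f :: xs) • ⊤ : Submodule R T) → t ∈ (Ideal.ofList (f :: xs) • ⊤ : Submodule R T))
    (t : L ⧸ LinearMap.range lam) (ht : a • t ∈ (Ideal.ofList xs • ⊤ : Submodule R (L ⧸ LinearMap.range lam))) :
    t ∈ (Ideal.ofList xs • ⊤ : Submodule R (L ⧸ LinearMap.range lam)) := by
  set J := Ideal.ofList xs
  have claim : ∀ (k : ℕ) (s u : T), a • s - f^k • u ∈ (J • ⊤ : Submodule R T) → ∃ v, s - f^k • v ∈ (J • ⊤ : Submodule R T) := by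
    intro k
    induction k with
    | zero => intro s u _; exact ⟨s, by simp⟩
    | succ k ih =>
      intro s u h
      obtain ⟨s', hs'⟩ := (mem_cons_smul f xs s).1 (ha s ((mem_cons_smul f xs _).2 ⟨f^k • u, by rwa [smul_smul, ← pow_succ']⟩))
      obtain ⟨v, hv⟩ := ih s' u (by
        apply hJ
        have : f • (a • s' - f^k • u) = (a • s - f^(k+1) • u) - a • (s - f • s') := by
          simp only [smul_sub, smul_smul, pow_succ']
          rw [mul_comm f a]; abel
        rw [this]
        exact Submodule.sub_mem _ h (Submodule.smul_mem _ _ hs'))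
      refine ⟨v, ?_⟩
      have : s - f^(k+1) • v = (s - f • s') + f • (s' - f^k • v) := by
        simp only [smul_sub, smul_smul, pow_succ']; abel
      rw [this]
      exact Submodule.add_mem _ hs' (Submodule.smul_mem _ _ hv)
  obtain ⟨z, rfl⟩ := Submodule.Quotient.mk_surjective _ t
  obtain ⟨k, s, hs⟩ := hsurj z
  obtain ⟨u, hu⟩ := loc_quot f lam hsurj heq J hJ (a • z) k (a • s) (by rw [smul_comm, hs, map_smul]) ht
  obtain ⟨v, hv⟩ := claim k s u hu
  have h1 : z - lam v ∈ (J • ⊤ : Submodule R L) := by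
    apply loc_div f hbij J k
    rw [smul_sub, hs, ← map_smul, ← map_sub]
    have : Submodule.map lam (J • ⊤) ≤ J • ⊤ := by
      rw [Submodule.map_smul'']; exact Submodule.smul_mono le_rfl le_top
    exact this ⟨_, hv, rfl⟩
  have h2 : (Submodule.Quotient.mk z : L ⧸ LinearMap.range lam) = (LinearMap.range lam).mkQ (z - lam v) := by
    have h0 : (LinearMap.range lam).mkQ (lam v) = 0 := (Submodule.Quotient.mk_eq_zero _).2 ⟨v, rfl⟩
    rw [map_sub, h0, sub_zero]; rfl
  rw [h2]
  have : Submodule.map (LinearMap.range lam).mkQ (J • ⊤) ≤ J • ⊤ := by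
    rw [Submodule.map_smul'']; exact Submodule.smul_mono le_rfl le_top
  exact this ⟨_, h1, rfl⟩

end

lemma ext_loc_zero {R : Type} [CommRing R] {L : Type} [AddCommGroup L] [Module R L] (f : R) (hb : Function.Bijective (fun z : L => f • z))
    (N : ModuleCat.{0} R) (hN : ∃ k : ℕ, ∀ x : N, f^k • x = 0) (i : ℕ) : Subsingleton (Ext N (ModuleCat.of R L) i) := by
  obtain ⟨k, hk⟩ := hN
  have hb' : Function.Bijective (LinearMap.lsmul R L f) := hb
  let e := LinearEquiv.ofBijective (LinearMap.lsmul R L f) hb'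
  have h0 : ∀ y : Ext N (ModuleCat.of R L) i, f^k • y = 0 := by
    intro y
    have h1 : (Ext.mk₀ (f^k • 𝟙 N)).comp y (zero_add i) = f^k • y := by
      rw [Ext.mk₀_smul, Ext.smul_comp, Ext.mk₀_id_comp]
    rw [← h1, show f^k • 𝟙 N = 0 by ext x; exact hk x, Ext.mk₀_zero, Ext.zero_comp]
  have h2 : ∀ y : Ext N (ModuleCat.of R L) i, f • y = 0 → y = 0 := by
    intro y hy
    have h1 : y.comp (Ext.mk₀ (ModuleCat.ofHom e.toLinearMap)) (add_zero i) = f • y := by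
      rw [show ModuleCat.ofHom e.toLinearMap = f • 𝟙 (ModuleCat.of R L) from rfl, Ext.mk₀_smul, Ext.comp_smul, Ext.comp_mk₀_id]
    have h3 : (y.comp (Ext.mk₀ (ModuleCat.ofHom e.toLinearMap)) (add_zero i)).comp (Ext.mk₀ (ModuleCat.ofHom e.symm.toLinearMap)) (add_zero i) = y := by
      rw [Ext.comp_assoc_of_third_deg_zero, Ext.mk₀_comp_mk₀, ← ModuleCat.ofHom_comp]
      simp
    rw [← h3, h1, hy, Ext.zero_comp]
  have h3 : ∀ (j : ℕ) (y : Ext N (ModuleCat.of R L) i), f^j • y = 0 → y = 0 := by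
    intro j
    induction j with
    | zero => intro y hy; simpa using hy
    | succ j ih => intro y hy; rw [pow_succ, mul_smul] at hy; exact h2 _ (ih _ hy)
  exact subsingleton_of_forall_eq 0 fun y => h3 k y (h0 y)

lemma shift_bij {R : Type} [CommRing R] {S : ShortComplex (ModuleCat.{0} R)} (hS : S.ShortExact) (N : ModuleCat.{0} R)
    (h0 : ∀ i, Subsingleton (Ext N S.X₂ i)) (i : ℕ) : Function.Bijective (fun y : Ext N S.X₃ i => y.comp hS.extClass (rfl : i + 1 = i + 1)) := by
  constructor
  · intro y y' h
    rw [← sub_eq_zero]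
    obtain ⟨z, hz⟩ := Ext.covariant_sequence_exact₃ N hS (y - y') rfl (by
      rw [sub_eq_add_neg, Ext.add_comp, Ext.neg_comp, ← sub_eq_add_neg, sub_eq_zero]; exact h)
    rw [← hz, (h0 i).elim z 0, Ext.zero_comp]
  · intro z
    obtain ⟨y, hy⟩ := Ext.covariant_sequence_exact₁ N hS z ((h0 _).elim _ _) rfl
    exact ⟨y, hy⟩

end LyuB

end

section

open TensorProduct
open IsLocalRing CategoryTheory CategoryTheory.Abelian Opposite RingTheory.Sequence
namespace LyuB

lemma wr_perm {R : Type} [CommRing R] [IsLocalRing R] [IsNoetherianRing R] {l l' : List R} (h : IsWeaklyRegular R l)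
    (hp : l.Perm l') (hm : ∀ a ∈ l, a ∈ maximalIdeal R) : IsWeaklyRegular R l' :=
  IsLocalRing.isWeaklyRegular_of_perm_of_subset_maximalIdeal h hp hm

lemma ofList_perm {R : Type} [CommRing R] {l l' : List R} (hp : l.Perm l') : Ideal.ofList l = Ideal.ofList l' := by
  unfold Ideal.ofList
  congr 1
  ext a
  exact hp.mem_iff

lemma exists_T {R : Type} [CommRing R] [IsLocalRing R] [IsNoetherianRing R] (fs : List R) :
    (∀ a ∈ fs, a ∈ maximalIdeal R) → IsWeaklyRegular R fs →
    ∃ (T : Type) (_ : AddCommGroup T) (_ : Module R T) (io : R →ₗ[R] T) (ξ : Ext (ModuleCat.of R T) (ModuleCat.of R R) fs.length),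
      IsCrys R T ∧ (∀ a ∈ fs, a • io 1 = 0) ∧
      (∀ xs : List R, (∀ a ∈ xs, a ∈ maximalIdeal R) → IsWeaklyRegular R (xs ++ fs) →
        ∀ c, io c ∈ (Ideal.ofList xs • ⊤ : Submodule R T) → c ∈ Ideal.ofList (xs ++ fs)) ∧
      (∀ xs : List R, (∀ a ∈ xs, a ∈ maximalIdeal R) → ∀ a ∈ maximalIdeal R, IsWeaklyRegular R (xs ++ fs ++ [a]) →
        ∀ t : T, a • t ∈ (Ideal.ofList xs • ⊤ : Submodule R T) → t ∈ (Ideal.ofList xs • ⊤ : Submodule R T)) ∧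
      (∀ N : ModuleCat.{0} R, (∀ a ∈ fs, ∃ k : ℕ, ∀ x : N, a^k • x = 0) → ∀ i : ℕ,
        Function.Bijective (fun y : Ext N (ModuleCat.of R T) i => y.comp ξ (rfl : i + fs.length = i + fs.length))) := by
  induction fs using List.reverseRecOn with
  | nil =>
    intro _ _
    refine ⟨R, inferInstance, inferInstance, LinearMap.id, Ext.mk₀ (𝟙 _), isCrys_self, by simp, ?_, ?_, ?_⟩
    · intro xs _ _ c hc
      simpa using hc
    · intro xs _ a _ h t ht
      rw [List.append_nil, isWeaklyRegular_append_iff] at h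
      have h1 := ((isWeaklyRegular_singleton_iff _ _).1 h.2)
      have := @h1 (Submodule.Quotient.mk t) 0 (by
        show a • Submodule.Quotient.mk t = a • 0
        rw [smul_zero, ← Submodule.Quotient.mk_smul, Submodule.Quotient.mk_eq_zero]; exact ht)
      rwa [Submodule.Quotient.mk_eq_zero] at this
    · intro N _ i
      have : (fun y : Ext N (ModuleCat.of R R) i => y.comp (Ext.mk₀ (𝟙 (ModuleCat.of R R))) (rfl : i + 0 = i + 0)) = id := by
        funext y; exact Ext.comp_mk₀_id y
      exact this ▸ Function.bijective_id
  | append_singleton fs f ih =>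
    intro hm hw
    have hm1 : ∀ a ∈ fs, a ∈ maximalIdeal R := fun a ha => hm a (by simp [ha])
    have hfm : f ∈ maximalIdeal R := hm f (by simp)
    have hw1 : IsWeaklyRegular R fs := ((isWeaklyRegular_append_iff _ _ _).1 hw).1
    obtain ⟨T, _, _, io, ξ, hcr, hio, h1, h2, h3⟩ := ih hm1 hw1
    let L := LocalizedModule (Submonoid.powers f) T
    let lam : T →ₗ[R] L := LocalizedModule.mkLinearMap (Submonoid.powers f) T
    have hbij : ∀ k : ℕ, Function.Bijective (fun z : L => f^k • z) := by
      intro k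
      have := IsLocalizedModule.map_units lam (⟨f^k, k, rfl⟩ : Submonoid.powers f)
      exact (Module.End.isUnit_iff _).1 this
    have hsurj : ∀ z : L, ∃ (k : ℕ) (s : T), f^k • z = lam s := by
      intro z
      obtain ⟨⟨s, ⟨_, k, rfl⟩⟩, h⟩ := IsLocalizedModule.surj (Submonoid.powers f) lam z
      exact ⟨k, s, h⟩
    have heq : ∀ s : T, lam s = 0 → ∃ k : ℕ, f^k • s = 0 := by
      intro s hs
      obtain ⟨⟨_, k, rfl⟩, h⟩ := (IsLocalizedModule.eq_zero_iff (Submonoid.powers f) lam).1 hs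
      exact ⟨k, h⟩
    have bot : ∀ {M : Type} [AddCommGroup M] [Module R M], (Ideal.ofList ([] : List R) • (⊤ : Submodule R M)) = ⊥ := fun {M} _ _ =>
      Eq.trans (congrArg (· • (⊤ : Submodule R M)) Ideal.ofList_nil) (Submodule.bot_smul ⊤)
    have hinj : Function.Injective lam := by
      rw [injective_iff_map_eq_zero]
      intro s hs
      obtain ⟨k, hk⟩ := heq s hs
      have := pow_reg f (Ideal.ofList []) (h2 [] (by simp) f hfm hw) k s (by rw [hk]; exact Submodule.zero_mem _)
      rwa [bot, Submodule.mem_bot] at this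
    obtain ⟨z, hz⟩ := (hbij 1).2 (lam (io 1))
    simp only [pow_one] at hz
    have hex : Function.Exact lam (LinearMap.range lam).mkQ := LinearMap.exact_map_mkQ_range lam
    have hS := sc_se lam (LinearMap.range lam).mkQ hex hinj (Submodule.mkQ_surjective _)
    let io' : R →ₗ[R] L ⧸ LinearMap.range lam := (LinearMap.range lam).mkQ ∘ₗ LinearMap.toSpanSingleton R L z
    have hlen : 1 + fs.length = (fs ++ [f]).length := by simp [add_comm]
    let ξ' : Ext (ModuleCat.of R (L ⧸ LinearMap.range lam)) (ModuleCat.of R R) (fs ++ [f]).length :=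
      (hS.extClass : Ext (ModuleCat.of R (L ⧸ LinearMap.range lam)) (ModuleCat.of R T) 1).comp ξ hlen
    have key : ∀ xs : List R, (∀ a ∈ xs, a ∈ maximalIdeal R) → IsWeaklyRegular R (xs ++ (fs ++ [f])) →
        ∀ t : T, f • t ∈ (Ideal.ofList xs • ⊤ : Submodule R T) → t ∈ (Ideal.ofList xs • ⊤ : Submodule R T) := by
      intro xs hx hw
      exact h2 xs hx f hfm (by rwa [List.append_assoc])
    have hperm : ∀ xs : List R, (xs ++ (fs ++ [f])).Perm (f :: xs ++ fs) := by
      intro xs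
      rw [← List.append_assoc]
      exact List.perm_append_comm
    refine ⟨L ⧸ LinearMap.range lam, inferInstance, inferInstance, io', ξ', ?_, ?_, ?_, ?_, ?_⟩
    · exact hcr.coker_loc (Submonoid.powers f) lam
    · intro a ha
      have hz' : ∀ a ∈ fs, a • z = 0 := by
        intro a ha
        apply (hbij 1).1
        simp only [pow_one, smul_zero]
        rw [smul_comm, hz, ← map_smul, hio a ha, map_zero]
      have : a • io' 1 = (LinearMap.range lam).mkQ (a • z) := by simp [io']
      rw [this]
      rcases List.mem_append.1 ha with ha | ha
      · rw [hz' a ha, map_zero]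
      · obtain rfl : a = f := by simpa using ha
        rw [hz]
        exact (Submodule.Quotient.mk_eq_zero _).2 ⟨_, rfl⟩
    · intro xs hx hw c hc
      have e1 : io' c = Submodule.Quotient.mk (c • z) := by simp [io']
      rw [e1] at hc
      obtain ⟨u, hu⟩ := loc_quot f lam hsurj heq (Ideal.ofList xs) (key xs hx hw) (c • z) 1 (io c) (by
        rw [pow_one, smul_comm, hz, ← map_smul, ← map_smul, smul_eq_mul, mul_one]) hc
      have hall : ∀ a ∈ xs ++ (fs ++ [f]), a ∈ maximalIdeal R := by
        intro a ha
        rcases List.mem_append.1 ha with ha | ha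
        · exact hx a ha
        · exact hm a ha
      rw [ofList_perm (hperm xs)]
      refine h1 (f :: xs) (by intro a ha; rcases List.mem_cons.1 ha with rfl | ha; exacts [hfm, hx a ha])
        (wr_perm hw (hperm xs) hall) c ((mem_cons_smul f xs _).2 ⟨u, by simpa using hu⟩)
    · intro xs hx a ha hw t ht
      have hall : ∀ b ∈ xs ++ (fs ++ [f]) ++ [a], b ∈ maximalIdeal R := by
        intro b hb
        rcases List.mem_append.1 hb with hb | hb
        · rcases List.mem_append.1 hb with hb | hb
          · exact hx b hb
          · exact hm b hb
        · obtain rfl : b = a := by simpa using hb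
          exact ha
      refine loc_reg f lam hbij hsurj heq xs a (key xs hx ((isWeaklyRegular_append_iff _ _ _).1 hw).1) ?_ t ht
      exact h2 (f :: xs) (by intro a ha; rcases List.mem_cons.1 ha with rfl | ha; exacts [hfm, hx a ha]) a ha
        (wr_perm hw ((hperm xs).append_right _) hall)
    · intro N hN i
      have b1 := shift_bij hS N (fun j => ext_loc_zero f (by simpa using hbij 1) N (hN f (by simp)) j) i
      have b2 := h3 N (fun a ha => hN a (by simp [ha])) (i + 1)
      have hl : i + 1 + fs.length = i + (fs ++ [f]).length := by omega
      have b3 : Function.Bijective (fun y : Ext N (ModuleCat.of R T) (i + 1) => y.comp ξ hl) := by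
        revert hl
        generalize i + (fs ++ [f]).length = m
        rintro rfl
        exact b2
      have b4 := b3.comp b1
      have e : (fun y : Ext N (ModuleCat.of R (L ⧸ LinearMap.range lam)) i => y.comp ξ' rfl) =
          (fun y : Ext N (ModuleCat.of R T) (i + 1) => y.comp ξ hl) ∘
            (fun y : Ext N (sc lam (LinearMap.range lam).mkQ hex).X₃ i => y.comp hS.extClass (rfl : i + 1 = i + 1)) := by
        funext y
        exact (Ext.comp_assoc y _ ξ rfl hlen (by omega)).symm
      rw [e]
      exact b4

end LyuB

end

section

open TensorProduct
open IsLocalRing CategoryTheory CategoryTheory.Abelian Opposite RingTheory.Sequence Limits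
namespace LyuB

lemma colim_model {R : Type} [CommRing R] {J : Type} [SmallCategory J] [IsFiltered J] (G : J ⥤ ModuleCat.{0} R) (c : Cocone G)
    (hc : IsColimit c) {T : Type} [AddCommGroup T] [Module R T] (ψ : ∀ j, G.obj j →ₗ[R] T)
    (hψ : ∀ {j j'} (w : j ⟶ j') (a : G.obj j), ψ j' (G.map w a) = ψ j a) (hinj : ∀ j, Function.Injective (ψ j)) :
    ∃ F : c.pt →ₗ[R] T, Function.Injective F ∧ ∀ t, t ∈ LinearMap.range F ↔ ∃ j a, ψ j a = t := by
  have hnat : ∀ ⦃X Y : J⦄ (f : X ⟶ Y),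
      G.map f ≫ ModuleCat.ofHom (ψ Y) = ModuleCat.ofHom (ψ X) ≫ ((Functor.const J).obj (ModuleCat.of R T)).map f := by
    intro j j' w
    ext a
    exact hψ w a
  let co : Cocone G := { pt := ModuleCat.of R T, ι := { app := fun j => ModuleCat.ofHom (ψ j), naturality := hnat } }
  have hd : ∀ j a, (hc.desc co).hom (c.ι.app j a) = ψ j a := by
    intro j a
    have := hc.fac co j
    have h2 := congrArg (fun f => f.hom a) this
    exact h2
  refine ⟨(hc.desc co).hom, ?_, ?_⟩
  · rw [injective_iff_map_eq_zero]
    intro z hz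
    obtain ⟨j, a, rfl⟩ := Concrete.isColimit_exists_rep G hc z
    rw [hd] at hz
    have : a = 0 := hinj j (by rw [hz, map_zero])
    rw [this]; exact map_zero _
  · intro t
    constructor
    · rintro ⟨z, rfl⟩
      obtain ⟨j, a, rfl⟩ := Concrete.isColimit_exists_rep G hc z
      exact ⟨j, a, (hd j a).symm⟩
    · rintro ⟨j, a, rfl⟩
      exact ⟨_, hd j a⟩

/-- Comparison of homs with top extensions -/
noncomputable def EE {R : Type} [CommRing R] {T : Type} [AddCommGroup T] [Module R T] {d : ℕ}
    (ξ : Ext (ModuleCat.of R T) (ModuleCat.of R R) d) (N : ModuleCat.{0} R) : (N ⟶ ModuleCat.of R T) →ₗ[R] Ext N (ModuleCat.of R R) d where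
  toFun h := (Ext.mk₀ h).comp ξ (zero_add d)
  map_add' := by intro h h'; rw [Ext.mk₀_add, Ext.add_comp]
  map_smul' := by intro r h; rw [Ext.mk₀_smul, Ext.smul_comp]; rfl

lemma EE_bij {R : Type} [CommRing R] {T : Type} [AddCommGroup T] [Module R T] {d : ℕ}
    (ξ : Ext (ModuleCat.of R T) (ModuleCat.of R R) d) (N : ModuleCat.{0} R)
    (h : Function.Bijective (fun y : Ext N (ModuleCat.of R T) 0 => y.comp ξ (rfl : 0 + d = 0 + d))) : Function.Bijective (EE ξ N) := by
  have h' : Function.Bijective (fun y : Ext N (ModuleCat.of R T) 0 => y.comp ξ (zero_add d)) := by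
    have : ∀ (m m' : ℕ) (p : 0 + d = m) (p' : 0 + d = m'), Function.Bijective (fun y : Ext N (ModuleCat.of R T) 0 => y.comp ξ p) →
        Function.Bijective (fun y : Ext N (ModuleCat.of R T) 0 => y.comp ξ p') := by
      rintro _ _ rfl rfl; exact id
    exact this _ _ _ _ h
  exact h'.comp (Ext.homEquiv₀ (X := N) (Y := ModuleCat.of R T)).symm.bijective

lemma EE_nat {R : Type} [CommRing R] {T : Type} [AddCommGroup T] [Module R T] {d : ℕ}
    (ξ : Ext (ModuleCat.of R T) (ModuleCat.of R R) d) {N N' : ModuleCat.{0} R} (g : N' ⟶ N) (h : N ⟶ ModuleCat.of R T) :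
    (Ext.mk₀ g).comp (EE ξ N h) (zero_add d) = EE ξ N' (g ≫ h) := by
  show (Ext.mk₀ g).comp ((Ext.mk₀ h).comp ξ (zero_add d)) (zero_add d) = (Ext.mk₀ (g ≫ h)).comp ξ (zero_add d)
  rw [← Ext.mk₀_comp_mk₀, Ext.comp_assoc_of_second_deg_zero]

/-- I-torsion -/
def Gam {R : Type} [CommRing R] (I : Ideal R) (T : Type) [AddCommGroup T] [Module R T] : Submodule R T where
  carrier := {t | ∃ k : ℕ, ∀ a ∈ I^k, a • t = 0}
  zero_mem' := ⟨0, by simp⟩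
  add_mem' := by
    rintro x y ⟨k, hk⟩ ⟨l, hl⟩
    exact ⟨k + l, fun a ha => by
      rw [smul_add, hk a (Ideal.pow_le_pow_right (Nat.le_add_right _ _) ha), hl a (Ideal.pow_le_pow_right (Nat.le_add_left _ _) ha), add_zero]⟩
  smul_mem' := by
    rintro r x ⟨k, hk⟩
    exact ⟨k, fun a ha => by rw [smul_comm, hk a ha, smul_zero]⟩

lemma lc_model {R : Type} [CommRing R] (I : Ideal R) (d : ℕ) {T : Type} [AddCommGroup T] [Module R T]
    (ξ : Ext (ModuleCat.of R T) (ModuleCat.of R R) d)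
    (hb : ∀ s : ℕ, Function.Bijective (fun y : Ext (ModuleCat.of R (R ⧸ I^s)) (ModuleCat.of R T) 0 => y.comp ξ (rfl : 0 + d = 0 + d))) :
    Nonempty (Gam I T ≃ₗ[R] ((localCohomology I d).obj (ModuleCat.of R R) : Type)) := by
  have hE := fun s => EE_bij ξ _ (hb s)
  let P : ∀ N : ModuleCat.{0} R, ProjectiveResolution N := fun N => projectiveResolution N
  let D := localCohomology.diagram (localCohomology.idealPowersDiagram I) d
  let c0 := colimit.cocone D
  let ev := (evaluation (ModuleCat.{0} R) (ModuleCat.{0} R)).obj (ModuleCat.of R R)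
  have hc : IsColimit (ev.mapCocone c0) := isColimitOfPreserves ev (colimit.isColimit D)
  let E : ∀ s, ((ModuleCat.of R (R ⧸ I^s)) ⟶ ModuleCat.of R T) ≃ₗ[R] Ext (ModuleCat.of R (R ⧸ I^s)) (ModuleCat.of R R) d :=
    fun s => LinearEquiv.ofBijective _ (hE s)
  let evl : ∀ s, ((ModuleCat.of R (R ⧸ I^s)) ⟶ ModuleCat.of R T) →ₗ[R] T := fun s =>
    { toFun := fun h => h.hom (Ideal.Quotient.mk (I^s) 1)
      map_add' := fun _ _ => rfl
      map_smul' := fun _ _ => rfl }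
  let ψ : ∀ j : ℕᵒᵖᵒᵖ, (D ⋙ ev).obj j →ₗ[R] T := fun j =>
    evl (unop (unop j)) ∘ₗ (E (unop (unop j))).symm.toLinearMap ∘ₗ (cmp (P (ModuleCat.of R (R ⧸ I^(unop (unop j))))) (ModuleCat.of R R) d).toLinearMap
  have hevl : ∀ s, Function.Injective (evl s) := by
    intro s h h' hh
    ext
    exact hh
  have hinj : ∀ j, Function.Injective (ψ j) := by
    intro j
    exact (hevl _).comp ((E _).symm.injective.comp (cmp _ _ _).injective)
  have hψ : ∀ {j j'} (w : j ⟶ j') (a : (D ⋙ ev).obj j), ψ j' ((D ⋙ ev).map w a) = ψ j a := by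
    intro j j' w a
    let g : ModuleCat.of R (R ⧸ I^(unop (unop j'))) ⟶ ModuleCat.of R (R ⧸ I^(unop (unop j))) :=
      (localCohomology.ringModIdeals (localCohomology.idealPowersDiagram I)).map w.unop
    have h1 := cmp_nat (P (ModuleCat.of R (R ⧸ I^(unop (unop j))))) (P (ModuleCat.of R (R ⧸ I^(unop (unop j'))))) (ModuleCat.of R R) d g a
    obtain ⟨h, hh⟩ := (E (unop (unop j))).surjective (cmp (P (ModuleCat.of R (R ⧸ I^(unop (unop j))))) (ModuleCat.of R R) d a)
    have h2 : ψ j a = evl _ h := by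
      show evl _ ((E _).symm (cmp _ _ _ a)) = _
      rw [← hh, LinearEquiv.symm_apply_apply]
    have h3 : (Ext.mk₀ g).comp (E (unop (unop j)) h) (zero_add d) = E (unop (unop j')) (g ≫ h) := EE_nat ξ g h
    rw [← hh, h3] at h1
    have h4 : ψ j' ((D ⋙ ev).map w a) = evl _ (g ≫ h) := by
      show evl _ ((E _).symm (cmp _ _ _ _)) = _
      refine congrArg _ ?_
      rw [LinearEquiv.symm_apply_eq]
      exact h1
    rw [h2, h4]
    rfl
  obtain ⟨F, hF, hr⟩ := colim_model (D ⋙ ev) (ev.mapCocone c0) hc ψ hψ hinj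
  have hrange : LinearMap.range F = Gam I T := by
    ext t
    rw [hr]
    constructor
    · rintro ⟨j, a, rfl⟩
      refine ⟨unop (unop j), fun b hb => ?_⟩
      show b • evl _ ((E _).symm (cmp _ _ _ a)) = 0
      generalize (E _).symm (cmp _ _ _ a) = h
      show b • h.hom (Ideal.Quotient.mk _ 1) = 0
      rw [← map_smul]
      have : b • (Ideal.Quotient.mk (I^(unop (unop j))) 1) = 0 := by
        rw [← Ideal.Quotient.mk_eq_mk, ← Submodule.Quotient.mk_smul, Submodule.Quotient.mk_eq_zero]; simpa using hb
      rw [this, map_zero]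
    · rintro ⟨s, hs⟩
      have hle : I^s ≤ LinearMap.ker (LinearMap.toSpanSingleton R T t) := by
        intro b hb; simpa using hs b hb
      let h : ModuleCat.of R (R ⧸ I^s) ⟶ ModuleCat.of R T := ModuleCat.ofHom (Submodule.liftQ (I^s) (LinearMap.toSpanSingleton R T t) hle)
      refine ⟨op (op s), (cmp (P (ModuleCat.of R (R ⧸ I^s))) (ModuleCat.of R R) d).symm (E s h), ?_⟩
      show evl s ((E s).symm (cmp _ _ _ _)) = _
      rw [LinearEquiv.apply_symm_apply, LinearEquiv.symm_apply_apply]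
      exact (Submodule.liftQ_apply (I^s) (LinearMap.toSpanSingleton R T t) (h := hle) 1).trans (one_smul R t)
  exact ⟨(LinearEquiv.ofEq _ _ hrange.symm) ≪≫ₗ (LinearEquiv.ofInjective F hF).symm⟩

end LyuB

end

section

open TensorProduct
open IsLocalRing 
namespace LyuB

lemma mem_gam_of_rad {R : Type} [CommRing R] [IsNoetherianRing R] (I : Ideal R) {T : Type} [AddCommGroup T] [Module R T] (t : T)
    {m : ℕ} (g : Fin m → R) (hg : Ideal.span (Set.range g) = I) : t ∈ Gam I T ↔ ∀ j, ∃ k : ℕ, g j ^ k • t = 0 := by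
  constructor
  · rintro ⟨k, hk⟩ j
    exact ⟨k, hk _ (Ideal.pow_mem_pow (hg ▸ Ideal.subset_span ⟨j, rfl⟩) k)⟩
  · intro h
    let A : Ideal R := LinearMap.ker (LinearMap.toSpanSingleton R T t)
    have h1 : I ≤ A.radical := by
      rw [← hg, Ideal.span_le]
      rintro _ ⟨j, rfl⟩
      obtain ⟨k, hk⟩ := h j
      exact ⟨k, hk⟩
    obtain ⟨k, hk⟩ := Ideal.exists_pow_le_of_le_radical_of_fg h1 (IsNoetherian.noetherian I)
    exact ⟨k, fun a ha => hk ha⟩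

lemma gam_eq_ker {R : Type} [CommRing R] [IsNoetherianRing R] (I : Ideal R) (T : Type) [AddCommGroup T] [Module R T] :
    ∃ (m : ℕ) (S : Fin m → Submonoid R) (f : T →ₗ[R] DirectSum (Fin m) (fun j => LocalizedModule (S j) T)),
      (∀ i, IsLocalizedModule (S i) (DirectSum.component R (Fin m) (fun j => LocalizedModule (S j) T) i ∘ₗ f)) ∧ LinearMap.ker f = Gam I T := by
  obtain ⟨m, g, hg⟩ := Submodule.fg_iff_exists_fin_generating_family.1 (IsNoetherian.noetherian I)
  let S : Fin m → Submonoid R := fun j => Submonoid.powers (g j)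
  let f : T →ₗ[R] DirectSum (Fin m) (fun j => LocalizedModule (S j) T) :=
    ∑ j, DirectSum.lof R (Fin m) (fun j => LocalizedModule (S j) T) j ∘ₗ LocalizedModule.mkLinearMap (S j) T
  have hf : ∀ i, DirectSum.component R (Fin m) (fun j => LocalizedModule (S j) T) i ∘ₗ f = LocalizedModule.mkLinearMap (S i) T := by
    intro i
    ext t
    simp only [f, LinearMap.comp_apply, LinearMap.sum_apply, map_sum]
    rw [Finset.sum_eq_single i]
    · rw [DirectSum.component.lof_self]
    · intro j _ hj
      rw [DirectSum.component.of, dif_neg hj]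
    · simp
  refine ⟨m, S, f, fun i => by rw [hf i]; infer_instance, ?_⟩
  ext t
  rw [mem_gam_of_rad I t g hg, LinearMap.mem_ker]
  constructor
  · intro h j
    have h1 : LocalizedModule.mkLinearMap (S j) T t = 0 := by
      rw [← hf j, LinearMap.comp_apply, h, map_zero]
    obtain ⟨⟨_, k, rfl⟩, h⟩ := (IsLocalizedModule.eq_zero_iff (S j) (LocalizedModule.mkLinearMap (S j) T)).1 h1
    exact ⟨k, h⟩
  · intro h
    refine DFinsupp.ext fun j => ?_
    obtain ⟨k, hk⟩ := h j
    have h1 : LocalizedModule.mkLinearMap (S j) T t = 0 :=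
      (IsLocalizedModule.eq_zero_iff (S j) (LocalizedModule.mkLinearMap (S j) T)).2 ⟨⟨_, k, rfl⟩, hk⟩
    rw [← hf j] at h1
    exact h1

lemma gam_crys {R : Type} [CommRing R] [IsNoetherianRing R] (I : Ideal R) {T : Type} [AddCommGroup T] [Module R T]
    {B C : Type} [CommRing B] [CommRing C] [Algebra R B] [Algebra R C] [Module.Flat R B]
    [Module.Flat R C] (ε : B →ₐ[R] C) (φ : R →+* B) (hk : IsNilpotent (RingHom.ker ε)) (h : ∀ r, ε (φ r) = algebraMap R C r)
    (δ : T →ₛₗ[φ] B ⊗[R] T) (hδ : IsCrysMap ε φ δ) :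
    ∃ δ' : Gam I T →ₛₗ[φ] B ⊗[R] (Gam I T), IsCrysMap ε φ δ' ∧ ∀ m, (Gam I T).subtype.baseChange B (δ' m) = δ m := by
  obtain ⟨m, S, f, hf, hker⟩ := gam_eq_ker I T
  obtain ⟨δN, h1, h2⟩ := crys_map_dsum S f hf ε φ hk h δ hδ
  rw [← hker]
  exact crys_ker ε φ f δ δN hδ h2

lemma gam_isCrys {R : Type} [CommRing R] [IsNoetherianRing R] (I : Ideal R) {T : Type} [AddCommGroup T] [Module R T] (hT : IsCrys R T) :
    IsCrys R (Gam I T) := by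
  intro B C _ _ _ _ _ _ ε φ hk h
  obtain ⟨δ, hδ⟩ := hT B C ε φ hk h
  obtain ⟨δ', h3, -⟩ := gam_crys I ε φ hk h δ hδ
  exact ⟨δ', h3⟩

end LyuB

end

section

open TensorProduct
open IsLocalRing CategoryTheory CategoryTheory.Abelian
namespace LyuB

lemma baer_dsum {R : Type} [CommRing R] [IsNoetherianRing R] {ι : Type} [DecidableEq ι] {N : ι → Type} [∀ i, AddCommGroup (N i)]
    [∀ i, Module R (N i)] (h : ∀ i, Module.Baer R (N i)) : Module.Baer R (DirectSum ι N) := by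
  classical
  intro J g
  choose E hE using fun i => h i J (DirectSum.component R ι N i ∘ₗ g)
  obtain ⟨s, hs⟩ : ∃ s : Finset ι, ∀ j i, i ∉ s → DirectSum.component R ι N i (g j) = 0 := by
    obtain ⟨t, ht⟩ := Module.Finite.fg_top (R := R) (M := J)
    refine ⟨t.biUnion fun j => DFinsupp.support (g j), fun j i hi => ?_⟩
    have h1 : (⊤ : Submodule R J) ≤ LinearMap.ker (DirectSum.component R ι N i ∘ₗ g) := by
      rw [← ht, Submodule.span_le]
      intro a ha
      show DirectSum.component R ι N i (g a) = 0
      by_contra hne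
      exact hi (Finset.mem_biUnion.2 ⟨a, ha, DFinsupp.mem_support_iff.2 hne⟩)
    exact h1 (show j ∈ ⊤ from trivial)
  refine ⟨∑ i ∈ s, DirectSum.lof R ι N i ∘ₗ E i, fun x hx => ?_⟩
  refine DFinsupp.ext fun i => ?_
  show DirectSum.component R ι N i _ = DirectSum.component R ι N i (g ⟨x, hx⟩)
  rw [LinearMap.sum_apply, map_sum]
  by_cases hi : i ∈ s
  · rw [Finset.sum_eq_single i]
    · rw [LinearMap.comp_apply, DirectSum.component.lof_self]; exact hE i x hx
    · intro j _ hj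
      rw [LinearMap.comp_apply, DirectSum.component.of, dif_neg hj]
    · intro h; exact absurd hi h
  · rw [hs _ _ hi, Finset.sum_eq_zero]
    intro j hj
    rw [LinearMap.comp_apply, DirectSum.component.of, dif_neg (by rintro rfl; exact hi hj)]

lemma dim_lt {R : Type} [CommRing R] {p q : Ideal R} [p.IsPrime] (hq : q.IsPrime) (h : q < p) :
    ringKrullDim (R ⧸ p) + 1 ≤ ringKrullDim (R ⧸ q) := by
  obtain ⟨hle, z, hz, hzq⟩ := SetLike.lt_iff_le_and_exists.1 h
  have h1 := dim_drop q z (by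
    intro p' hp'
    rw [Ideal.minimalPrimes_eq_subsingleton_self] at hp'
    rw [Set.mem_singleton_iff.1 hp']; exact hzq)
  refine le_trans ?_ h1
  have : q ⊔ Ideal.span {z} ≤ p := sup_le hle ((Ideal.span_singleton_le_iff_mem _).2 hz)
  gcongr
  exact ringKrullDim_le_of_surjective _ (Ideal.Quotient.factor_surjective this)

section
variable {R : Type} [CommRing R] [IsNoetherianRing R] {M : Type} [AddCommGroup M] [Module R M] {r : ℕ}
  (hr : ∀ p ∈ Module.support R M, ringKrullDim (R ⧸ p.asIdeal) ≤ r)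

/-- annihilator of an element -/
def ann1 (m : M) : Ideal R := LinearMap.ker (LinearMap.toSpanSingleton R M m)

omit [IsNoetherianRing R] in
lemma mem_ann1 (m : M) (a : R) : a ∈ ann1 m ↔ a • m = 0 := Iff.rfl

include hr
omit [IsNoetherianRing R] in
lemma eq_of_le (m : M) (p q : PrimeSpectrum R) (hp : ringKrullDim (R ⧸ p.asIdeal) = r) (h : q ≤ p) (hm : ann1 m ≤ q.asIdeal) : q = p := by
  by_contra hne
  have h1 : q ∈ Module.support R M := by
    rw [Module.mem_support_iff']
    exact ⟨m, fun s hs hsm => hs (hm hsm)⟩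
  have h2 := hr q h1
  have h3 := dim_lt q.isPrime (show q.asIdeal < p.asIdeal from lt_of_le_of_ne h (fun e => hne (PrimeSpectrum.ext e)))
  rw [hp] at h3
  have := h3.trans h2
  have h5 : ((r + 1 : ℕ) : WithBot ℕ∞) ≤ (r : ℕ) := by exact_mod_cast this
  have h6 : r + 1 ≤ r := by exact_mod_cast h5
  omega

lemma fin_supp (m : M) : {p : PrimeSpectrum R | ringKrullDim (R ⧸ p.asIdeal) = r ∧ ∀ s, s ∉ p.asIdeal → s • m ≠ 0}.Finite := by
  have hfin := (Ideal.finite_minimalPrimes_of_isNoetherianRing R (ann1 m))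
  refine Set.Finite.of_finite_image (f := PrimeSpectrum.asIdeal) (hfin.subset ?_) (fun p _ q _ h => PrimeSpectrum.ext h)
  rintro _ ⟨p, ⟨hp, hm⟩, rfl⟩
  have hle : ann1 m ≤ p.asIdeal := by
    intro a ha; by_contra h; exact hm a h ha
  refine ⟨⟨p.isPrime, hle⟩, ?_⟩
  rintro q ⟨hq, hmq⟩ hqp
  have := eq_of_le hr m p ⟨q, hq⟩ hp hqp hmq
  rw [← this]

omit [IsNoetherianRing R] in
lemma pow_kill (p : PrimeSpectrum R) (hp : ringKrullDim (R ⧸ p.asIdeal) = r) (w : LocalizedModule p.asIdeal.primeCompl M)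
    (a : R) (ha : a ∈ p.asIdeal) : ∃ k : ℕ, a^k • w = 0 := by
  obtain ⟨⟨m, t⟩, hw⟩ := IsLocalizedModule.surj p.asIdeal.primeCompl (LocalizedModule.mkLinearMap p.asIdeal.primeCompl M) w
  by_contra hne
  push Not at hne
  let S := p.asIdeal.primeCompl ⊔ Submonoid.powers a
  have hd : Disjoint ((ann1 m : Ideal R) : Set R) S := by
    rw [Set.disjoint_left]
    intro b hb hbS
    obtain ⟨u, hu, _, ⟨k, rfl⟩, rfl⟩ := Submonoid.mem_sup.1 hbS
    refine hne k ?_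
    have h1 : LocalizedModule.mkLinearMap p.asIdeal.primeCompl M (a^k • m) = 0 :=
      (IsLocalizedModule.eq_zero_iff p.asIdeal.primeCompl _).2 ⟨⟨u, hu⟩, by rw [Submonoid.mk_smul, smul_smul]; exact hb⟩
    have h2 := IsLocalizedModule.smul_injective (LocalizedModule.mkLinearMap p.asIdeal.primeCompl M) t
    apply h2
    simp only [smul_zero]
    rw [smul_comm, hw, ← map_smul, h1]
  obtain ⟨q, hq, hmq, hdq⟩ := Ideal.exists_le_prime_disjoint _ S hd
  have hqp : q ≤ p.asIdeal := by
    intro b hb; by_contra hbp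
    exact Set.disjoint_left.1 hdq hb (Submonoid.mem_sup_left hbp)
  have := eq_of_le hr m p ⟨q, hq⟩ hp hqp hmq
  have e : q = p.asIdeal := congrArg PrimeSpectrum.asIdeal this
  have haq : a ∈ (q : Set R) := by rw [e]; exact ha
  exact Set.disjoint_left.1 hdq haq (Submonoid.mem_sup_right (Submonoid.mem_powers a))

end
end LyuB

end

section

open TensorProduct
open IsLocalRing CategoryTheory CategoryTheory.Abelian
namespace LyuB

section
variable {R : Type} [CommRing R] [IsNoetherianRing R] {M : Type} [AddCommGroup M] [Module R M] {r : ℕ}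
  (hr : ∀ p ∈ Module.support R M, ringKrullDim (R ⧸ p.asIdeal) ≤ r)

/-- primes of coheight r -/
abbrev PR (R : Type) [CommRing R] (r : ℕ) := {p : PrimeSpectrum R // ringKrullDim (R ⧸ p.asIdeal) = r}

/-- localization at a prime -/
abbrev LM (M : Type) [AddCommGroup M] [Module R M] (p : PR R r) : Type := LocalizedModule p.1.asIdeal.primeCompl M

/-- localization map -/
noncomputable abbrev lm (p : PR R r) : M →ₗ[R] LM M p := LocalizedModule.mkLinearMap p.1.asIdeal.primeCompl M

include hr

lemma exists_locmap : ∃ f : M →ₗ[R] DirectSum (PR R r) (fun p => LM M p), ∀ m p, (f m) p = lm p m := by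
  classical
  have hfin : ∀ m : M, {p : PR R r | lm p m ≠ 0}.Finite := by
    intro m
    refine Set.Finite.of_finite_image (f := Subtype.val) ((fin_supp hr m).subset ?_) (fun p _ q _ h => Subtype.ext h)
    rintro _ ⟨p, hp, rfl⟩
    refine ⟨p.2, fun s hs h => hp ?_⟩
    exact (IsLocalizedModule.eq_zero_iff p.1.asIdeal.primeCompl _).2 ⟨⟨s, hs⟩, h⟩
  let f0 : M → DirectSum (PR R r) (fun p => LM M p) := fun m => DFinsupp.mk (hfin m).toFinset (fun p => lm p.1 m)
  have h0 : ∀ m p, (f0 m) p = lm p m := by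
    intro m p
    by_cases h : lm p m = 0
    · rw [h]
      refine DFinsupp.mk_of_notMem ?_
      simpa using h
    · exact DFinsupp.mk_of_mem ((Set.Finite.mem_toFinset _).2 h)
  refine ⟨{ toFun := f0, map_add' := ?_, map_smul' := ?_ }, h0⟩
  · intro m m'
    refine DFinsupp.ext fun p => ?_
    rw [h0, map_add]
    show _ = f0 m p + f0 m' p
    rw [h0, h0]
  · intro a m
    refine DFinsupp.ext fun p => ?_
    rw [h0, map_smul]
    show _ = a • f0 m p
    rw [h0]

omit [IsNoetherianRing R] in
lemma coker_local (f : M →ₗ[R] DirectSum (PR R r) (fun p => LM M p)) (hf : ∀ m p, (f m) p = lm p m) (p : PrimeSpectrum R)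
    (hp : (r : WithBot ℕ∞) ≤ ringKrullDim (R ⧸ p.asIdeal)) (z : DirectSum (PR R r) (fun p => LM M p)) :
    ∃ s, s ∉ p.asIdeal ∧ s • z ∈ LinearMap.range f := by
  classical
  have hnle : ∀ q : PR R r, q.1 ≠ p → ∃ a, a ∈ q.1.asIdeal ∧ a ∉ p.asIdeal := by
    intro q hq
    by_contra hne
    push Not at hne
    have h3 := dim_lt q.1.isPrime (show q.1.asIdeal < p.asIdeal from lt_of_le_of_ne hne (fun e => hq (PrimeSpectrum.ext e)))
    rw [q.2] at h3
    have : (r : WithBot ℕ∞) + 1 ≤ r := le_trans (by gcongr) h3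
    have h5 : ((r + 1 : ℕ) : WithBot ℕ∞) ≤ (r : ℕ) := by exact_mod_cast this
    have h6 : r + 1 ≤ r := by exact_mod_cast h5
    omega
  induction z using DirectSum.induction_on with
  | zero => exact ⟨1, (Ideal.ne_top_iff_one _).1 p.isPrime.ne_top, by rw [smul_zero]; exact Submodule.zero_mem _⟩
  | add x y hx hy =>
    obtain ⟨s, hs, h⟩ := hx
    obtain ⟨s', hs', h'⟩ := hy
    refine ⟨s * s', fun h => (p.isPrime.mem_or_mem h).elim hs hs', ?_⟩
    rw [smul_add]
    refine Submodule.add_mem _ ?_ ?_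
    · rw [mul_comm, mul_smul]; exact Submodule.smul_mem _ _ h
    · rw [mul_smul]; exact Submodule.smul_mem _ _ h'
  | of q w =>
    by_cases hqp : q.1 = p
    · obtain ⟨⟨m, t⟩, hw⟩ := IsLocalizedModule.surj q.1.asIdeal.primeCompl (lm q) w
      have hk : ∀ q' : PR R r, ∃ s, s ∉ p.asIdeal ∧ (q'.1 ≠ p → s • lm q' m = 0) := by
        intro q'
        by_cases h : q'.1 = p
        · exact ⟨1, (Ideal.ne_top_iff_one _).1 p.isPrime.ne_top, fun h' => absurd h h'⟩
        · obtain ⟨a, ha, hap⟩ := hnle q' h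
          obtain ⟨k, hk⟩ := pow_kill hr q'.1 q'.2 (lm q' m) a ha
          exact ⟨a^k, fun h => hap (p.isPrime.mem_of_pow_mem _ h), fun _ => hk⟩
      choose s hs hs0 using hk
      let S := ∏ q' ∈ DFinsupp.support (f m), s q'
      have hS : S ∉ p.asIdeal := by
        intro h
        obtain ⟨q', -, h⟩ := (Ideal.IsPrime.prod_mem_iff (hp := p.isPrime)).1 h
        exact hs q' h
      have ht : (t : R) ∉ p.asIdeal := by rw [← hqp]; exact t.2
      refine ⟨S * t, fun h => (p.isPrime.mem_or_mem h).elim hS ht, S • m, ?_⟩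
      refine DFinsupp.ext fun q' => ?_
      rw [hf, map_smul]
      show _ = DirectSum.component R (PR R r) (fun p => LM M p) q' ((S * t) • (DirectSum.lof R _ (fun p => LM M p) q w))
      rw [map_smul, DirectSum.component.of]
      split_ifs with h
      · subst h
        show _ = (S * t.1) • w
        rw [mul_smul]
        exact congrArg (S • ·) hw.symm
      · rw [smul_zero]
        have hq' : q'.1 ≠ p := by
          rw [← hqp]; exact fun e => h (Subtype.ext e.symm)
        by_cases h0 : lm q' m = 0
        · rw [h0, smul_zero]
        · obtain ⟨c, hc⟩ := Finset.dvd_prod_of_mem s (a := q') (s := DFinsupp.support (f m)) (by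
            rw [DFinsupp.mem_support_iff, hf]; exact h0)
          show (∏ q' ∈ DFinsupp.support (f m), s q') • lm q' m = 0
          rw [hc, mul_comm, mul_smul, hs0 q' hq', smul_zero]
    · obtain ⟨a, ha, hap⟩ := hnle q hqp
      obtain ⟨k, hk⟩ := pow_kill hr q.1 q.2 w a ha
      refine ⟨a^k, fun h => hap (p.isPrime.mem_of_pow_mem _ h), ?_⟩
      have : a^k • DirectSum.of (fun p => LM M p) q w = DirectSum.lof R _ (fun p => LM M p) q (a^k • w) := by
        rw [map_smul]; rfl
      rw [this, hk, map_zero]; exact Submodule.zero_mem _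

end

lemma dimlt_iff (a : WithBot ℕ∞) (r : ℕ) : a < ((r + 1 : ℕ) : WithBot ℕ∞) ↔ a ≤ r := by
  rw [Nat.cast_add, Nat.cast_one]
  exact ENat.WithBot.lt_add_one_iff

lemma upper {R : Type} [CommRing R] [IsLocalRing R] [IsNoetherianRing R] {n : ℕ} (x : Fin n → R)
    (hx : Ideal.span (Set.range x) = maximalIdeal R) (hn : (n : WithBot ℕ∞) ≤ ringKrullDim R)
    (F : Type) [Field F] (i : F →+* R) (r : ℕ) : ∀ (M : Type) [AddCommGroup M] [Module R M], IsCrys R M →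
      (∀ p ∈ Module.support R M, ringKrullDim (R ⧸ p.asIdeal) < (r : WithBot ℕ∞)) → HasInjectiveDimensionLT (ModuleCat.of R M) r := by
  classical
  obtain ⟨C, _, _, _, _, k, _, g, hCD, hmax⟩ := exists_cd x hx hn F i
  induction r with
  | zero =>
    intro M _ _ _ hM
    rw [hasInjectiveDimensionLT_zero_iff_isZero, ModuleCat.isZero_iff_subsingleton]
    show Subsingleton M
    rw [← Module.support_eq_empty_iff (R := R), Set.eq_empty_iff_forall_notMem]
    intro p hp
    have h1 := hM p hp
    have h2 := ringKrullDim_nonneg_of_nontrivial (R := R ⧸ p.asIdeal)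
    exact absurd h1 (not_lt.2 h2)
  | succ r ih =>
    intro M _ _ hcr hM
    have hr : ∀ p ∈ Module.support R M, ringKrullDim (R ⧸ p.asIdeal) ≤ r := fun p hp => (dimlt_iff _ _).1 (hM p hp)
    obtain ⟨f, hf⟩ := exists_locmap hr
    have hfl : ∀ p : PR R r, IsLocalizedModule p.1.asIdeal.primeCompl (DirectSum.component R (PR R r) (fun p => LM M p) p ∘ₗ f) := by
      intro p
      have : DirectSum.component R (PR R r) (fun p => LM M p) p ∘ₗ f = lm p := by
        ext m; exact hf m p
      rw [this]; infer_instance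
    have hK := ih (LinearMap.ker f) (hcr.ker_dsum (fun p => p.1.asIdeal.primeCompl) f hfl) (by
      intro p hp
      have h1 := hr p (Module.support_subset_of_injective (LinearMap.ker f).subtype (Submodule.injective_subtype _) hp)
      refine lt_of_le_of_ne h1 fun h2 => ?_
      obtain ⟨m, hm⟩ := Module.mem_support_iff'.1 hp
      have h3 : lm (⟨p, h2⟩ : PR R r) m.1 = 0 := by
        rw [← hf, show f m.1 = 0 from m.2]; rfl
      obtain ⟨⟨s, hs⟩, h4⟩ := (IsLocalizedModule.eq_zero_iff p.asIdeal.primeCompl _).1 h3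
      exact hm s hs (Subtype.ext h4))
    have hQ := ih (DirectSum (PR R r) (fun p => LM M p) ⧸ LinearMap.range f) (hcr.coker_dsum (fun p => p.1.asIdeal.primeCompl) f hfl) (by
      intro p hp
      by_contra hlt
      obtain ⟨y, hy⟩ := Module.mem_support_iff'.1 hp
      obtain ⟨z, rfl⟩ := Submodule.Quotient.mk_surjective _ y
      obtain ⟨s, hs, hsz⟩ := coker_local hr f hf p (not_lt.1 hlt) z
      refine hy s hs ?_
      rw [← Submodule.Quotient.mk_smul, Submodule.Quotient.mk_eq_zero]; exact hsz)
    have hB : Module.Baer R (DirectSum (PR R r) (fun p => LM M p)) := by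
      apply baer_dsum
      intro p
      refine baer_cd hCD (fun j => algebraMap R C (x j)) hmax (hcr.loc p.1.asIdeal.primeCompl (lm p)) p.1.asIdeal ?_ ?_
      · intro w
        obtain ⟨m, g, hg⟩ := Submodule.fg_iff_exists_fin_generating_family.1 (IsNoetherian.noetherian p.1.asIdeal)
        exact (mem_gam_of_rad p.1.asIdeal w g hg).2 fun j => pow_kill hr p.1 p.2 w (g j) (by
          have : g j ∈ Submodule.span R (Set.range g) := Submodule.subset_span ⟨j, rfl⟩
          rwa [hg] at this)
      · intro s hs
        exact (Module.End.isUnit_iff _).1 (IsLocalizedModule.map_units (lm p) (⟨s, hs⟩ : p.1.asIdeal.primeCompl))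
    have hI : HasInjectiveDimensionLT (ModuleCat.of R (DirectSum (PR R r) (fun p => LM M p))) 1 := by
      have := hB.injective
      have := Module.injective_object_of_injective_module (R := R) (M := DirectSum (PR R r) (fun p => LM M p))
      infer_instance
    have e1 : Function.Exact (LinearMap.range f).subtype (LinearMap.range f).mkQ := LinearMap.exact_subtype_mkQ _
    have s1 := sc_se _ _ e1 (Submodule.injective_subtype _) (Submodule.mkQ_surjective _)
    have e2 : Function.Exact (LinearMap.ker f).subtype f.rangeRestrict := by
      intro m
      rw [← LinearMap.mem_ker, LinearMap.ker_rangeRestrict]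
      simp
    have s2 := sc_se (A := LinearMap.ker f) (B := M) (C := LinearMap.range f) (LinearMap.ker f).subtype f.rangeRestrict e2 (Submodule.injective_subtype _) (LinearMap.surjective_rangeRestrict f)
    have hR : HasInjectiveDimensionLT (ModuleCat.of R (LinearMap.range f)) (r+1) :=
      s1.hasInjectiveDimensionLT_X₁ r hQ (@hasInjectiveDimensionLT_of_ge _ _ _ _ 1 (r+1) (by omega) hI)
    exact s2.hasInjectiveDimensionLT_X₂ (r+1) (@hasInjectiveDimensionLT_of_ge _ _ _ _ r (r+1) (by omega) hK) hR

end LyuB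

end

section

open TensorProduct
open IsLocalRing CategoryTheory CategoryTheory.Abelian RingTheory.Sequence
namespace LyuB

section
variable {R : Type} [CommRing R]

lemma ql_inj (l : List R) (x : R) (h : IsWeaklyRegular R (l ++ [x])) :
    Function.Injective (LinearMap.lsmul R (R ⧸ Ideal.ofList l) x) := by
  rw [isWeaklyRegular_append_iff] at h
  have h1 := ((isWeaklyRegular_singleton_iff _ _).1 h.2)
  have e : (Ideal.ofList l • ⊤ : Ideal R) = Ideal.ofList l := by simp
  rw [e] at h1
  exact h1

lemma ofList_le_app (l : List R) (x : R) : Ideal.ofList l ≤ Ideal.ofList (l ++ [x]) := by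
  rw [Ideal.ofList_append]; exact le_sup_left

lemma ql_exact (l : List R) (x : R) :
    Function.Exact (LinearMap.lsmul R (R ⧸ Ideal.ofList l) x) (Submodule.factor (ofList_le_app l x)) := by
  intro y
  obtain ⟨y, rfl⟩ := Submodule.Quotient.mk_surjective _ y
  have h1 : Submodule.factor (ofList_le_app l x) (Submodule.Quotient.mk y) = Submodule.Quotient.mk y := rfl
  rw [h1, Submodule.Quotient.mk_eq_zero, Ideal.ofList_append, Ideal.ofList_singleton]
  constructor
  · intro h
    obtain ⟨a, ha, b, hb, rfl⟩ := Submodule.mem_sup.1 h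
    obtain ⟨c, rfl⟩ := Ideal.mem_span_singleton'.1 hb
    refine ⟨Submodule.Quotient.mk c, ?_⟩
    show x • (Submodule.Quotient.mk c : R ⧸ Ideal.ofList l) = _
    rw [← Submodule.Quotient.mk_smul, eq_comm, Submodule.Quotient.eq]
    simpa [mul_comm] using ha
  · rintro ⟨z, hz⟩
    obtain ⟨c, rfl⟩ := Submodule.Quotient.mk_surjective _ z
    have hz : x • (Submodule.Quotient.mk c : R ⧸ Ideal.ofList l) = Submodule.Quotient.mk y := hz
    rw [← Submodule.Quotient.mk_smul, eq_comm, Submodule.Quotient.eq] at hz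
    exact Submodule.mem_sup.2 ⟨_, hz, x * c, Ideal.mem_span_singleton'.2 ⟨c, mul_comm _ _⟩, by simp⟩

lemma ql_se (l : List R) (x : R) (h : IsWeaklyRegular R (l ++ [x])) :
    (sc _ _ (ql_exact l x)).ShortExact := sc_se _ _ _ (ql_inj l x h) (Submodule.factor_surjective _)

lemma ql_pd (M : ModuleCat.{0} R) (l : List R) (h : IsWeaklyRegular R l) (i : ℕ) (hi : l.length < i) :
    Subsingleton (Ext (ModuleCat.of R (R ⧸ Ideal.ofList l)) M i) := by
  induction l using List.reverseRecOn generalizing i with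
  | nil =>
    have : Module.Projective R (R ⧸ Ideal.ofList ([] : List R)) := by
      rw [Ideal.ofList_nil]
      exact Module.Projective.of_equiv (Submodule.quotEquivOfEqBot (⊥ : Ideal R) rfl).symm
    have := (ModuleCat.of R (R ⧸ Ideal.ofList ([] : List R))).projective_of_module_projective
    refine subsingleton_of_forall_eq 0 fun e => ?_
    obtain ⟨j, rfl⟩ : ∃ j, i = j + 1 := ⟨i - 1, by simp at hi; omega⟩
    exact Ext.eq_zero_of_projective e
  | append_singleton l x ih =>
    have hl := ((isWeaklyRegular_append_iff _ _ _).1 h).1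
    obtain ⟨j, rfl⟩ : ∃ j, i = 1 + j := ⟨i - 1, by simp at hi; omega⟩
    have hj : l.length < j := by simp at hi; omega
    refine subsingleton_of_forall_eq 0 fun e => ?_
    have := ih hl j hj
    have := ih hl (1 + j) (by omega)
    obtain ⟨y, hy⟩ := Ext.contravariant_sequence_exact₃ (ql_se l x h) M e ((this).elim _ _) rfl
    have hy0 : y = 0 := (ih hl j hj).elim y 0
    rw [← hy, hy0]
    exact Ext.comp_zero ((ql_se l x h).extClass) M j (1 + j) rfl

lemma ql_surj (M : ModuleCat.{0} R) (l : List R) (h : IsWeaklyRegular R l) :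
    ∃ φ : Ext (ModuleCat.of R (R ⧸ Ideal.ofList l)) M l.length →ₗ[R] (M ⧸ (Ideal.ofList l • ⊤ : Submodule R M)), Function.Surjective φ := by
  induction l using List.reverseRecOn with
  | nil =>
    let evl : (ModuleCat.of R (R ⧸ Ideal.ofList ([] : List R)) ⟶ M) →ₗ[R] M :=
      { toFun := fun h => h.hom (Submodule.Quotient.mk 1)
        map_add' := fun _ _ => rfl
        map_smul' := fun _ _ => rfl }
    refine ⟨Submodule.mkQ _ ∘ₗ evl ∘ₗ (Ext.linearEquiv₀ (R := R)).toLinearMap, ?_⟩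
    intro w
    obtain ⟨m, rfl⟩ := Submodule.mkQ_surjective _ w
    have hle : Ideal.ofList [] ≤ LinearMap.ker (LinearMap.toSpanSingleton R M m) := by rw [Ideal.ofList_nil]; exact bot_le
    refine ⟨(Ext.linearEquiv₀ (R := R)).symm (ModuleCat.ofHom (Submodule.liftQ _ (LinearMap.toSpanSingleton R M m) hle)), ?_⟩
    rw [LinearMap.comp_apply, LinearMap.comp_apply, LinearEquiv.coe_coe, LinearEquiv.apply_symm_apply]
    congr 1
    exact (Submodule.liftQ_apply _ (LinearMap.toSpanSingleton R M m) (h := hle) 1).trans (one_smul R m)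
  | append_singleton l x ih =>
    have hl := ((isWeaklyRegular_append_iff _ _ _).1 h).1
    obtain ⟨φ, hφ⟩ := ih hl
    have hS := ql_se l x h
    have hlen : 1 + l.length = (l ++ [x]).length := by simp [add_comm]
    let D : Ext (ModuleCat.of R (R ⧸ Ideal.ofList l)) M l.length →ₗ[R] Ext (ModuleCat.of R (R ⧸ Ideal.ofList (l ++ [x]))) M (l ++ [x]).length :=
      { toFun := fun y => (hS.extClass : Ext (ModuleCat.of R (R ⧸ Ideal.ofList (l ++ [x]))) (ModuleCat.of R (R ⧸ Ideal.ofList l)) 1).comp y hlen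
        map_add' := fun y y' => Ext.comp_add _ _ _ _
        map_smul' := fun r y => Ext.comp_smul _ _ _ _ }
    have hD : Function.Surjective D := by
      intro e
      obtain ⟨y, hy⟩ := Ext.contravariant_sequence_exact₃ hS M e ((ql_pd M l hl _ (by simp)).elim _ _) hlen
      exact ⟨y, hy⟩
    have hle : (Ideal.ofList l • ⊤ : Submodule R M) ≤ (Ideal.ofList (l ++ [x]) • ⊤ : Submodule R M) :=
      Submodule.smul_mono (ofList_le_app l x) le_rfl
    let φ1 := Submodule.factor hle ∘ₗ φ
    have hφ1 : Function.Surjective φ1 := (Submodule.factor_surjective hle).comp hφ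
    have hker : LinearMap.ker D ≤ LinearMap.ker φ1 := by
      intro y hy
      have key : ∀ z : Ext (ModuleCat.of R (R ⧸ Ideal.ofList l)) M l.length,
          (Ext.mk₀ (x • 𝟙 (ModuleCat.of R (R ⧸ Ideal.ofList l)))).comp z (zero_add _) = x • z := by
        intro z
        rw [Ext.mk₀_smul, Ext.smul_comp, Ext.mk₀_id_comp]
      obtain ⟨z, e2⟩ : ∃ z : Ext (ModuleCat.of R (R ⧸ Ideal.ofList l)) M l.length, x • z = y := by
        obtain ⟨z, hz⟩ := Ext.contravariant_sequence_exact₁ hS M y hlen hy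
        exact ⟨z, (key z).symm.trans hz⟩
      rw [← e2, LinearMap.mem_ker, map_smul]
      obtain ⟨w, hw⟩ := Submodule.Quotient.mk_surjective _ (φ1 z)
      rw [← hw, ← Submodule.Quotient.mk_smul, Submodule.Quotient.mk_eq_zero]
      exact Submodule.smul_mem_smul (by rw [Ideal.ofList_append, Ideal.ofList_singleton]; exact Ideal.mem_sup_right (Ideal.mem_span_singleton_self x)) trivial
    refine ⟨Submodule.liftQ _ φ1 hker ∘ₗ (D.quotKerEquivOfSurjective hD).symm.toLinearMap, ?_⟩
    intro w
    obtain ⟨y, hy⟩ := hφ1 w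
    refine ⟨D y, ?_⟩
    have e : (D.quotKerEquivOfSurjective hD).symm (D y) = Submodule.Quotient.mk y := by
      rw [LinearEquiv.symm_apply_eq]; rfl
    rw [LinearMap.comp_apply, LinearEquiv.coe_coe, e, ← hy]
    rfl

lemma top_of_injdim (M : Type) [AddCommGroup M] [Module R M] (l : List R) (h : IsWeaklyRegular R l)
    (hM : HasInjectiveDimensionLT (ModuleCat.of R M) l.length) : (Ideal.ofList l • ⊤ : Submodule R M) = ⊤ := by
  obtain ⟨φ, hφ⟩ := ql_surj (ModuleCat.of R M) l h
  have h1 := HasInjectiveDimensionLT.subsingleton (ModuleCat.of R M) l.length l.length le_rfl (ModuleCat.of R (R ⧸ Ideal.ofList l))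
  have h2 : Subsingleton (M ⧸ (Ideal.ofList l • ⊤ : Submodule R M)) := hφ.subsingleton
  exact Submodule.Quotient.subsingleton_iff.1 h2

end
end LyuB

end

section

open TensorProduct
open IsLocalRing CategoryTheory CategoryTheory.Abelian RingTheory.Sequence
namespace LyuB

section
variable {R : Type} [CommRing R]

lemma smul_mem_of_map {B T : Type} [CommRing B] [Algebra R B] [AddCommGroup T] [Module R T] (J : Ideal R) (b : B)
    (hb : b ∈ J.map (algebraMap R B)) (z : B ⊗[R] T) : b • z ∈ (J • ⊤ : Submodule R (B ⊗[R] T)) := by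
  induction hb using Submodule.span_induction with
  | mem x hx =>
    obtain ⟨j, hj, rfl⟩ := hx
    rw [algebraMap_smul]
    exact Submodule.smul_mem_smul hj trivial
  | zero => simp
  | add x y _ _ hx hy => rw [add_smul]; exact add_mem hx hy
  | smul a x _ hx =>
    let f : B ⊗[R] T →ₗ[R] B ⊗[R] T := (LinearMap.lsmul B (B ⊗[R] T) a).restrictScalars R
    have h := Submodule.mem_map_of_mem (f := f) hx
    rw [Submodule.map_smul''] at h
    rw [smul_eq_mul, mul_smul]
    exact Submodule.smul_mono le_rfl le_top h

lemma map_smul_mem {M N : Type} [AddCommGroup M] [Module R M] [AddCommGroup N] [Module R N] (J : Ideal R)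
    (f : M →ₗ[R] N) (m : M) (hm : m ∈ (J • ⊤ : Submodule R M)) : f m ∈ (J • ⊤ : Submodule R N) := by
  have h := Submodule.mem_map_of_mem (f := f) hm
  rw [Submodule.map_smul''] at h
  exact Submodule.smul_mono le_rfl le_top h

lemma ff_mem {C T : Type} [CommRing C] [Algebra R C] [Module.FaithfullyFlat R C] [AddCommGroup T] [Module R T]
    (J : Ideal R) (m : T) (hm : (1 : C) ⊗ₜ[R] m ∈ (J • ⊤ : Submodule R (C ⊗[R] T))) : m ∈ (J • ⊤ : Submodule R T) := by
  rw [← Submodule.Quotient.mk_eq_zero]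
  apply Module.FaithfullyFlat.tensorProduct_mk_injective (A := R) (B := C)
  have h := map_smul_mem J ((J • ⊤ : Submodule R T).mkQ.lTensor C) _ hm
  have h0 : (J • ⊤ : Submodule R (C ⊗[R] (T ⧸ (J • ⊤ : Submodule R T)))) = ⊥ := by
    rw [eq_bot_iff, Submodule.smul_le]
    intro a ha z hz
    clear hz
    rw [Submodule.mem_bot]
    induction z using TensorProduct.induction_on with
    | zero => simp
    | tmul x y =>
      obtain ⟨y, rfl⟩ := Submodule.Quotient.mk_surjective _ y
      rw [← TensorProduct.tmul_smul, ← Submodule.Quotient.mk_smul, (Submodule.Quotient.mk_eq_zero _).2 (Submodule.smul_mem_smul ha Submodule.mem_top), TensorProduct.tmul_zero]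
    | add x y hx hy => rw [smul_add, hx, hy, add_zero]
  rw [h0, Submodule.mem_bot] at h
  rw [map_zero]
  exact h

lemma lower_core {σ : Type} [Fintype σ] (xv : σ → R) (C : Type) [CommRing C] [Algebra R C] [Module.FaithfullyFlat R C]
    (N : ℕ) {B : Type} [CommRing B] [Algebra (MvPolynomial σ C) B] [Algebra R B] [IsScalarTower R (MvPolynomial σ C) B]
    (tt : B) (ε : B →ₐ[MvPolynomial σ C] MvPolynomial σ C) (l : B →ₗ[MvPolynomial σ C] MvPolynomial σ C)
    (hl : ∀ b, l (tt ^ N * b) = ε b) (φ : R →+* B)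
    (hφ : ∀ i, φ (xv i) = algebraMap R _ (xv i) + algebraMap (MvPolynomial σ C) _ (MvPolynomial.X i) * tt)
    {T : Type} [AddCommGroup T] [Module R T] (δ : T →ₛₗ[φ] B ⊗[R] T)
    (hδ : IsCrysMap (ε.restrictScalars R) φ δ) (u : R →ₗ[R] T) (P : MvPolynomial σ R)
    (hP : P.IsHomogeneous N) (J : Ideal R) (hJ : ∀ i, xv i ∈ J)
    (h : δ (u (P.eval xv)) ∈ (J • ⊤ : Submodule R (B ⊗[R] T))) (β : σ →₀ ℕ) :
    u (P.coeff β) ∈ (J • ⊤ : Submodule R T) := by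
  classical
  by_cases hβ : β ∈ P.support
  swap
  · rw [MvPolynomial.notMem_support_iff.1 hβ, map_zero]; exact zero_mem _
  apply ff_mem (C := C)
  let cβ : (MvPolynomial σ C) →ₗ[R] C := (MvPolynomial.lcoeff C β).restrictScalars R
  let lβ : B →ₗ[R] C := cβ ∘ₗ l.restrictScalars R
  let Λ := lβ.rTensor T
  let W : (σ →₀ ℕ) → B := fun α => tt ^ N * algebraMap (MvPolynomial σ C) B (MvPolynomial.monomial α 1)
  -- congruence
  have h1 : ∀ α ∈ P.support, ∀ z : B ⊗[R] T, (φ (α.prod fun i k => xv i ^ k)) • z - W α • z ∈ (J • ⊤ : Submodule R (B ⊗[R] T)) := by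
    intro α hα z
    suffices hs : φ (α.prod fun i k => xv i ^ k) - W α ∈ J.map (algebraMap R B) by
      have := smul_mem_of_map (T := T) J _ hs z
      rw [sub_eq_add_neg, add_smul] at this
      rw [sub_eq_add_neg]
      convert this using 2
      exact (neg_smul (W α) z).symm
    rw [← Ideal.Quotient.eq]
    have hd : ∑ i ∈ α.support, α i = N := by
      have := hP (MvPolynomial.mem_support_iff.1 hα)
      rw [← this, Finsupp.weight_apply]; simp [Finsupp.sum]
    have hW : W α = ∏ i ∈ α.support, (algebraMap (MvPolynomial σ C) B (MvPolynomial.X i) * tt) ^ (α i) := by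
      simp only [W, mul_pow, Finset.prod_mul_distrib, Finset.prod_pow_eq_pow_sum, hd]
      rw [mul_comm]
      congr 1
      rw [MvPolynomial.monomial_eq, map_one, one_mul, Finsupp.prod, map_prod]
      simp only [map_pow]
    rw [hW, Finsupp.prod, map_prod, map_prod, map_prod]
    refine Finset.prod_congr rfl fun i _ => ?_
    rw [map_pow, map_pow, map_pow, hφ, map_add]
    congr 1
    rw [Ideal.Quotient.eq_zero_iff_mem.2 (Ideal.mem_map_of_mem _ (hJ i)), zero_add]
  have h2 : ∀ (α : σ →₀ ℕ) (m : T), Λ (W α • δ m) = (MvPolynomial.coeff β (MvPolynomial.monomial α (1 : C))) ⊗ₜ[R] m := by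
    intro α m
    have e1 : ∀ z : B ⊗[R] T, Λ (W α • z) = (cβ ∘ₗ LinearMap.mulLeft R (MvPolynomial.monomial α (1:C) : (MvPolynomial σ C))).rTensor T
        (((ε).restrictScalars R).toLinearMap.rTensor T z) := by
      intro z
      induction z using TensorProduct.induction_on with
      | zero => simp
      | tmul b t =>
        have : lβ (W α * b) = cβ (MvPolynomial.monomial α (1:C) * ε b) := by
          simp only [lβ, W, LinearMap.comp_apply, LinearMap.restrictScalars_apply, mul_assoc]
          rw [hl, map_mul, AlgHom.commutes]
          rfl
        simp only [Λ, TensorProduct.smul_tmul', smul_eq_mul, LinearMap.rTensor_tmul, this]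
        rfl
      | add x y hx hy => rw [smul_add, map_add, hx, hy, map_add, map_add]
    rw [e1, hδ m, LinearMap.rTensor_tmul]
    simp [cβ]
  have h3 : δ (u (P.eval xv)) = ∑ α ∈ P.support, φ (α.prod fun i k => xv i ^ k) • δ (u (P.coeff α)) := by
    rw [MvPolynomial.eval_eq, map_sum, map_sum]
    refine Finset.sum_congr rfl fun α _ => ?_
    rw [mul_comm, ← smul_eq_mul, map_smul, LinearMap.map_smulₛₗ]
    rfl
  have h4 : Λ (∑ α ∈ P.support, W α • δ (u (P.coeff α))) = 1 ⊗ₜ[R] u (P.coeff β) := by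
    rw [map_sum, Finset.sum_eq_single β]
    · rw [h2]; simp
    · intro α _ hne; rw [h2, MvPolynomial.coeff_monomial, if_neg hne, TensorProduct.zero_tmul]
    · intro h; exact absurd hβ h
  rw [← h4]
  apply map_smul_mem
  have h5 : δ (u (P.eval xv)) - ∑ α ∈ P.support, W α • δ (u (P.coeff α)) ∈ (J • ⊤ : Submodule R (B ⊗[R] T)) := by
    rw [h3, ← Finset.sum_sub_distrib]
    exact sum_mem fun α hα => h1 α hα _
  exact (Submodule.sub_mem_iff_right _ h).1 h5
end
end LyuB

end

section

open TensorProduct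
open IsLocalRing CategoryTheory CategoryTheory.Abelian RingTheory.Sequence
namespace LyuB

section
variable {R : Type} [CommRing R]

lemma exists_order [IsLocalRing R] [IsNoetherianRing R] (J K : Ideal R) (hJ : J ≠ ⊤) (c : R) (hc : c ∉ K) :
    ∃ N, c ∈ J ^ N ⊔ K ∧ c ∉ J ^ (N + 1) ⊔ K := by
  classical
  have h := Ideal.iInf_pow_smul_eq_bot_of_isLocalRing (M := R ⧸ K) J hJ
  have hex : ∃ N, c ∉ J ^ N ⊔ K := by
    by_contra hcon
    push Not at hcon
    apply hc
    rw [← Submodule.Quotient.mk_eq_zero, ← Submodule.mem_bot R, ← h, Submodule.mem_iInf]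
    intro i
    obtain ⟨a, ha, b, hb, hab⟩ := Submodule.mem_sup.1 (hcon i)
    have e : (Submodule.Quotient.mk c : R ⧸ K) = a • (Submodule.Quotient.mk 1 : R ⧸ K) := by
      rw [← Submodule.Quotient.mk_smul, Submodule.Quotient.eq, ← hab]; simpa using hb
    rw [e]
    exact Submodule.smul_mem_smul ha trivial
  refine ⟨Nat.find hex - 1, ?_, ?_⟩
  · have h0 : Nat.find hex ≠ 0 := by
      intro h0
      have := Nat.find_spec hex
      rw [h0] at this
      simp at this
    exact not_not.1 (Nat.find_min hex (m := Nat.find hex - 1) (by omega))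
  · have h0 : Nat.find hex ≠ 0 := by
      intro h0
      have := Nat.find_spec hex
      rw [h0] at this
      simp at this
    rw [Nat.sub_add_cancel (by omega)]
    exact Nat.find_spec hex

lemma lower [IsLocalRing R] [IsNoetherianRing R] {n : ℕ} (x : Fin n → R)
    (hx : Ideal.span (Set.range x) = maximalIdeal R) (hn : (n : WithBot ℕ∞) ≤ ringKrullDim R)
    (F : Type) [Field F] (i : F →+* R) (I : Ideal R) (fs : List R) (hfs : IsWeaklyRegular R fs)
    (hfm : ∀ a ∈ fs, a ∈ maximalIdeal R) {T : Type} [AddCommGroup T] [Module R T] (io : R →ₗ[R] T)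
    (hT : IsCrys R T) (hio : ∀ a ∈ fs, a • io 1 = 0)
    (hp : ∀ xs : List R, (∀ a ∈ xs, a ∈ maximalIdeal R) → IsWeaklyRegular R (xs ++ fs) →
        ∀ c, io c ∈ (Ideal.ofList xs • ⊤ : Submodule R T) → c ∈ Ideal.ofList (xs ++ fs))
    (r : ℕ) (hr : fs.length + r ≤ n) (c : R) (hc : c ∉ Ideal.ofList fs) (hIc : ∀ a ∈ I, a * c ∈ Ideal.ofList fs) :
    ¬ HasInjectiveDimensionLT (ModuleCat.of R (Gam I T)) r := by
  classical
  obtain ⟨y, l, hy, -, rfl, hreg⟩ := exists_reg x hx hn fs hfs r hr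
  intro hid
  have hym : ∀ j, y j ∈ maximalIdeal R := fun j => hy ▸ Ideal.subset_span ⟨j, rfl⟩
  have hxm : ∀ a ∈ l.map y, a ∈ maximalIdeal R := by
    intro a ha
    obtain ⟨j, -, rfl⟩ := List.mem_map.1 ha
    exact hym j
  have hreg' : IsWeaklyRegular R (l.map y ++ fs) := wr_perm hreg List.perm_append_comm (by
    intro a ha
    rcases List.mem_append.1 ha with h | h
    · exact hfm a h
    · exact hxm a h)
  have hxs := ((isWeaklyRegular_append_iff _ _ _).1 hreg').1
  have htop := top_of_injdim (Gam I T) (l.map y) hxs (by rw [List.length_map]; exact hid)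
  set J := Ideal.ofList (l.map y) with hJdef
  have hJm : J ≤ maximalIdeal R := by
    rw [hJdef, Ideal.ofList, Ideal.span_le]
    exact hxm
  obtain ⟨N, hN1, hN2⟩ := exists_order J (Ideal.ofList fs) (ne_top_of_le_ne_top (maximalIdeal.isMaximal R).ne_top hJm) c hc
  let xv : {j // j ∈ l} → R := fun j => y j
  have hJs : J = Ideal.span (Set.range xv) := by
    rw [hJdef, Ideal.ofList]
    congr 1
    ext a
    simp [xv]
  have hkill : ∀ a ∈ Ideal.ofList fs, io a = 0 := by
    have : Ideal.ofList fs ≤ LinearMap.ker io := by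
      rw [Ideal.ofList, Ideal.span_le]
      intro a ha
      have := hio a ha
      rw [← map_smul, smul_eq_mul, mul_one] at this
      exact this
    exact this
  obtain ⟨c', hc', b, hb, hcb⟩ := Submodule.mem_sup.1 hN1
  rw [hJs, Ideal.mem_span_pow_iff_exists_isHomogeneous] at hc'
  obtain ⟨P, hP, rfl⟩ := hc'
  have hioc : io c = io (P.eval xv) := by rw [← hcb, map_add, hkill b hb, add_zero]
  have hcG : io c ∈ Gam I T := by
    refine ⟨1, fun a ha => ?_⟩
    rw [← map_smul, smul_eq_mul]
    exact hkill _ (hIc a (by simpa using ha))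
  obtain ⟨C, _, _, _, _, k, _, g, hCD, hCx⟩ := exists_cd y hy hn F i
  let C' := MvPolynomial {j // j ∈ l} C
  let B := Tr C' N
  let ee : Fin n → B := fun j => if h : j ∈ l then algebraMap C' B (MvPolynomial.X ⟨j, h⟩) * tr C' N else 0
  have hee : Ideal.span (Set.range ee) ≤ Ideal.span {tr C' N} := by
    rw [Ideal.span_le]
    rintro _ ⟨j, rfl⟩
    simp only [ee]
    split_ifs
    · exact Ideal.mul_mem_left _ _ (Ideal.mem_span_singleton_self _)
    · exact zero_mem _
  have heN : Ideal.span (Set.range ee) ^ (N + 1) = ⊥ := by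
    have := Ideal.pow_right_mono hee (N + 1)
    rw [Ideal.span_singleton_pow, tr_pow] at this
    simpa using this
  obtain ⟨φ0, -, hφ2, hφ3⟩ := hCD.taylor (fun j => algebraMap R C (y j)) hCx ee (N + 1) heN
  let φ : R →+* B := φ0.comp (algebraMap R C)
  haveI : Module.Flat C C' := inferInstanceAs (Module.Flat C (MvPolynomial _ C))
  haveI : Module.Flat R C' := Module.Flat.trans R C C'
  haveI : Module.Flat R B := Module.Flat.trans R C' B
  have hε : ∀ r, ((trε C' N).restrictScalars R) (φ r) = algebraMap R C' r := by
    intro r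
    obtain ⟨w, hw⟩ := Ideal.mem_span_singleton'.1 (hee (hφ3 (algebraMap R C r)))
    have e : φ r = algebraMap R B r + w * tr C' N := by
      rw [hw, ← IsScalarTower.algebraMap_apply]; simp [φ]
    rw [e, map_add, AlgHom.commutes, map_mul]
    simp
  have hk : IsNilpotent (RingHom.ker ((trε C' N).restrictScalars R)) := tr_ker C' N
  obtain ⟨δ, hδ⟩ := hT B C' ((trε C' N).restrictScalars R) φ hk hε
  obtain ⟨δ', -, h2⟩ := gam_crys I ((trε C' N).restrictScalars R) φ hk hε δ hδ
  have hmem : δ (io (P.eval xv)) ∈ (J • ⊤ : Submodule R (B ⊗[R] T)) := by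
    rw [← hioc, ← h2 ⟨io c, hcG⟩]
    have ht2 : ∀ z : B ⊗[R] (Gam I T), z ∈ (J • ⊤ : Submodule R (B ⊗[R] (Gam I T))) := by
      intro z
      induction z using TensorProduct.induction_on with
      | zero => exact zero_mem _
      | add a b ha hb => exact add_mem ha hb
      | tmul b m =>
        have hm : m ∈ (J • ⊤ : Submodule R (Gam I T)) := by rw [htop]; trivial
        exact map_smul_mem J (TensorProduct.mk R B (Gam I T) b) m hm
    exact map_smul_mem J (((Gam I T).subtype.baseChange B).restrictScalars R) _ (ht2 _)
  obtain ⟨lf, hlf⟩ := tr_functional C' N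
  have hco : ∀ β, P.coeff β ∈ J ⊔ Ideal.ofList fs := by
    intro β
    have h3 := lower_core xv C N (tr C' N) (trε C' N) lf hlf φ (by
      intro j
      have := hφ2 j.1
      have e1 : φ (xv j) = φ0 (algebraMap R C (y j.1)) := rfl
      rw [e1, this, ← IsScalarTower.algebraMap_apply]
      simp only [ee, dif_pos j.2]
      rfl) δ hδ io P hP J (fun j => hJs ▸ Ideal.subset_span ⟨j, rfl⟩) hmem β
    have := hp (l.map y) hxm hreg' _ h3
    rwa [Ideal.ofList_append] at this
  apply hN2
  rw [← hcb]
  refine add_mem ?_ (Ideal.mem_sup_right hb)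
  rw [MvPolynomial.eval_eq]
  refine sum_mem fun α hα => ?_
  obtain ⟨u, hu, v, hv, huv⟩ := Submodule.mem_sup.1 (hco α)
  rw [← huv, add_mul]
  refine add_mem (Ideal.mem_sup_left ?_) (Ideal.mem_sup_right (Ideal.mul_mem_right _ _ hv))
  rw [pow_succ, mul_comm u]
  refine Ideal.mul_mem_mul ?_ hu
  rw [hJs, Ideal.mem_span_pow_iff_exists_isHomogeneous]
  refine ⟨MvPolynomial.monomial α 1, MvPolynomial.isHomogeneous_monomial _ ?_, ?_⟩
  · have := hP (MvPolynomial.mem_support_iff.1 hα)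
    rw [← this, Finsupp.weight_apply, Finsupp.degree_apply]; simp [Finsupp.sum]
  · simp [MvPolynomial.eval_monomial, Finsupp.prod]
end
end LyuB

end

section

open TensorProduct
open IsLocalRing CategoryTheory CategoryTheory.Abelian RingTheory.Sequence
namespace LyuB

section
variable {R : Type} [CommRing R]

lemma quot_dim_coheight (p : PrimeSpectrum R) : ringKrullDim (R ⧸ p.asIdeal) = (Order.coheight p : ℕ∞) := by
  rw [ringKrullDim_quotient, Order.coheight_eq_krullDim_Ici]
  congr 2

lemma suppDim_le {H : Type} [AddCommGroup H] [Module R H] (r : WithBot ℕ∞) (h : ∀ p ∈ Module.support R H, ringKrullDim (R ⧸ p.asIdeal) ≤ r) :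
    Order.krullDim (Module.support R H) ≤ r := by
  refine iSup_le fun s => ?_
  refine le_trans ?_ (h s.head s.head.2)
  rw [ringKrullDim_quotient]
  let s' : LTSeries (PrimeSpectrum.zeroLocus (R := R) ((s.head : PrimeSpectrum R).asIdeal : Set R)) :=
    { length := s.length
      toFun := fun j => ⟨(s j : PrimeSpectrum R), by
        have : s.head ≤ s j := LTSeries.head_le _ _
        exact this⟩
      step := fun j => s.step j }
  exact le_iSup (fun s : LTSeries (PrimeSpectrum.zeroLocus (R := R) ((s.head : PrimeSpectrum R).asIdeal : Set R)) => (s.length : WithBot ℕ∞)) s'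

lemma le_suppDim {H : Type} [AddCommGroup H] [Module R H] (p : PrimeSpectrum R) (hp : p ∈ Module.support R H) :
    ringKrullDim (R ⧸ p.asIdeal) ≤ Order.krullDim (Module.support R H) := by
  rw [ringKrullDim_quotient]
  refine Order.krullDim_le_of_strictMono (fun q => ⟨q.1, Module.mem_support_mono (show p ≤ q.1 from q.2) hp⟩) ?_
  intro a b hab
  exact hab

lemma length_le_height [IsNoetherianRing R] (fs : List R) (hfs : IsWeaklyRegular R fs) (q : Ideal R) [q.IsPrime]
    (hq : ∀ a ∈ fs, a ∈ q) : (fs.length : ℕ∞) ≤ q.height := by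
  have h1 := hfs.isRegular_of_isLocalization_of_mem (Localization.AtPrime q) q hq
  have h2 := ringKrullDim_add_length_eq_ringKrullDim_of_isRegular _ h1
  rw [IsLocalization.AtPrime.ringKrullDim_eq_height q (Localization.AtPrime q), List.length_map] at h2
  have hnt : Nontrivial (Localization.AtPrime q ⧸ Ideal.ofList (fs.map (algebraMap R (Localization.AtPrime q)))) := by
    apply Ideal.Quotient.nontrivial_iff.2
    intro h
    apply h1.2
    simp [h]
  have h3 := ringKrullDim_nonneg_of_nontrivial (R := Localization.AtPrime q ⧸ Ideal.ofList (fs.map (algebraMap R (Localization.AtPrime q))))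
  have h4 : (fs.length : WithBot ℕ∞) ≤ (q.height : WithBot ℕ∞) := by
    rw [← h2]
    exact le_add_of_nonneg_left h3
  exact_mod_cast h4

lemma exists_c [IsNoetherianRing R] (I : Ideal R) (fs : List R) (hfs : IsWeaklyRegular R fs) (hfI : ∀ a ∈ fs, a ∈ I)
    (p : Ideal R) [p.IsPrime] (hIp : I ≤ p) (hp : p.height = fs.length) :
    ∃ c, c ∉ Ideal.ofList fs ∧ ∀ a ∈ I, a * c ∈ Ideal.ofList fs := by
  have hle : Ideal.ofList fs ≤ p := by
    rw [Ideal.ofList, Ideal.span_le]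
    exact fun a ha => hIp (hfI a ha)
  have hmin : p ∈ (Ideal.ofList fs).minimalPrimes := by
    obtain ⟨q, hq, hqp⟩ := Ideal.exists_minimalPrimes_le hle
    have := hq.isPrime
    have hq2 := length_le_height fs hfs q (fun a ha => hq.1.2 (Ideal.subset_span ha))
    rcases hqp.eq_or_lt with rfl | hlt
    · exact hq
    · have := Ideal.height_strict_mono_of_isPrime_of_isPrime hlt
      rw [hp] at this
      exact absurd hq2 (not_le.2 this)
  have hass := Module.associatedPrimes.minimalPrimes_annihilator_subset_associatedPrimes R (R ⧸ Ideal.ofList fs)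
    (by rw [Ideal.annihilator_quotient]; exact hmin)
  obtain ⟨hpp, c, hc⟩ := Submodule.isAssociatedPrime_iff.1 hass
  obtain ⟨c, rfl⟩ := Submodule.Quotient.mk_surjective _ c
  have key : ∀ a : R, a ∈ p ↔ a * c ∈ Ideal.ofList fs := by
    intro a
    rw [hc, Submodule.mem_colon_singleton, Submodule.mem_bot, ← Submodule.Quotient.mk_smul,
      Submodule.Quotient.mk_eq_zero, smul_eq_mul]
  refine ⟨c, fun h => hpp.ne_top ((Ideal.eq_top_iff_one p).2 ((key 1).2 (by rwa [one_mul]))),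
    fun a ha => (key a).1 (hIp ha)⟩

lemma main_lc [IsLocalRing R] [IsNoetherianRing R] {n : ℕ} (x : Fin n → R)
    (hx : Ideal.span (Set.range x) = maximalIdeal R) (hn : ringKrullDim R = (n : WithBot ℕ∞))
    (F : Type) [Field F] (i : F →+* R) (I : Ideal R) (hI : I ≠ ⊤) (d : ℕ) (p0 : PrimeSpectrum R)
    (hp0 : I ≤ p0.asIdeal) (hd0 : Order.height p0 = d) (hd : ∀ p : PrimeSpectrum R, I ≤ p.asIdeal → (d : ℕ∞) ≤ Order.height p) :
    ∃ r : ℕ, HasInjectiveDimensionLT (ModuleCat.of R ((localCohomology I d).obj (ModuleCat.of R R))) (r + 1) ∧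
      ¬ HasInjectiveDimensionLT (ModuleCat.of R ((localCohomology I d).obj (ModuleCat.of R R))) r ∧
      Order.krullDim (Module.support R ((localCohomology I d).obj (ModuleCat.of R R))) = (r : WithBot ℕ∞) := by
  have hsum : ∀ p : PrimeSpectrum R, Order.height p + Order.coheight p ≤ (n : ℕ∞) := by
    intro p
    have h := Order.krullDim_eq_iSup_height_add_coheight_of_nonempty (α := PrimeSpectrum R)
    have h2 : Order.krullDim (PrimeSpectrum R) = (n : WithBot ℕ∞) := hn
    rw [h2] at h
    have h3 : ((n : ℕ∞)) = ⨆ (a : PrimeSpectrum R), Order.height a + Order.coheight a := by exact_mod_cast h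
    rw [h3]
    exact le_iSup (fun a : PrimeSpectrum R => Order.height a + Order.coheight a) p
  have hdn : d ≤ n := by
    have := (le_self_add).trans (hsum p0)
    rw [hd0] at this
    exact_mod_cast this
  obtain ⟨r, rfl⟩ := Nat.exists_eq_add_of_le hdn
  have hdim : ∀ p : PrimeSpectrum R, I ≤ p.asIdeal → ringKrullDim (R ⧸ p.asIdeal) ≤ (r : WithBot ℕ∞) := by
    intro p hp
    rw [quot_dim_coheight]
    have h1 := (add_le_add_left (hd p hp) (Order.coheight p)).trans (hsum p)
    have h2 : Order.coheight p ≤ (r : ℕ∞) := by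
      have h1 : (d : ℕ∞) + Order.coheight p ≤ d + r := by exact_mod_cast h1
      exact (ENat.add_le_add_iff_left (ENat.natCast_ne_top d)).1 h1
    exact_mod_cast h2
  obtain ⟨fs, rfl, hfI, hfs⟩ := exists_fs x hx hn.ge I hI d r rfl (fun p hp hIp => hdim ⟨p, hp⟩ hIp)
  have hIm := le_maximalIdeal hI
  obtain ⟨T, _, _, io, ξ, hT, hio, hi, -, hb⟩ := exists_T fs (fun a ha => hIm (hfI a ha)) hfs.toIsWeaklyRegular
  obtain ⟨e⟩ := lc_model I fs.length ξ (by
    intro s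
    refine hb _ (fun a ha => ⟨s, fun z => ?_⟩) 0
    obtain ⟨z, rfl⟩ := Submodule.Quotient.mk_surjective _ z
    refine (Submodule.Quotient.mk_eq_zero _).2 ?_
    exact Ideal.mul_mem_right _ _ (Ideal.pow_mem_pow (hfI a ha) s))
  obtain ⟨c, hc, hIc⟩ := exists_c I fs hfs.toIsWeaklyRegular hfI p0.asIdeal hp0 (by rw [PrimeSpectrum.height_eq_orderHeight, hd0])
  have hlow := lower x hx hn.ge F i I fs hfs.toIsWeaklyRegular (fun a ha => hIm (hfI a ha)) io hT hio hi r le_rfl c hc hIc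
  have hcr := gam_isCrys I hT
  have hsupp : ∀ p ∈ Module.support R (Gam I T), I ≤ p.asIdeal := by
    intro p hp a ha
    by_contra hap
    obtain ⟨m, hm⟩ := Module.mem_support_iff'.1 hp
    obtain ⟨k, hk⟩ := m.2
    exact hm (a ^ k) (fun h => hap (p.2.mem_of_pow_mem k h)) (Subtype.ext (hk _ (Ideal.pow_mem_pow ha k)))
  have iso : ModuleCat.of R (Gam I T) ≅ ModuleCat.of R ((localCohomology I fs.length).obj (ModuleCat.of R R)) := e.toModuleIso
  refine ⟨r, ?_, ?_, ?_⟩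
  · have h1 := upper x hx hn.ge F i (r + 1) (Gam I T) hcr (fun p hp => (dimlt_iff _ _).2 (hdim p (hsupp p hp)))
    exact hasInjectiveDimensionLT_of_iso iso _
  · intro h
    exact hlow (hasInjectiveDimensionLT_of_iso iso.symm _)
  · rw [← LinearEquiv.support_eq e]
    refine le_antisymm (suppDim_le _ fun p hp => hdim p (hsupp p hp)) ?_
    by_contra hlt
    rw [not_le] at hlt
    exact hlow (upper x hx hn.ge F i r (Gam I T) hcr (fun p hp => (le_suppDim p hp).trans_lt hlt))

end
end LyuB

end

/-- Regular local ring `R` of dimension `n` containing a field, `I` a proper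
ideal of height `d`.  Then `inj.dim H_I^d(R) = dim H_I^d(R)`. -/
theorem stmt4 (R : Type) [CommRing R] [IsLocalRing R]
    (hreg : IsRegularLocal R) (hfield : ContainsField R)
    (n : ℕ) (hdim : ringKrullDim R = (n : WithBot ℕ∞))
    (I : Ideal R) (hI : I ≠ ⊤) (d : ℕ) (hht : idealHeight R I = (d : ℕ∞)) :
    (injDim R (LocalCohomologyMod R I d) : WithBot ℕ∞) =
      moduleSuppDim R (LocalCohomologyMod R I d) := by
  obtain ⟨hNoeth, s, hs, hcard⟩ := hreg
  rw [hdim] at hcard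
  have hcard' : s.card = n := by exact_mod_cast hcard
  obtain ⟨k, hk⟩ := hfield
  letI : Field k := hk.toField
  let e := (s.equivFinOfCardEq hcard').symm
  let x : Fin n → R := fun j => (e j : R)
  have hx : Ideal.span (Set.range x) = IsLocalRing.maximalIdeal R := by
    rw [← hs]
    congr 1
    ext a
    constructor
    · rintro ⟨j, rfl⟩
      exact (e j).2
    · intro ha
      exact ⟨e.symm ⟨a, ha⟩, by simp [x]⟩
  let S : Set ℕ∞ := {h : ℕ∞ | ∃ p : PrimeSpectrum R, I ≤ p.asIdeal ∧ Order.height p = h}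
  have hS : S.Nonempty := ⟨_, ⟨IsLocalRing.maximalIdeal R, inferInstance⟩, IsLocalRing.le_maximalIdeal hI, rfl⟩
  have hSd : sInf S = (d : ℕ∞) := hht
  obtain ⟨p0, hp0, hd0⟩ : (d : ℕ∞) ∈ S := hSd ▸ csInf_mem hS
  have hd : ∀ p : PrimeSpectrum R, I ≤ p.asIdeal → (d : ℕ∞) ≤ Order.height p := by
    intro p hp
    rw [← hSd]
    exact sInf_le ⟨p, hp, rfl⟩
  obtain ⟨r, h1, h2, h3⟩ := LyuB.main_lc x hx hdim k (k.subtype) I hI d p0 hp0 hd0 hd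
  have hinj : injDim R (LocalCohomologyMod R I d) = (r : ℕ∞) := by
    apply le_antisymm
    · refine sInf_le ⟨r, rfl, fun N i hi => ?_⟩
      have : Subsingleton (CategoryTheory.Abelian.Ext N (ModuleCat.of R (LocalCohomologyMod R I d)) i) :=
        h1.subsingleton _ (r + 1) i hi N
      exact (LyuB.cmp (projectiveResolution N) _ i).toEquiv.subsingleton
    · refine le_sInf ?_
      rintro _ ⟨m, rfl, hm⟩
      have hm' : HasInjectiveDimensionLT (ModuleCat.of R (LocalCohomologyMod R I d)) (m + 1) := by
        rw [hasInjectiveDimensionLT_iff]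
        intro i hi N y
        have := hm N i hi
        have : Subsingleton (CategoryTheory.Abelian.Ext N (ModuleCat.of R (LocalCohomologyMod R I d)) i) :=
          (LyuB.cmp (projectiveResolution N) _ i).symm.toEquiv.subsingleton
        exact Subsingleton.elim _ _
      by_contra hlt
      have hlt : m < r := by
        rw [not_le] at hlt
        exact_mod_cast hlt
      exact h2 (@hasInjectiveDimensionLT_of_ge _ _ _ _ (m + 1) r hlt hm')
  rw [hinj]
  exact h3.symm
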